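/- There is no binary linear code of length 30, dimension 12, and minimum distance at least 10. -/

import Mathlib

namespace BitGrid

/-! ### Arithmetic that the kernel evaluates eagerly -/

/-- Evaluation of `f` at `n`, arranged so that `n` is reduced to a numeral first. -/
def force {α : Sort*} (n : ℕ) (f : ℕ → α) : α :=
  match Nat.add n 1 with
  | 0 => f 0
  | Nat.succ m => f m

def forceList {α : Type} : List ℕ → (List ℕ → α) → α
  | [], c => c []
  | m :: l, c => force m fun a => forceList l fun l' => c (a :: l')

/-- A computation with state `σ` that may fail. -/
def Step (σ : Type) := σ → Option σ

def Step.seq {σ : Type} (f g : Step σ) : Step σ := fun s =>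
  match f s with
  | none => none
  | some t => g t

def Step.fail {σ : Type} : Step σ := fun _ => none

def append : List ℕ → List ℕ → List ℕ
  | [], l => l
  | a :: k, l => a :: append k l

def len : List ℕ → ℕ
  | [] => 0
  | _ :: l => Nat.succ (len l)

def headNat : List ℕ → ℕ
  | [] => 0
  | a :: _ => a

def tailNat : List ℕ → List ℕ
  | [] => []
  | _ :: l => l

def bitAt (A x : ℕ) : Bool := Nat.beq (Nat.land (Nat.shiftRight A x) 1) 1

/-! ### Sets of bit vectors as numbers

A set `X` of numbers below `2 ^ n` is represented by a number whose bit `64 + x` tells whether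
`x ∈ X`. The lowest 64 bits are irrelevant; `salt` fills them with a checksum, which keeps the
hash tables of the kernel efficient. -/

def salt (A : ℕ) : ℕ := Nat.lor A (Nat.mod A 2305843009213693951)

def lift (A : ℕ) : ℕ := salt (Nat.shiftLeft A 64)

def mem (A x : ℕ) : Bool := bitAt A (Nat.add 64 x)

def joinBits (n lo hi : ℕ) : ℕ := Nat.lor lo (Nat.shiftLeft hi (Nat.pow 2 n))

def fullSet (n : ℕ) : ℕ := Nat.sub (Nat.pow 2 (Nat.pow 2 n)) 1

def forBits {σ : Type} (f : ℕ → Step σ) : ℕ → ℕ → ℕ → Step σ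
  | 0, A, b => bif Nat.ble 18446744073709551616 A then f b else some
  | n + 1, A, b => bif Nat.ble 18446744073709551616 A then
      Step.seq
        (force (Nat.mod A (Nat.pow 2 (Nat.add 64 (Nat.pow 2 n)))) fun A' => forBits f n A' b)
        (force (salt (Nat.shiftRight A (Nat.pow 2 n))) fun A' =>
          force (Nat.add b (Nat.pow 2 n)) fun b' => forBits f n A' b')
      else some

def clearSet (i : ℕ) : ℕ → ℕ
  | 0 => 1
  | n + 1 => force (clearSet i n) fun A => bif Nat.beq i n then A else joinBits n A A

def clearMasks (n : ℕ) : ℕ → ℕ → List ℕ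
  | _, 0 => []
  | i, k + 1 => Nat.shiftLeft (clearSet i n) 64 :: clearMasks n (Nat.add i 1) k

def swapBits (sh mk A : ℕ) : ℕ :=
  Nat.lor (Nat.land (Nat.shiftRight A sh) mk) (Nat.shiftLeft (Nat.land A mk) sh)

/-- The set `{x ^^^ s | x ∈ A}`. -/
def shiftXor : ℕ → List ℕ → ℕ → ℕ → ℕ
  | _, [], A, _ => A
  | sh, mk :: l, A, s =>
      force (Nat.mul 2 sh) fun sh' => force (Nat.div s 2) fun s' =>
      bif Nat.beq (Nat.land s 1) 1
      then force (salt (swapBits sh mk A)) fun A' => shiftXor sh' l A' s'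
      else shiftXor sh' l A s'

def weightJoin (n : ℕ) : ℕ → List ℕ → List ℕ
  | p, [] => [joinBits n 0 p]
  | p, a :: l => joinBits n a p :: weightJoin n a l

/-- Passes on the list of the sets `{x | x has j bits}`. -/
def withWeights {α : Type} : ℕ → (List ℕ → α) → α
  | 0, c => c [1]
  | n + 1, c => withWeights n fun l => forceList (weightJoin n 0 l) c

def unionIf (f : ℕ → Bool) : ℕ → List ℕ → ℕ
  | _, [] => 0
  | j, A :: l => Nat.lor (bif f j then A else 0) (unionIf f (Nat.add j 1) l)

def paritySet (w : ℕ) : ℕ → ℕ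
  | 0 => 0
  | n + 1 => force (paritySet w n) fun A =>
      joinBits n A (bif bitAt w n then Nat.xor (fullSet n) A else A)

def diffSet (A B : ℕ) : ℕ := Nat.xor A (Nat.land A B)

/-! ### Exhaustive search for generator matrices with prescribed last columns -/

def ascFilter (mk mk' A : ℕ) : ℕ :=
  force (Nat.land A mk') fun B => Nat.xor A (Nat.xor B (Nat.land B mk))

def ascSet : ℕ → List ℕ → ℕ → ℕ → ℕ
  | _, [], _, A => A
  | mk, mk' :: l, Q, A =>
      force (Nat.div Q 2) fun Q' =>
      bif Nat.beq (Nat.land Q 1) 1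
      then force (ascFilter mk mk' A) fun A' => ascSet mk' l Q' A'
      else ascSet mk' l Q' A

def equalMask (Q r : ℕ) : ℕ := Nat.xor Q (Nat.land Q (Nat.xor r (Nat.shiftRight r 1)))

structure Tables where
  masks : List ℕ
  light : ℕ
  even : ℕ

def signTest (T : Tables) (r : ℕ) : List ℕ → Bool
  | [] => true
  | u :: us => force (Nat.xor u r) fun y =>
      bif mem T.light y then true else bif mem T.even y then signTest T r us else false

def mapXor (r : ℕ) : List ℕ → List ℕ
  | [] => []
  | u :: us => Nat.xor u r :: mapXor r us

def childFamily {α : Type} (T : Tables) (r : ℕ) : List ℕ → (List ℕ → α) → α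
  | x :: y :: l, c => force (Nat.land x (shiftXor 1 T.masks y r)) fun z =>
      childFamily T r l fun l' => c (z :: l')
  | _, c => c []

def search {σ : Type} (T : Tables) (leaf : List ℕ → Step σ) :
    ℕ → List ℕ → List ℕ → ℕ → List ℕ → Step σ
  | 0, _, _, _, acc => leaf acc
  | k + 1, fam, us, Q, acc =>
      force (ascSet (headNat T.masks) (tailNat T.masks) Q (headNat fam)) fun A =>
      forBits (fun r => bif signTest T r us then
        childFamily T r (tailNat fam) fun fam' =>
          forceList (append us (mapXor r us)) fun us' =>
          force (equalMask Q r) fun Q' =>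
          search T leaf k fam' us' Q' (r :: acc) else some) 16 A 0

def xorWords (b : ℕ) : List ℕ → List ℕ
  | [] => []
  | w :: l => w :: Nat.xor w b :: xorWords b l

/-- All sums of nonempty subfamilies. -/
def words : List ℕ → List ℕ
  | [] => []
  | b :: l => b :: xorWords b (words l)

def bitCount : ℕ → ℕ → ℕ
  | 0, _ => 0
  | n + 1, x => Nat.add (bif bitAt x n then 1 else 0) (bitCount n x)

def goodWeight (p j : ℕ) : Bool :=
  Nat.beq (Nat.land (Nat.add p j) 1) 0 &&
    (Nat.ble 10 (Nat.add p j) && Nat.ble (Nat.add 10 j) (Nat.add 16 p))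

def family (wt : List ℕ) : List ℕ → List ℕ
  | [] => []
  | b :: l => lift (unionIf (goodWeight (bitCount 8 b)) 0 wt) :: family wt l

def runSearch {σ : Type} (bs : List ℕ) (leaf : List ℕ → Step σ) : Step σ :=
  withWeights 16 fun wt =>
  forceList (clearMasks 16 0 16) fun ms =>
  force (lift (unionIf (fun j => Nat.ble j 7) 0 wt)) fun l8 =>
  force (lift (unionIf (fun j => Nat.beq j 8) 0 wt)) fun e8 =>
  forceList (family wt (words bs)) fun fam =>
  search ⟨ms, l8, e8⟩ leaf (len bs) fam [0] 32767 []

/-! ### Recognition of the codes found by the search -/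

def colXor (j : ℕ) : List ℕ → List ℕ → ℕ → ℕ
  | m :: ms, c :: cs, a => colXor j ms cs (bif bitAt m j then Nat.xor a c else a)
  | _, _, a => a

def unionCols (ms cs : List ℕ) (a : ℕ) : ℕ → ℕ → ℕ
  | 0, U => U
  | j + 1, U => force (Nat.lor U (Nat.pow 2 (colXor j ms cs a))) fun U' => unionCols ms cs a j U'

def unpack : ℕ → ℕ → List ℕ
  | 0, _ => []
  | k + 1, c => Nat.mod c 128 :: unpack k (Nat.div c 128)

/-- The code whose parity check matrix has as columns the powers of 2 below `2 ^ 17` and the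
list `s` has a generator matrix with these columns. -/
def genCol (j : ℕ) : List ℕ → ℕ
  | [] => 0
  | s :: l => Nat.add (bif bitAt s j then 1 else 0) (Nat.mul 2 (genCol j l))

def unionGenCols (s : List ℕ) : ℕ → ℕ → ℕ
  | 0, U => U
  | j + 1, U => force (Nat.lor U (Nat.pow 2 (genCol j s))) fun U' => unionGenCols s j U'

def genSet (s : List ℕ) : ℕ := unionGenCols s 17 (Nat.add 2 (Nat.add 4 (Nat.add 16 (Nat.add 256
  (Nat.add 65536 (Nat.add 4294967296 18446744073709551616))))))

def genSets : List (List ℕ) → List ℕ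
  | [] => []
  | s :: l => genSet s :: genSets l

def nth : List ℕ → ℕ → ℕ
  | [], _ => 0
  | a :: _, 0 => a
  | _ :: l, n + 1 => nth l n

def recognize (targets bs ms : List ℕ) : Step (List ℕ)
  | [] => none
  | c :: rest =>
    force (Nat.div c 8) fun d =>
    forceList (unpack 7 d) fun l =>
    force (unionCols bs (tailNat l) 0 8 (unionCols ms (tailNat l) (headNat l) 16 0)) fun U =>
    bif Nat.beq U (nth targets (Nat.mod c 8)) then some rest else none

def recognizeAll (codes : List (List ℕ)) (bs certs : List ℕ) : Bool :=
  forceList (genSets codes) fun targets =>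
  match runSearch bs (recognize targets (List.reverse bs)) certs with
  | none => false
  | some _ => true

/-! ### Gluing -/

def unionShift (ms : List ℕ) (A : ℕ) : List ℕ → ℕ → ℕ
  | [], B => B
  | s :: l, B => force (Nat.lor B (shiftXor 1 ms A s)) fun B' => unionShift ms A l B'

def withBall {α : Type} (ms cols : List ℕ) : ℕ → (ℕ → α) → α
  | 0, c => c (lift 1)
  | n + 1, c => withBall ms cols n fun A => force (unionShift ms A cols A) c

def unitCols : ℕ → List ℕ
  | 0 => []
  | n + 1 => Nat.pow 2 n :: unitCols n

def noEdgeAbove (G y z : ℕ) : List ℕ → Bool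
  | [] => true
  | u :: l => (bif mem G (Nat.xor y u) then bif mem G (Nat.xor z u) then false else true else true)
      && noEdgeAbove G y z l

def noTriangleAt (G y : ℕ) : List ℕ → Bool
  | [] => true
  | z :: l => (bif mem G (Nat.xor y z) then noEdgeAbove G y z l else true) && noTriangleAt G y l

def noTriangle (G : ℕ) : List ℕ → Bool
  | [] => true
  | y :: l => noTriangleAt G y l && noTriangle G l

def consStep (x : ℕ) : Step (List ℕ) := fun l => some (x :: l)

def edgeStep (ms : List ℕ) (G x : ℕ) : Step Unit := fun _ =>
  match force (Nat.land G (shiftXor 1 ms G x)) fun N => forBits consStep 17 N 0 [] with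
  | none => none
  | some l => bif noTriangle G l then some () else none

def allOdd : List ℕ → Bool
  | [] => true
  | s :: l => bitAt (bitCount 17 s) 0 && (Nat.ble s 131071 && allOdd l)

def glueTest (s : List ℕ) (w w' : ℕ) : Bool :=
  allOdd s && forceList (clearMasks 17 0 17) fun ms =>
  force (lift (paritySet 131071 17)) fun O =>
  force (lift (fullSet 17)) fun F =>
  withBall ms (append (unitCols 17) s) 7 fun A =>
  force (Nat.lor A O) fun B =>
  Nat.beq (Nat.shiftRight (diffSet F (Nat.lor A (diffSet F O))) 64) 0 &&
  force (salt (diffSet F B)) fun G =>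
  force (diffSet (diffSet G (lift (paritySet w 17))) (lift (paritySet w' 17))) fun X =>
    match forBits (edgeStep ms G) 17 X 0 () with
    | none => false
    | some _ => true

/-! ### Soundness of the set operations -/

theorem force_eq {α : Sort*} (n : ℕ) (f : ℕ → α) : force n f = f n := by
  cases n <;> rfl

theorem forceList_eq {α : Type} (l : List ℕ) (c : List ℕ → α) : forceList l c = c l := by
  induction l generalizing c with
  | nil => rfl
  | cons a l ih => simp only [forceList, force_eq, ih]

theorem append_eq (k l : List ℕ) : append k l = k ++ l := by
  induction k with
  | nil => rfl
  | cons a k ih => simp [append, ih]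

theorem len_eq (l : List ℕ) : len l = l.length := by
  induction l with
  | nil => rfl
  | cons a k ih => simp [len, ih]

theorem bitAt_eq (A x : ℕ) : bitAt A x = A.testBit x := by
  have h : bitAt A x = Nat.beq ((A >>> x) &&& 1) 1 := rfl
  rw [h, Nat.testBit_eq_decide_div_mod_eq, Nat.and_one_is_mod, Nat.shiftRight_eq_div_pow,
    Bool.eq_iff_iff, Nat.beq_eq, decide_eq_true_eq]

theorem mem_eq (A x : ℕ) : mem A x = A.testBit (64 + x) := bitAt_eq _ _

theorem mem_salt (A x : ℕ) : mem (salt A) x = mem A x := by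
  have h : salt A = A ||| A % 2305843009213693951 := rfl
  rw [mem_eq, mem_eq, h, Nat.testBit_or, Nat.testBit_lt_two_pow (x := A % 2305843009213693951),
    Bool.or_false]
  calc A % 2305843009213693951 < 2 ^ 64 := (Nat.mod_lt _ (by norm_num)).trans (by norm_num)
    _ ≤ _ := Nat.pow_le_pow_right (by norm_num) (by omega)

theorem mem_lift (A x : ℕ) : mem (lift A) x = A.testBit x := by
  have h : lift A = salt (A <<< 64) := rfl
  rw [h, mem_salt, mem_eq, Nat.testBit_shiftLeft]
  simp

theorem mem_land (A B x : ℕ) : mem (Nat.land A B) x = (mem A x && mem B x) := by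
  rw [mem_eq, mem_eq, mem_eq]
  exact Nat.testBit_and A B (64 + x)

theorem mem_lor (A B x : ℕ) : mem (Nat.lor A B) x = (mem A x || mem B x) := by
  rw [mem_eq, mem_eq, mem_eq]
  exact Nat.testBit_or A B (64 + x)

theorem mem_xor (A B x : ℕ) : mem (Nat.xor A B) x = (mem A x ^^ mem B x) := by
  rw [mem_eq, mem_eq, mem_eq]
  exact Nat.testBit_xor A B (64 + x)

theorem mem_diffSet (A B x : ℕ) : mem (diffSet A B) x = (mem A x && !mem B x) := by
  rw [diffSet, mem_xor, mem_land]
  cases mem A x <;> cases mem B x <;> rfl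

/-- `A` represents, without offset, the subset of `2 ^ n` with characteristic function `p`. -/
def Represents (n A : ℕ) (p : ℕ → Bool) : Prop :=
  A < 2 ^ 2 ^ n ∧ ∀ x < 2 ^ n, A.testBit x = p x

theorem testBit_joinBits {n lo : ℕ} (h : lo < 2 ^ 2 ^ n) (hi x : ℕ) :
    (joinBits n lo hi).testBit x = if x < 2 ^ n then lo.testBit x else hi.testBit (x - 2 ^ n) := by
  have h' : joinBits n lo hi = lo ||| hi <<< 2 ^ n := rfl
  rw [h', Nat.testBit_or, Nat.testBit_shiftLeft]
  split_ifs with hx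
  · simp [hx]
  · rw [Nat.testBit_lt_two_pow (h.trans_le (Nat.pow_le_pow_right (by norm_num) (by omega)))]
    simp [not_lt.1 hx]

theorem Represents.join {n A B : ℕ} {p q r : ℕ → Bool} (hA : Represents n A p)
    (hB : Represents n B q) (h0 : ∀ x < 2 ^ n, r x = p x) (h1 : ∀ x < 2 ^ n, r (2 ^ n + x) = q x) :
    Represents (n + 1) (joinBits n A B) r := by
  refine ⟨Nat.lt_pow_two_of_testBit _ fun i hi => ?_, fun x hx => ?_⟩
  · rw [pow_succ] at hi
    rw [testBit_joinBits hA.1, if_neg (by omega)]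
    exact Nat.testBit_lt_two_pow (hB.1.trans_le (Nat.pow_le_pow_right (by norm_num) (by omega)))
  · rw [pow_succ] at hx
    rw [testBit_joinBits hA.1]
    split_ifs with h
    · rw [hA.2 x h, h0 x h]
    · obtain ⟨y, rfl⟩ := Nat.exists_eq_add_of_le (not_lt.1 h)
      rw [Nat.add_sub_cancel_left, hB.2 y (by omega), h1 y (by omega)]

theorem represents_zero (n : ℕ) : Represents n 0 fun _ => false :=
  ⟨by positivity, fun x _ => Nat.zero_testBit x⟩

theorem represents_fullSet (n : ℕ) : Represents n (fullSet n) fun _ => true := by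
  have h : fullSet n = 2 ^ 2 ^ n - 1 := rfl
  refine ⟨?_, fun x hx => ?_⟩
  · rw [h]
    exact Nat.sub_lt (by positivity) one_pos
  · rw [h, Nat.testBit_two_pow_sub_one]
    simpa using hx

theorem Represents.mem_lift {n A : ℕ} {p : ℕ → Bool} (h : Represents n A p) {x : ℕ}
    (hx : x < 2 ^ n) : mem (lift A) x = p x := by
  rw [BitGrid.mem_lift, h.2 x hx]

theorem xor_two_pow_of_testBit_false {x i : ℕ} (h : x.testBit i = false) :
    x ^^^ 2 ^ i = x + 2 ^ i := by
  induction i generalizing x with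
  | zero =>
    rw [Nat.testBit_zero, decide_eq_false_iff_not] at h
    refine Nat.eq_of_testBit_eq fun j => ?_
    cases j with
    | zero => simp
    | succ j =>
      rw [Nat.testBit_succ, Nat.testBit_succ, Nat.xor_div_two, pow_zero,
        show (x + 1) / 2 = x / 2 by omega]
      simp
  | succ i ih =>
    rw [Nat.testBit_succ] at h
    have h1 : (x ^^^ 2 ^ (i + 1)) / 2 = x / 2 + 2 ^ i := by
      rw [Nat.xor_div_two, pow_succ, Nat.mul_div_cancel _ two_pos, ih h]
    have h2 : (x ^^^ 2 ^ (i + 1)) % 2 = x % 2 := by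
      have := Nat.testBit_xor x (2 ^ (i + 1)) 0
      simp only [Nat.testBit_zero, pow_succ] at this
      rcases Nat.mod_two_eq_zero_or_one x with h | h <;> simp_all [pow_succ]
    rw [pow_succ] at *
    omega

theorem testBit_xor_two_pow (x i j : ℕ) :
    (x ^^^ 2 ^ i).testBit j = (x.testBit j ^^ decide (i = j)) := by
  rw [Nat.testBit_xor, Nat.testBit_two_pow]

theorem testBit_two_pow_add (n x i : ℕ) (hx : x < 2 ^ n) :
    (2 ^ n + x).testBit i = (x.testBit i ^^ decide (n = i)) := by
  rw [add_comm, ← xor_two_pow_of_testBit_false (Nat.testBit_lt_two_pow hx), testBit_xor_two_pow]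

theorem represents_clearSet (i n : ℕ) :
    Represents n (clearSet i n) fun x => !x.testBit i := by
  induction n with
  | zero => exact ⟨by norm_num [clearSet], fun x hx => by simp_all [clearSet]⟩
  | succ n ih =>
    rw [clearSet, force_eq]
    have hx (x : ℕ) (h : x < 2 ^ n) := testBit_two_pow_add n x i h
    by_cases h : i = n
    · have h0 : clearSet i n = joinBits n (clearSet i n) 0 := by
        have : joinBits n (clearSet i n) 0 = clearSet i n ||| 0 <<< 2 ^ n := rfl
        simp [this]
      have hb : Nat.beq i n = true := by simpa using h
      rw [hb, cond_true, h0]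
      subst h
      exact ih.join (represents_zero i) (fun _ _ => rfl) fun x hx' => by
        simp [hx x hx', Nat.testBit_lt_two_pow hx']
    · have h1 : Nat.beq i n = false := by rwa [← Bool.not_eq_true, Nat.beq_eq]
      rw [h1, cond_false]
      exact ih.join ih (fun _ _ => rfl) fun x hx' => by simp [hx x hx', Ne.symm h]

/-! ### Iteration over a set -/

theorem forBits_sound {σ : Type} {f : ℕ → Step σ} {R : σ → σ → Prop} (hr : ∀ s, R s s)
    (ht : ∀ s t u, R s t → R t u → R s u) (hf : ∀ x s t, f x s = some t → R s t)
    {n A b : ℕ} {s t : σ} (h : forBits f n A b s = some t) :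
    R s t ∧ ∀ x < 2 ^ n, mem A x = true →
      ∃ s' t', R s s' ∧ f (b + x) s' = some t' ∧ R t' t := by
  have hm (A : ℕ) (hA : Nat.ble 18446744073709551616 A = false) (x : ℕ) : mem A x = false := by
    have hA : ¬18446744073709551616 ≤ A := fun h' => by
      rw [Nat.ble_eq_true_of_le h'] at hA
      cases hA
    rw [mem_eq]
    refine Nat.testBit_lt_two_pow ?_
    calc A < 2 ^ 64 := by omega
      _ ≤ _ := Nat.pow_le_pow_right (by norm_num) (by omega)
  induction n generalizing A b s t with
  | zero =>
    rw [forBits] at h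
    cases hA : Nat.ble 18446744073709551616 A with
    | false =>
      rw [hA] at h
      cases h
      exact ⟨hr _, fun x _ hx => by rw [hm A hA x] at hx; cases hx⟩
    | true =>
      rw [hA] at h
      refine ⟨hf _ _ _ h, fun x hx _ => ⟨s, t, hr _, ?_, hr _⟩⟩
      obtain rfl : x = 0 := by simpa using hx
      exact h
  | succ n ih =>
    rw [forBits] at h
    cases hA : Nat.ble 18446744073709551616 A with
    | false =>
      rw [hA] at h
      cases h
      exact ⟨hr _, fun x _ hx => by rw [hm A hA x] at hx; cases hx⟩
    | true =>
      rw [hA] at h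
      change Step.seq _ _ s = some t at h
      simp only [force_eq, Step.seq] at h
      split at h
      · cases h
      rename_i u hu
      obtain ⟨r1, h1⟩ := ih hu
      obtain ⟨r2, h2⟩ := ih h
      refine ⟨ht _ _ _ r1 r2, fun x hx hxA => ?_⟩
      rw [pow_succ] at hx
      rcases lt_or_ge x (2 ^ n) with hlt | hge
      · obtain ⟨s', t', a, b', c⟩ := h1 x hlt (by
          have : Nat.mod A (Nat.pow 2 (Nat.add 64 (Nat.pow 2 n))) = A % 2 ^ (64 + 2 ^ n) := rfl
          rw [mem_eq, this, Nat.testBit_mod_two_pow]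
          simpa [hlt, mem_eq] using hxA)
        exact ⟨s', t', a, b', ht _ _ _ c r2⟩
      · obtain ⟨y, rfl⟩ := Nat.exists_eq_add_of_le hge
        obtain ⟨s', t', a, b', c⟩ := h2 y (by omega) (by
          have : Nat.shiftRight A (Nat.pow 2 n) = A >>> 2 ^ n := rfl
          rw [mem_salt, mem_eq, this, Nat.testBit_shiftRight]
          rw [mem_eq] at hxA
          rwa [show 2 ^ n + (64 + y) = 64 + (2 ^ n + y) by ring])
        have hb : Nat.add b (Nat.pow 2 n) + y = b + (2 ^ n + y) := Nat.add_assoc b (2 ^ n) y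
        exact ⟨s', t', ht _ _ _ r1 a, hb ▸ b', c⟩

theorem forBits_exists {σ : Type} {f : ℕ → Step σ} {n A b : ℕ} {s t : σ}
    (h : forBits f n A b s = some t) {x : ℕ} (hx : x < 2 ^ n) (hA : mem A x = true) :
    ∃ s' t', f (b + x) s' = some t' := by
  obtain ⟨s', t', -, h', -⟩ := (forBits_sound (R := fun _ _ => True) (fun _ => trivial)
    (fun _ _ _ _ _ => trivial) (fun _ _ _ _ => trivial) h).2 x hx hA
  exact ⟨s', t', h'⟩

/-! ### Translation of a set -/

theorem mem_clearMask {n i x : ℕ} (hx : x < 2 ^ n) :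
    mem (Nat.shiftLeft (clearSet i n) 64) x = !x.testBit i := by
  have : Nat.shiftLeft (clearSet i n) 64 = clearSet i n <<< 64 := rfl
  rw [mem_eq, this, Nat.testBit_shiftLeft]
  simpa using (represents_clearSet i n).2 x hx

theorem mem_swapBits {n i A x : ℕ} (hx : x < 2 ^ n) :
    mem (swapBits (2 ^ i) (Nat.shiftLeft (clearSet i n) 64) A) x = mem A (x ^^^ 2 ^ i) := by
  have hp : 0 < 2 ^ i := by positivity
  set mk := Nat.shiftLeft (clearSet i n) 64 with hmk
  have hmk' : ∀ j < 64, mk.testBit j = false := fun j hj => by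
    have : mk = clearSet i n <<< 64 := rfl
    rw [this, Nat.testBit_shiftLeft]
    simp [hj]
  have h : swapBits (2 ^ i) mk A = (A >>> 2 ^ i &&& mk) ||| (A &&& mk) <<< 2 ^ i := rfl
  rw [h, mem_eq, Nat.testBit_or, Nat.testBit_and, Nat.testBit_shiftRight, Nat.testBit_shiftLeft,
    Nat.testBit_and, ← mem_eq mk, mem_clearMask hx, mem_eq]
  cases hb : x.testBit i with
  | false =>
    rw [xor_two_pow_of_testBit_false hb, show 2 ^ i + (64 + x) = 64 + (x + 2 ^ i) by ring]
    suffices (decide (64 + x ≥ 2 ^ i) && mk.testBit (64 + x - 2 ^ i)) = false by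
      revert this
      generalize decide (64 + x ≥ 2 ^ i) = a
      generalize mk.testBit (64 + x - 2 ^ i) = b
      generalize A.testBit (64 + x - 2 ^ i) = c
      cases a <;> cases b <;> cases c <;> simp
    rcases lt_or_ge x (2 ^ i) with h1 | h1
    · by_cases h2 : 64 + x ≥ 2 ^ i
      · rw [hmk' _ (by omega), Bool.and_false]
      · simp [h2]
    · obtain ⟨y, rfl⟩ := Nat.exists_eq_add_of_le' h1
      rw [show 64 + (y + 2 ^ i) - 2 ^ i = 64 + y by omega, ← mem_eq, mem_clearMask (by omega)]
      have h3 : y.testBit i = true := by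
        by_contra h3
        rw [Bool.not_eq_true] at h3
        rw [← xor_two_pow_of_testBit_false h3, testBit_xor_two_pow, h3] at hb
        simp at hb
      simp [h3]
  | true =>
    have h1 : (x ^^^ 2 ^ i).testBit i = false := by rw [testBit_xor_two_pow, hb]; simp
    have h2 := xor_two_pow_of_testBit_false h1
    rw [Nat.xor_assoc, Nat.xor_self, Nat.xor_zero] at h2
    rw [show 64 + x - 2 ^ i = 64 + (x ^^^ 2 ^ i) by omega, ← mem_eq mk, mem_clearMask (by omega),
      h1]
    simp only [Bool.not_true, Bool.and_false, Bool.not_false, Bool.and_true, Bool.false_or,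
      Bool.and_eq_right_iff_imp, decide_eq_true_eq]
    intro
    omega

theorem mem_shiftXor_aux {n : ℕ} (k m : ℕ) (hkm : k + m = n) (A s : ℕ) (hs : s < 2 ^ m) {x : ℕ}
    (hx : x < 2 ^ n) :
    mem (shiftXor (2 ^ k) (clearMasks n k m) A s) x = mem A (x ^^^ s * 2 ^ k) := by
  induction m generalizing k A s with
  | zero => simp_all [clearMasks, shiftXor]
  | succ m ih =>
    have e1 : Nat.mul 2 (2 ^ k) = 2 ^ (k + 1) := by rw [pow_succ']; rfl
    have e2 : Nat.div s 2 = s / 2 := rfl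
    rw [pow_succ] at hs
    simp only [clearMasks, shiftXor, force_eq, e1, e2]
    have hx2 : x ^^^ s / 2 * 2 ^ (k + 1) < 2 ^ n := by
      refine Nat.xor_lt_two_pow hx ?_
      calc s / 2 * 2 ^ (k + 1) < 2 ^ m * 2 ^ (k + 1) := by
            refine Nat.mul_lt_mul_of_pos_right (by omega) (by positivity)
        _ = 2 ^ n := by rw [← pow_add, ← hkm]; congr 1; omega
    have e3 : Nat.beq (Nat.land s 1) 1 = decide (s % 2 = 1) := by
      have : Nat.land s 1 = s % 2 := Nat.and_one_is_mod s
      rw [this, Bool.eq_iff_iff, Nat.beq_eq, decide_eq_true_eq]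
    rw [e3]
    rcases Nat.mod_two_eq_zero_or_one s with h | h
    · rw [h, decide_eq_false (by norm_num), cond_false, ih _ (by omega) _ _ (by omega)]
      congr 2
      rw [pow_succ']
      conv_rhs => rw [← Nat.div_add_mod s 2, h]
      ring
    · rw [h, decide_eq_true rfl, cond_true, ih _ (by omega) _ _ (by omega), mem_salt,
        mem_swapBits hx2]
      congr 1
      rw [Nat.xor_assoc]
      congr 1
      rw [xor_two_pow_of_testBit_false]
      · conv_rhs => rw [← Nat.div_add_mod s 2, h]
        ring
      · rw [Nat.testBit_mul_two_pow]
        simp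

theorem mem_shiftXor {n A s x : ℕ} (hs : s < 2 ^ n) (hx : x < 2 ^ n) :
    mem (shiftXor 1 (clearMasks n 0 n) A s) x = mem A (x ^^^ s) := by
  simpa using mem_shiftXor_aux 0 n (zero_add n) A s hs hx

/-! ### Soundness of the search -/

theorem bitCount_succ (n x : ℕ) :
    bitCount (n + 1) x = (if x.testBit n then 1 else 0) + bitCount n x := by
  have : bitCount (n + 1) x = (bif bitAt x n then 1 else 0) + bitCount n x := rfl
  rw [this, bitAt_eq]
  cases x.testBit n <;> rfl

theorem bitCount_eq_sum (n x : ℕ) :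
    bitCount n x = ∑ i ∈ Finset.range n, if x.testBit i then 1 else 0 := by
  induction n with
  | zero => rfl
  | succ n ih => rw [bitCount_succ, ih, Finset.sum_range_succ, add_comm]

theorem bitCount_two_pow_add {n x : ℕ} (hx : x < 2 ^ n) :
    bitCount (n + 1) (2 ^ n + x) = bitCount n x + 1 := by
  rw [bitCount_succ, bitCount_eq_sum, bitCount_eq_sum, testBit_two_pow_add n x n hx,
    Nat.testBit_lt_two_pow hx, add_comm]
  simp only [decide_true, Bool.false_xor, if_true, Nat.add_right_cancel_iff]
  refine Finset.sum_congr rfl fun i hi => ?_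
  rw [testBit_two_pow_add n x i hx, decide_eq_false (by have := Finset.mem_range.1 hi; omega),
    Bool.xor_false]

theorem bitCount_le (n x : ℕ) : bitCount n x ≤ n := by
  rw [bitCount_eq_sum]
  refine (Finset.sum_le_card_nsmul _ _ 1 fun i _ => ?_).trans (by simp)
  split_ifs <;> simp

theorem bitCount_succ_of_lt {n x : ℕ} (hx : x < 2 ^ n) :
    bitCount (n + 1) x = bitCount n x := by
  rw [bitCount_succ, Nat.testBit_lt_two_pow hx]
  simp

theorem weightJoin_represents {n : ℕ} {p : ℕ} {l : List ℕ} (a : ℕ)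
    (hp : Represents n p fun x => bitCount n x + 1 == a)
    (hl : ∀ j, (h : j < l.length) → Represents n l[j] fun x => bitCount n x == a + j) :
    (weightJoin n p l).length = l.length + 1 ∧
      ∀ j, (h : j < (weightJoin n p l).length) → a + l.length = n + 1 →
        Represents (n + 1) (weightJoin n p l)[j] fun x => bitCount (n + 1) x == a + j := by
  induction l generalizing p a with
  | nil =>
    refine ⟨rfl, fun j h ha => ?_⟩
    obtain rfl : j = 0 := by simpa [weightJoin] using h
    simp only [List.length_nil, add_zero] at ha
    refine (represents_zero n).join hp (fun x hx => ?_) fun x hx => ?_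
    · rw [bitCount_succ_of_lt hx]
      have := bitCount_le n x
      simp; omega
    · rw [bitCount_two_pow_add hx, add_zero]
  | cons b l ih =>
    have h0 : Represents n b fun x => bitCount n x == a := hl 0 (by simp)
    obtain ⟨h1, h2⟩ := ih (p := b) (a + 1) ⟨h0.1, fun x hx => by rw [h0.2 x hx]; simp⟩
      fun j h => by
        have := hl (j + 1) (by simpa using h)
        rwa [List.getElem_cons_succ, ← add_assoc, add_right_comm] at this
    refine ⟨by simp [weightJoin, h1], fun j h ha => ?_⟩
    cases j with
    | zero =>
      refine h0.join hp (fun x hx => ?_) fun x hx => ?_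
      · rw [bitCount_succ_of_lt hx, add_zero]
      · rw [bitCount_two_pow_add hx, add_zero]
    | succ j =>
      have := h2 j (by simpa [weightJoin] using h) (by simp at ha; omega)
      simpa [weightJoin, add_assoc, add_comm 1] using this

theorem withWeights_eq {α : Type} (n : ℕ) :
    ∃ l : List ℕ, l.length = n + 1 ∧
      (∀ j, (h : j < l.length) → Represents n l[j] fun x => bitCount n x == j) ∧
      ∀ c : List ℕ → α, withWeights n c = c l := by
  induction n with
  | zero =>
    refine ⟨[1], rfl, fun j h => ?_, fun c => rfl⟩
    obtain rfl : j = 0 := by simpa using h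
    exact ⟨by norm_num, fun x hx => by simp_all [bitCount]⟩
  | succ n ih =>
    obtain ⟨l, h1, h2, h3⟩ := ih
    obtain ⟨h4, h5⟩ := weightJoin_represents (n := n) (p := 0) (l := l) 0
      (by simpa using represents_zero n) (by simpa using h2)
    exact ⟨weightJoin n 0 l, by rw [h4, h1], fun j h => by simpa using h5 j h (by omega),
      fun c => by rw [withWeights, h3, forceList_eq]⟩

theorem testBit_unionIf {f : ℕ → Bool} {l : List ℕ} {i x : ℕ} (j : ℕ) (hi : i < l.length)
    (hf : f (j + i) = true) (hx : l[i].testBit x = true) : (unionIf f j l).testBit x = true := by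
  have (A : ℕ) (l : List ℕ) (j : ℕ) : unionIf f j (A :: l) =
      (bif f j then A else 0) ||| unionIf f (j + 1) l := rfl
  induction l generalizing i j with
  | nil => simp at hi
  | cons A l ih =>
    rw [this, Nat.testBit_or]
    cases i with
    | zero =>
      rw [add_zero] at hf
      simp_all
    | succ i =>
      rw [ih (j + 1) (by simpa using hi) (by rwa [add_assoc, add_comm 1]) (by simpa using hx),
        Bool.or_true]

/-- Some sum of `r` with an element of the list, preceded by such sums of weight 8 only, has weight
less than 8, or all of them have weight 8. -/
def SignedBy (r : ℕ) : List ℕ → Prop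
  | [] => True
  | u :: us => bitCount 16 (u ^^^ r) ≤ 7 ∨ bitCount 16 (u ^^^ r) = 8 ∧ SignedBy r us

def Signed : List ℕ → List ℕ → Prop
  | _, [] => True
  | us, r :: rs => SignedBy r us ∧ Signed (us ++ us.map (· ^^^ r)) rs

/-- The columns of the matrix with the given rows are in ascending lexicographic order, where
equality of columns `i` and `i + 1` in previous rows is recorded in the bit `i` of `Q`. -/
def Ascending : ℕ → List ℕ → Prop
  | _, [] => True
  | Q, r :: rs => (∀ i < 15, Q.testBit i = true → r.testBit i = true → r.testBit (i + 1) = true) ∧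
      Ascending (equalMask Q r) rs

theorem testBit_equalMask (Q r i : ℕ) :
    (equalMask Q r).testBit i = (Q.testBit i && (r.testBit i == r.testBit (i + 1))) := by
  have : equalMask Q r = Q ^^^ (Q &&& (r ^^^ r >>> 1)) := rfl
  rw [this, Nat.testBit_xor, Nat.testBit_and, Nat.testBit_xor, Nat.testBit_shiftRight, add_comm 1]
  cases Q.testBit i <;> cases r.testBit i <;> cases r.testBit (i + 1) <;> rfl

theorem mem_ascFilter {n i A x : ℕ} (hx : x < 2 ^ n) (hA : mem A x = true)
    (h : x.testBit i = true → x.testBit (i + 1) = true) :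
    mem (ascFilter (Nat.shiftLeft (clearSet i n) 64) (Nat.shiftLeft (clearSet (i + 1) n) 64) A) x =
      true := by
  rw [ascFilter, force_eq, mem_xor, mem_xor, mem_land (Nat.land _ _), mem_land,
    mem_clearMask hx, mem_clearMask hx, hA]
  revert h
  cases x.testBit i <;> cases x.testBit (i + 1) <;> simp

theorem mem_ascSet {n x : ℕ} (hx : x < 2 ^ n) (i k Q A : ℕ) (hA : mem A x = true)
    (h : ∀ j < k, Q.testBit j = true → x.testBit (i + j) = true → x.testBit (i + j + 1) = true) :
    mem (ascSet (Nat.shiftLeft (clearSet i n) 64) (clearMasks n (i + 1) k) Q A) x = true := by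
  induction k generalizing i Q A with
  | zero => exact hA
  | succ k ih =>
    have e3 : Nat.beq (Nat.land Q 1) 1 = Q.testBit 0 := bitAt_eq Q 0
    simp only [clearMasks, ascSet, force_eq, e3]
    have h' : ∀ j < k, (Nat.div Q 2).testBit j = true → x.testBit (i + 1 + j) = true →
        x.testBit (i + 1 + j + 1) = true := fun j hj h1 h2 => by
      have h3 : Nat.div Q 2 = Q / 2 := rfl
      rw [h3, ← Nat.testBit_succ] at h1
      rw [add_assoc i, add_comm 1] at h2 ⊢
      exact h (j + 1) (by omega) h1 h2
    cases h0 : Q.testBit 0 with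
    | false => exact ih _ _ _ hA h'
    | true => exact ih _ _ _ (mem_ascFilter hx hA (h 0 (by omega) h0)) h'

/-- The tables hold the words of length 16 with at most 7 ones and those with 8 ones. -/
def Tables.Valid (T : Tables) : Prop :=
  T.masks = clearMasks 16 0 16 ∧
    (∀ x < 2 ^ 16, bitCount 16 x ≤ 7 → mem T.light x = true) ∧
    ∀ x < 2 ^ 16, bitCount 16 x = 8 → mem T.even x = true

theorem signTest_eq_true {T : Tables} (hT : T.Valid) {r : ℕ} (hr : r < 2 ^ 16) {us : List ℕ}
    (hus : ∀ u ∈ us, u < 2 ^ 16) (h : SignedBy r us) : signTest T r us = true := by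
  induction us with
  | nil => rfl
  | cons u us ih =>
    have e : Nat.xor u r = u ^^^ r := rfl
    have hlt : u ^^^ r < 2 ^ 16 := Nat.xor_lt_two_pow (hus u (by simp)) hr
    simp only [signTest, force_eq, e]
    obtain h | ⟨h, h'⟩ := h
    · rw [hT.2.1 _ hlt h]
      rfl
    · rw [hT.2.2 _ hlt h, ih (fun u hu => hus u (by simp [hu])) h']
      cases mem T.light (u ^^^ r) <;> rfl

theorem mapXor_eq (r : ℕ) (l : List ℕ) : mapXor r l = l.map (· ^^^ r) := by
  induction l with
  | nil => rfl
  | cons u l ih =>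
    rw [mapXor, ih, List.map_cons]
    rfl

theorem xorWords_lt {n b : ℕ} {l : List ℕ} (hb : b < 2 ^ n) (hl : ∀ w ∈ l, w < 2 ^ n) :
    ∀ w ∈ xorWords b l, w < 2 ^ n := by
  induction l with
  | nil => simp [xorWords]
  | cons a l ih =>
    simp only [List.mem_cons, forall_eq_or_imp] at hl
    simp only [xorWords, List.mem_cons, forall_eq_or_imp]
    exact ⟨hl.1, Nat.xor_lt_two_pow hl.1 hb, ih hl.2⟩

theorem words_lt {n : ℕ} {l : List ℕ} (hl : ∀ w ∈ l, w < 2 ^ n) : ∀ w ∈ words l, w < 2 ^ n := by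
  induction l with
  | nil => simp [words]
  | cons b l ih =>
    simp only [List.mem_cons, forall_eq_or_imp] at hl
    simp only [words, List.mem_cons, forall_eq_or_imp]
    exact ⟨hl.1, xorWords_lt hl.1 (ih hl.2)⟩

theorem childFamily_eq {α : Type} {T : Tables} (hT : T.Valid) {r : ℕ} (hr : r < 2 ^ 16)
    {fam ws : List ℕ} (hws : ∀ w ∈ ws, w < 2 ^ 16)
    (h : List.Forall₂ (fun A w => mem A w = true) fam (xorWords r ws)) :
    ∃ fam' : List ℕ, List.Forall₂ (fun A w => mem A w = true) fam' ws ∧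
      ∀ c : List ℕ → α, childFamily T r fam c = c fam' := by
  induction ws generalizing fam with
  | nil =>
    obtain rfl := List.forall₂_nil_right_iff.1 h
    exact ⟨[], .nil, fun c => rfl⟩
  | cons w ws ih =>
    simp only [List.mem_cons, forall_eq_or_imp] at hws
    obtain ⟨x, famx, hx, hfx, rfl⟩ := List.forall₂_cons_right_iff.1 h
    obtain ⟨y, famy, hy, hfy, rfl⟩ := List.forall₂_cons_right_iff.1 hfx
    obtain ⟨fam', h1, h2⟩ := ih hws.2 hfy
    refine ⟨_, .cons (a := Nat.land x (shiftXor 1 T.masks y r)) ?_ h1, fun c => ?_⟩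
    · rw [mem_land, hx, hT.1, mem_shiftXor hr hws.1]
      exact hy
    · rw [childFamily, force_eq, h2]

theorem search_sound {σ : Type} {T : Tables} (hT : T.Valid) {leaf : List ℕ → Step σ} {k : ℕ}
    {fam us : List ℕ} {Q : ℕ} {acc : List ℕ} {s t : σ}
    (h : search T leaf k fam us Q acc s = some t) {ms : List ℕ} (hk : ms.length = k)
    (hus : ∀ u ∈ us, u < 2 ^ 16) (hms : ∀ m ∈ ms, m < 2 ^ 16)
    (hf : List.Forall₂ (fun A w => mem A w = true) fam (words ms)) (h1 : Signed us ms)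
    (h2 : Ascending Q ms) : ∃ s' t', leaf (ms.reverse ++ acc) s' = some t' := by
  induction ms generalizing k fam us Q acc s t with
  | nil =>
    obtain rfl : k = 0 := by simpa using hk.symm
    exact ⟨s, t, h⟩
  | cons r ms ih =>
    obtain rfl : k = ms.length + 1 := by simpa using hk.symm
    simp only [List.mem_cons, forall_eq_or_imp] at hms
    obtain ⟨A, fam, hA, hfam, rfl⟩ := List.forall₂_cons_right_iff.1 hf
    rw [search, force_eq] at h
    obtain ⟨s', t', h⟩ := forBits_exists h hms.1 (by
      rw [hT.1]
      exact mem_ascSet hms.1 0 15 Q A hA fun j hj h' => by simpa using h2.1 j hj h')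
    rw [zero_add, signTest_eq_true hT hms.1 hus h1.1] at h
    obtain ⟨fam', hf', he⟩ := childFamily_eq (α := Step σ) hT hms.1 (words_lt hms.2) hfam
    change childFamily (α := Step σ) T r fam _ s' = some t' at h
    rw [he, forceList_eq, force_eq] at h
    have := ih h rfl (fun u hu => ?_) hms.2 hf' ?_ h2.2
    · simpa using this
    · rw [append_eq, mapXor_eq, List.mem_append, List.mem_map] at hu
      obtain hu | ⟨u, hu, rfl⟩ := hu
      · exact hus u hu
      · exact Nat.xor_lt_two_pow (hus u hu) hms.1
    · rw [append_eq, mapXor_eq]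
      exact h1.2

theorem family_sound {wt ws vs : List ℕ} (hwt : wt.length = 17)
    (hr : ∀ j, (h : j < wt.length) → Represents 16 wt[j] fun x => bitCount 16 x == j)
    (hvs : ∀ v ∈ vs, v < 2 ^ 16)
    (h : List.Forall₂ (fun b v => goodWeight (bitCount 8 b) (bitCount 16 v) = true) ws vs) :
    List.Forall₂ (fun A v => mem A v = true) (family wt ws) vs := by
  induction h with
  | nil => exact .nil
  | @cons b v ws vs hb _ ih =>
    simp only [List.mem_cons, forall_eq_or_imp] at hvs
    refine .cons ?_ (ih hvs.2)
    rw [mem_lift]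
    have hlt : bitCount 16 v < wt.length := by have := bitCount_le 16 v; omega
    refine testBit_unionIf 0 hlt (by rwa [zero_add]) ?_
    rw [(hr _ hlt).2 _ hvs.1]
    simp

theorem runSearch_sound {σ : Type} {bs : List ℕ} {leaf : List ℕ → Step σ} {s t : σ}
    (h : runSearch bs leaf s = some t) {ms : List ℕ} (hk : ms.length = bs.length)
    (hms : ∀ m ∈ ms, m < 2 ^ 16)
    (hf : List.Forall₂ (fun b v => goodWeight (bitCount 8 b) (bitCount 16 v) = true)
      (words bs) (words ms))
    (h1 : Signed [0] ms) (h2 : Ascending 32767 ms) :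
    ∃ s' t', leaf ms.reverse s' = some t' := by
  obtain ⟨wt, hl, hwt, he⟩ := withWeights_eq (α := Step σ) 16
  rw [runSearch, he] at h
  simp only [forceList_eq, force_eq] at h
  have hT : Tables.Valid ⟨clearMasks 16 0 16, lift (unionIf (fun j => Nat.ble j 7) 0 wt),
      lift (unionIf (fun j => Nat.beq j 8) 0 wt)⟩ := by
    refine ⟨rfl, fun x hx hx' => ?_, fun x hx hx' => ?_⟩ <;>
    · have hlt : bitCount 16 x < wt.length := by omega
      rw [mem_lift]
      refine testBit_unionIf 0 hlt (by simpa using hx') ?_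
      rw [(hwt _ hlt).2 _ hx]
      simp
  have := search_sound hT h (by rw [hk, len_eq]) (by simp) hms
    (family_sound hl hwt (words_lt hms) hf) h1 h2
  simpa using this

/-! ### Soundness of the recognition -/

def bitz (x i : ℕ) : ZMod 2 := if x.testBit i then 1 else 0

theorem bitz_xor (x y i : ℕ) : bitz (x ^^^ y) i = bitz x i + bitz y i := by
  rw [bitz, bitz, bitz, Nat.testBit_xor]
  cases x.testBit i <;> cases y.testBit i <;> simp [CharTwo.add_self_eq_zero]

theorem bitz_eq_one {x i : ℕ} : bitz x i = 1 ↔ x.testBit i = true := by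
  rw [bitz]
  split_ifs with h <;> simp [h]

theorem bitz_zero_left (i : ℕ) : bitz 0 i = 0 := by simp [bitz]

theorem bitz_two_pow (k i : ℕ) : bitz (2 ^ k) i = if k = i then 1 else 0 := by
  simp [bitz, Nat.testBit_two_pow]

theorem testBit_unionCols (ms cs : List ℕ) (a n U i : ℕ) :
    (unionCols ms cs a n U).testBit i = true ↔
      U.testBit i = true ∨ ∃ j < n, colXor j ms cs a = i := by
  induction n generalizing U with
  | zero => simp [unionCols]
  | succ n ih =>
    have h : Nat.lor U (Nat.pow 2 (colXor n ms cs a)) = U ||| 2 ^ colXor n ms cs a := rfl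
    rw [unionCols, force_eq, ih, h, Nat.testBit_or, Nat.testBit_two_pow, Bool.or_eq_true,
      decide_eq_true_eq, or_assoc]
    refine or_congr_right ⟨?_, ?_⟩
    · rintro (h' | ⟨j, hj, h'⟩)
      · exact ⟨n, by omega, h'⟩
      · exact ⟨j, by omega, h'⟩
    · rintro ⟨j, hj, h'⟩
      obtain rfl | hj' := Nat.eq_or_lt_of_le (Nat.le_of_lt_succ hj)
      · exact .inl h'
      · exact .inr ⟨j, hj', h'⟩

theorem testBit_unionGenCols (s : List ℕ) (n U i : ℕ) :
    (unionGenCols s n U).testBit i = true ↔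
      U.testBit i = true ∨ ∃ j < n, genCol j s = i := by
  induction n generalizing U with
  | zero => simp [unionGenCols]
  | succ n ih =>
    have h : Nat.lor U (Nat.pow 2 (genCol n s)) = U ||| 2 ^ genCol n s := rfl
    rw [unionGenCols, force_eq, ih, h, Nat.testBit_or, Nat.testBit_two_pow, Bool.or_eq_true,
      decide_eq_true_eq, or_assoc]
    refine or_congr_right ⟨?_, ?_⟩
    · rintro (h' | ⟨j, hj, h'⟩)
      · exact ⟨n, by omega, h'⟩
      · exact ⟨j, by omega, h'⟩
    · rintro ⟨j, hj, h'⟩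
      obtain rfl | hj' := Nat.eq_or_lt_of_le (Nat.le_of_lt_succ hj)
      · exact .inl h'
      · exact .inr ⟨j, hj', h'⟩

theorem bitz_genCol (j : ℕ) (s : List ℕ) (a : ℕ) :
    bitz (genCol j s) a = bitz (s.getD a 0) j := by
  induction s generalizing a with
  | nil => simp [genCol, bitz]
  | cons b s ih =>
    have h : genCol j (b :: s) = (bif bitAt b j then 1 else 0) + 2 * genCol j s := rfl
    rw [h, bitAt_eq]
    clear h
    cases a with
    | zero =>
      rw [bitz, bitz, Nat.testBit_zero, List.getD_cons_zero]
      cases b.testBit j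
      · simp
      · simp [Nat.add_mod]
    | succ a =>
      rw [List.getD_cons_succ, ← ih, bitz, bitz, Nat.testBit_succ]
      congr 3
      cases b.testBit j <;> simp <;> omega

/-- The columns of a parity check matrix. -/
def col (s : List ℕ) (k : ℕ) : ℕ := if k < 17 then 2 ^ k else s.getD (k - 17) 0

/-- The columns of the corresponding generator matrix. -/
def dualCol (s : List ℕ) (k : ℕ) : ℕ := if k < 17 then genCol k s else 2 ^ (k - 17)

theorem testBit_genSet {s : List ℕ} {k : ℕ} (hk : k < 24) :
    (genSet s).testBit (dualCol s k) = true := by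
  rw [genSet, testBit_unionGenCols, dualCol]
  split_ifs with h
  · exact .inr ⟨k, h, rfl⟩
  · left
    interval_cases k <;> first | omega | decide

theorem genSets_eq (l : List (List ℕ)) : genSets l = l.map genSet := by
  induction l with
  | nil => rfl
  | cons s l ih => rw [genSets, ih, List.map_cons]

theorem nth_mem (l : List ℕ) (n : ℕ) : nth l n = 0 ∨ nth l n ∈ l := by
  induction l generalizing n with
  | nil => exact .inl rfl
  | cons a l ih =>
    cases n with
    | zero => exact .inr (by simp [nth])
    | succ n => exact (ih n).imp_right fun h => List.mem_cons_of_mem _ h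

theorem recognizeAll_sound {codes : List (List ℕ)} {bs certs : List ℕ}
    (h : recognizeAll codes bs certs = true) {ms : List ℕ} (hk : ms.length = bs.length)
    (hms : ∀ m ∈ ms, m < 2 ^ 16)
    (hf : List.Forall₂ (fun b v => goodWeight (bitCount 8 b) (bitCount 16 v) = true)
      (words bs) (words ms))
    (h1 : Signed [0] ms) (h2 : Ascending 32767 ms) :
    ∃ s ∈ codes, ∃ (a : ℕ) (cs : List ℕ), genSet s =
      unionCols bs.reverse cs 0 8 (unionCols ms.reverse cs a 16 0) := by
  rw [recognizeAll, forceList_eq] at h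
  split at h
  · cases h
  rename_i t ht
  obtain ⟨s', t', h⟩ := runSearch_sound ht hk hms hf h1 h2
  cases s' with
  | nil => cases h
  | cons c rest =>
    simp only [recognize, force_eq, forceList_eq] at h
    generalize unpack 7 (Nat.div c 8) = l at h
    generalize hn : nth (genSets codes) (Nat.mod c 8) = g at h
    cases hb : Nat.beq (unionCols bs.reverse (tailNat l) 0 8
        (unionCols ms.reverse (tailNat l) (headNat l) 16 0)) g with
    | false => rw [hb] at h; cases h
    | true =>
      rw [Nat.beq_eq] at hb
      have hg : g ≠ 0 := by
        have := (testBit_unionCols bs.reverse (tailNat l) 0 8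
          (unionCols ms.reverse (tailNat l) (headNat l) 16 0) _).2 (.inr ⟨0, by norm_num, rfl⟩)
        rw [hb] at this
        rintro rfl
        simp at this
      obtain h0 | h0 := nth_mem (genSets codes) (Nat.mod c 8)
      · exact absurd (hn ▸ h0) hg
      · rw [hn, genSets_eq, List.mem_map] at h0
        obtain ⟨s, hs, rfl⟩ := h0
        exact ⟨s, hs, headNat l, tailNat l, hb.symm⟩

abbrev V := Fin 30 → ZMod 2

/-- The code `K`, restricted to some coordinates in `T`, contains the code with parity check
matrix `col s`. -/
def HasForm (s : List ℕ) (K : Submodule (ZMod 2) V) (T : Finset (Fin 30)) : Prop :=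
  ∃ ρ : Fin 24 → Fin 30, Function.Injective ρ ∧ (∀ k, ρ k ∈ T) ∧
    ∀ e : Fin 24 → ZMod 2, (∀ i < 17, ∑ k : Fin 24, bitz (col s k) i * e k = 0) →
      ∃ v ∈ K, ∀ k, v (ρ k) = e k

/-- The combination of vectors with the bits `i` of the numbers in the list as coefficients. -/
def comb (i : ℕ) : List V → List ℕ → V
  | v :: vs, c :: cs => bitz c i • v + comb i vs cs
  | _, _ => 0

theorem comb_mem {K : Submodule (ZMod 2) V} (i : ℕ) {vs : List V} (h : ∀ v ∈ vs, v ∈ K)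
    (cs : List ℕ) : comb i vs cs ∈ K := by
  induction vs generalizing cs with
  | nil => exact K.zero_mem
  | cons v vs ih =>
    cases cs with
    | nil => exact K.zero_mem
    | cons c cs =>
      simp only [List.mem_cons, forall_eq_or_imp] at h
      exact K.add_mem (K.smul_mem _ h.1) (ih h.2 cs)

theorem bitz_colXor {j : ℕ} {t : Fin 30} {ms : List ℕ} {vs : List V}
    (h : List.Forall₂ (fun m v => v t = bitz m j) ms vs) (cs : List ℕ) (a i : ℕ) :
    bitz (colXor j ms cs a) i = bitz a i + comb i vs cs t := by
  induction h generalizing cs a with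
  | nil => simp [colXor, comb]
  | @cons m v ms vs hm _ ih =>
    cases cs with
    | nil => simp [colXor, comb]
    | cons c cs =>
      rw [colXor, ih, comb, bitAt_eq, Pi.add_apply, Pi.smul_apply, hm, smul_eq_mul, ← add_assoc]
      congr 1
      cases hb : m.testBit j with
      | false => simp [bitz, hb]
      | true =>
        have : Nat.xor a c = a ^^^ c := rfl
        rw [cond_true, this, bitz_xor, show bitz m j = 1 by simp [bitz, hb], mul_one]

theorem hasForm_of_genSet_eq {K : Submodule (ZMod 2) V} {T : Finset (Fin 30)} {s : List ℕ}
    (hs : ∀ k < 24, ∀ l < 24, dualCol s k = dualCol s l → k = l)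
    (σ : Fin 16 → Fin 30) (τ : Fin 8 → Fin 30) (hσ : ∀ j, σ j ∈ T) (hτ : ∀ j, τ j ∈ T)
    {h : V} (hh : h ∈ K) (h1 : ∀ j, h (σ j) = 1) (h0 : ∀ j, h (τ j) = 0)
    {vs : List V} (hvs : ∀ v ∈ vs, v ∈ K) {ms bs : List ℕ}
    (hms : List.Forall₂ (fun m v => ∀ j : Fin 16, v (σ j) = bitz m j) ms vs)
    (hbs : List.Forall₂ (fun b v => ∀ j : Fin 8, v (τ j) = bitz b j) bs vs)
    {a : ℕ} {cs : List ℕ}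
    (heq : genSet s = unionCols bs cs 0 8 (unionCols ms cs a 16 0)) : HasForm s K T := by
  have key (k : Fin 24) : ∃ t ∈ T, ∀ i, bitz (dualCol s k) i = bitz a i * h t + comb i vs cs t := by
    have := testBit_genSet (s := s) k.2
    rw [heq, testBit_unionCols, testBit_unionCols, Nat.zero_testBit] at this
    obtain (h' | ⟨j, hj, h'⟩) | ⟨j, hj, h'⟩ := this
    · cases h'
    · refine ⟨σ ⟨j, hj⟩, hσ _, fun i => ?_⟩
      rw [← h', bitz_colXor (hms.imp fun m v h => h ⟨j, hj⟩), h1, mul_one]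
    · refine ⟨τ ⟨j, hj⟩, hτ _, fun i => ?_⟩
      rw [← h', bitz_colXor (hbs.imp fun m v h => h ⟨j, hj⟩), h0, mul_zero, bitz_zero_left]
  choose ρ hρ hb using key
  refine ⟨ρ, fun k l hkl => ?_, hρ, fun e he => ?_⟩
  · refine Fin.ext (hs k k.2 l l.2 (Nat.eq_of_testBit_eq fun i => ?_))
    have : bitz (dualCol s k) i = bitz (dualCol s l) i := by rw [hb, hb, hkl]
    rw [Bool.eq_iff_iff, ← bitz_eq_one, ← bitz_eq_one, this]
  · refine ⟨∑ i : Fin 7, e (Fin.natAdd 17 i) • (bitz a i • h + comb i vs cs), K.sum_mem fun i _ =>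
      K.smul_mem _ (K.add_mem (K.smul_mem _ hh) (comb_mem _ hvs _)), fun k => ?_⟩
    have hv : (∑ i : Fin 7, e (Fin.natAdd 17 i) • (bitz a i • h + comb i vs cs)) (ρ k) =
        ∑ i : Fin 7, e (Fin.natAdd 17 i) * bitz (dualCol s k) i := by
      simp only [hb, Finset.sum_apply, Pi.smul_apply, Pi.add_apply, smul_eq_mul]
    rw [hv]
    by_cases hk : (k : ℕ) < 17
    · have hsum := he k hk
      rw [Fin.sum_univ_add (a := 17) (b := 7) (f := fun k' : Fin (17 + 7) => bitz (col s k') k * e k'),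
        Finset.sum_eq_single ⟨k, hk⟩] at hsum
      · have hc : bitz (col s ((Fin.castAdd 7 ⟨k, hk⟩ : Fin (17 + 7)) : ℕ)) k = 1 := by
          simp [col, hk, bitz_two_pow]
        rw [hc, one_mul] at hsum
        rw [CharTwo.add_eq_zero] at hsum
        refine Eq.trans ?_ hsum.symm
        refine Finset.sum_congr rfl fun i _ => ?_
        rw [mul_comm]
        congr 1
        simp [dualCol, hk, bitz_genCol, col]
      · intro l _ hl
        have : bitz (col s ((Fin.castAdd 7 l : Fin (17 + 7)) : ℕ)) k = 0 := by
          simp [col, bitz_two_pow, Fin.ext_iff] at hl ⊢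
          exact hl
        rw [this, zero_mul]
      · simp
    · obtain ⟨l, rfl⟩ : ∃ l : Fin 7, k = Fin.natAdd 17 l :=
        ⟨⟨k - 17, by omega⟩, Fin.ext (by simp; omega)⟩
      rw [Finset.sum_eq_single l]
      · simp [dualCol, bitz_two_pow]
      · intro i _ hi
        simp [dualCol, bitz_two_pow, Fin.ext_iff] at hi ⊢
        omega
      · simp

/-! ### Soundness of the gluing test -/

/-- The parity of the number of common bits of `w` and `x` below `n`. -/
def parity (w n x : ℕ) : ZMod 2 := ∑ i ∈ Finset.range n, bitz w i * bitz x i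

theorem parity_xor (w n x y : ℕ) : parity w n (x ^^^ y) = parity w n x + parity w n y := by
  simp only [parity, bitz_xor, mul_add, Finset.sum_add_distrib]

theorem parity_two_pow_add {n x : ℕ} (w : ℕ) (hx : x < 2 ^ n) :
    parity w (n + 1) (2 ^ n + x) = bitz w n + parity w n x := by
  have hb (i : ℕ) : bitz (2 ^ n + x) i = bitz x i + if n = i then 1 else 0 := by
    rw [add_comm, ← xor_two_pow_of_testBit_false (Nat.testBit_lt_two_pow hx), bitz_xor,
      bitz_two_pow]
  rw [parity, Finset.sum_range_succ, add_comm, hb]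
  congr 1
  · simp [bitz, Nat.testBit_lt_two_pow hx]
  · refine Finset.sum_congr rfl fun i hi => ?_
    rw [hb, if_neg (by have := Finset.mem_range.1 hi; omega), add_zero]

theorem parity_succ_of_lt {n x : ℕ} (w : ℕ) (hx : x < 2 ^ n) :
    parity w (n + 1) x = parity w n x := by
  rw [parity, Finset.sum_range_succ, parity]
  simp [bitz, Nat.testBit_lt_two_pow hx]

theorem represents_paritySet (w n : ℕ) :
    Represents n (paritySet w n) fun x => decide (parity w n x = 1) := by
  induction n with
  | zero => exact ⟨by norm_num [paritySet], fun x _ => by simp [paritySet, parity]⟩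
  | succ n ih =>
    rw [paritySet, force_eq, bitAt_eq]
    have hx (b : ZMod 2) : (1 + b = 1) ↔ ¬b = 1 := by revert b; decide
    cases hw : w.testBit n with
    | false =>
      refine ih.join ih (fun x hx => ?_) fun x hx => ?_
      · rw [parity_succ_of_lt w hx]
      · rw [parity_two_pow_add w hx]
        simp [bitz, hw]
    | true =>
      refine ih.join (q := fun x => !decide (parity w n x = 1)) ?_ (fun x hx => ?_) fun x hx' => ?_
      · have h : Nat.xor (fullSet n) (paritySet w n) = fullSet n ^^^ paritySet w n := rfl
        rw [cond_true, h]
        refine ⟨Nat.xor_lt_two_pow (represents_fullSet n).1 ih.1, fun x hx => ?_⟩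
        rw [Nat.testBit_xor, (represents_fullSet n).2 x hx, ih.2 x hx, Bool.true_xor]
      · rw [parity_succ_of_lt w hx]
      · rw [parity_two_pow_add w hx', show bitz w n = 1 by simp [bitz, hw]]
        simp [hx]

theorem parity_full (x : ℕ) : parity 131071 17 x = bitCount 17 x := by
  rw [parity, bitCount_eq_sum, Nat.cast_sum]
  refine Finset.sum_congr rfl fun i hi => ?_
  have h : bitz 131071 i = 1 := by
    have hi := Finset.mem_range.1 hi
    interval_cases i <;> rfl
  rw [h, one_mul, bitz]
  split_ifs <;> simp

/-- The number `x` encodes the syndrome of a vector of weight at most `n`. -/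
def Reach (s : List ℕ) (n x : ℕ) : Prop :=
  ∃ e : Fin 24 → ZMod 2, hammingNorm e ≤ n ∧
    ∀ i < 17, ∑ k : Fin 24, bitz (col s k) i * e k = bitz x i

theorem reach_zero (s : List ℕ) : Reach s 0 0 := ⟨0, by simp, by simp [bitz]⟩

theorem Reach.mono {s : List ℕ} {m n x : ℕ} (h : Reach s m x) (hmn : m ≤ n) : Reach s n x := by
  obtain ⟨e, h1, h2⟩ := h
  exact ⟨e, h1.trans hmn, h2⟩

theorem Reach.step {s : List ℕ} {n x : ℕ} (k : Fin 24) (h : Reach s n (x ^^^ col s k)) :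
    Reach s (n + 1) x := by
  obtain ⟨e, h1, h2⟩ := h
  refine ⟨e + Pi.single k 1, ?_, fun i hi => ?_⟩
  · have h3 : ({i | (e + Pi.single k 1 : Fin 24 → ZMod 2) i ≠ 0} : Finset (Fin 24)) ⊆
        insert k (Finset.univ.filter fun i => e i ≠ 0) := fun i hi => by
      by_cases hik : i = k <;> simp_all
    exact (Finset.card_le_card h3).trans ((Finset.card_insert_le _ _).trans
      (Nat.add_le_add_right h1 1))
  · simp only [Pi.add_apply, mul_add, Finset.sum_add_distrib, h2 i hi, bitz_xor]
    simp [Pi.single_apply, add_assoc, CharTwo.add_self_eq_zero]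

theorem mem_unionShift {n A x : ℕ} (hx : x < 2 ^ n) {l : List ℕ} (hl : ∀ c ∈ l, c < 2 ^ n) {B : ℕ}
    (h : mem (unionShift (clearMasks n 0 n) A l B) x = true) :
    mem B x = true ∨ ∃ c ∈ l, mem A (x ^^^ c) = true := by
  induction l generalizing B with
  | nil => exact .inl h
  | cons c l ih =>
    simp only [List.mem_cons, forall_eq_or_imp] at hl
    rw [unionShift, force_eq] at h
    obtain h | ⟨d, hd, h⟩ := ih hl.2 h
    · rw [mem_lor, mem_shiftXor hl.1 hx, Bool.or_eq_true] at h
      exact h.imp_right fun h => ⟨c, by simp, h⟩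
    · exact .inr ⟨d, by simp [hd], h⟩

theorem withBall_eq {α : Type} {s l : List ℕ} (hl : ∀ c ∈ l, c < 2 ^ 17 ∧ ∃ k : Fin 24, c = col s k)
    (n : ℕ) : ∃ A, (∀ x < 2 ^ 17, mem A x = true → Reach s n x) ∧
      ∀ c : ℕ → α, withBall (clearMasks 17 0 17) l n c = c A := by
  induction n with
  | zero =>
    refine ⟨lift 1, fun x hx h => ?_, fun c => rfl⟩
    rw [mem_lift, Nat.testBit_one_eq_true_iff_self_eq_zero] at h
    exact h ▸ reach_zero s
  | succ n ih =>
    obtain ⟨A, h1, h2⟩ := ih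
    refine ⟨_, fun x hx h => ?_, fun c => by rw [withBall, h2, force_eq]⟩
    obtain h | ⟨d, hd, h⟩ := mem_unionShift hx (fun c hc => (hl c hc).1) h
    · exact (h1 x hx h).mono (by omega)
    · obtain ⟨hlt, k, rfl⟩ := hl d hd
      exact (h1 _ (Nat.xor_lt_two_pow hx hlt) h).step k

theorem mem_unitCols {n c : ℕ} (h : c ∈ unitCols n) : ∃ k < n, c = 2 ^ k := by
  induction n with
  | zero => simp [unitCols] at h
  | succ n ih =>
    rw [unitCols, List.mem_cons] at h
    obtain rfl | h := h
    · exact ⟨n, by omega, rfl⟩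
    · obtain ⟨k, hk, rfl⟩ := ih h
      exact ⟨k, by omega, rfl⟩

theorem allOdd_iff {s : List ℕ} (h : allOdd s = true) :
    ∀ c ∈ s, c < 2 ^ 17 ∧ parity 131071 17 c = 1 := by
  induction s with
  | nil => simp
  | cons c s ih =>
    simp only [allOdd, Bool.and_eq_true, Nat.ble_eq, bitAt_eq, Nat.testBit_zero,
      decide_eq_true_eq] at h
    simp only [List.mem_cons, forall_eq_or_imp]
    refine ⟨⟨by omega, ?_⟩, ih h.2.2⟩
    rw [parity_full, ← Nat.cast_one, ZMod.natCast_eq_natCast_iff']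
    exact h.1

theorem noEdgeAbove_sound {G y z : ℕ} {l : List ℕ} (h : noEdgeAbove G y z l = true) :
    ∀ u ∈ l, mem G (y ^^^ u) = true → ¬mem G (z ^^^ u) = true := by
  induction l with
  | nil => simp
  | cons u l ih =>
    have e (a : ℕ) : Nat.xor a u = a ^^^ u := rfl
    simp only [noEdgeAbove, Bool.and_eq_true, e] at h
    simp only [List.mem_cons, forall_eq_or_imp]
    refine ⟨fun h1 h2 => ?_, ih h.2⟩
    rw [h1, h2] at h
    cases h.1

theorem noTriangleAt_sound {G y : ℕ} {l : List ℕ} (h : noTriangleAt G y l = true) :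
    ∀ z ∈ l, ∀ u ∈ l, z ≠ u → mem G (y ^^^ z) = true → mem G (y ^^^ u) = true →
      ¬mem G (z ^^^ u) = true := by
  induction l with
  | nil => simp
  | cons z l ih =>
    have e : Nat.xor y z = y ^^^ z := rfl
    rw [noTriangleAt, Bool.and_eq_true, e] at h
    have h1 (u : ℕ) (hu : u ∈ l) (h1 : mem G (y ^^^ z) = true) := by
      have h2 := h.1
      rw [h1] at h2
      exact noEdgeAbove_sound h2 u hu
    intro a ha b hb hab
    rw [List.mem_cons] at ha hb
    obtain rfl | ha := ha <;> obtain rfl | hb := hb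
    · exact absurd rfl hab
    · exact h1 b hb
    · rw [Nat.xor_comm a]
      exact fun h2 h3 => h1 a ha h3 h2
    · exact ih h.2 a ha b hb hab

theorem noTriangle_sound {G : ℕ} {l : List ℕ} (h : noTriangle G l = true) :
    ∀ y ∈ l, ∀ z ∈ l, ∀ u ∈ l, y ≠ z → y ≠ u → z ≠ u → mem G (y ^^^ z) = true →
      mem G (y ^^^ u) = true → ¬mem G (z ^^^ u) = true := by
  induction l with
  | nil => simp
  | cons a l ih =>
    simp only [noTriangle, Bool.and_eq_true] at h
    have h1 := noTriangleAt_sound h.1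
    intro y hy z hz u hu hyz hyu hzu
    rw [List.mem_cons] at hy hz hu
    obtain rfl | hy := hy
    · exact h1 z (hz.resolve_left hyz.symm) u (hu.resolve_left hyu.symm) hzu
    obtain rfl | hz := hz
    · rw [Nat.xor_comm y]
      exact fun h2 h3 h4 => h1 y hy u (hu.resolve_left hzu.symm) hyu h2 h4 h3
    obtain rfl | hu := hu
    · rw [Nat.xor_comm y u, Nat.xor_comm z u]
      exact fun h2 h3 h4 => h1 y hy z hz hyz h3 h4 h2
    · exact ih h.2 y hy z hz u hu hyz hyu hzu

theorem edgeStep_sound {G x : ℕ} (hx : x < 2 ^ 17) {s t : Unit}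
    (h : edgeStep (clearMasks 17 0 17) G x s = some t) {y z u : ℕ}
    (hy : y < 2 ^ 17) (hz : z < 2 ^ 17) (hu : u < 2 ^ 17)
    (hyG : mem G y = true) (hzG : mem G z = true) (huG : mem G u = true)
    (hyx : mem G (y ^^^ x) = true) (hzx : mem G (z ^^^ x) = true) (hux : mem G (u ^^^ x) = true)
    (hyz : y ≠ z) (hyu : y ≠ u) (hzu : z ≠ u) (h1 : mem G (y ^^^ z) = true)
    (h2 : mem G (y ^^^ u) = true) : ¬mem G (z ^^^ u) = true := by
  rw [edgeStep, force_eq] at h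
  split at h
  · cases h
  rename_i l hl
  have hl' (a : ℕ) (ha : a < 2 ^ 17) (h1 : mem G a = true) (h2 : mem G (a ^^^ x) = true) :
      a ∈ l := by
    obtain ⟨s', t', -, h4, h5⟩ := (forBits_sound (R := fun s t => ∀ a ∈ s, a ∈ t)
      (fun s a ha => ha) (fun s t u hs ht a ha => ht a (hs a ha))
      (fun x s t h a ha => by cases h; exact List.mem_cons_of_mem _ ha) hl).2 a ha
      (by rw [mem_land, mem_shiftXor hx ha, h1, h2]; rfl)
    cases h4
    exact h5 a (by simp)
  cases hn : noTriangle G l with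
  | false => rw [hn] at h; cases h
  | true =>
    exact noTriangle_sound hn y (hl' y hy hyG hyx) z (hl' z hz hzG hzx) u (hl' u hu huG hux)
      hyz hyu hzu h1 h2

/-- The syndrome of words of length 24, encoded as a number. -/
noncomputable def syndrome (s : List ℕ) (e : Fin 24 → ZMod 2) : ℕ :=
  Nat.ofBits fun i : Fin 17 => decide (∑ k : Fin 24, bitz (col s k) i * e k = 1)

theorem syndrome_lt (s : List ℕ) (e : Fin 24 → ZMod 2) : syndrome s e < 2 ^ 17 :=
  Nat.ofBits_lt_two_pow _

theorem bitz_syndrome (s : List ℕ) (e : Fin 24 → ZMod 2) {i : ℕ} (hi : i < 17) :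
    bitz (syndrome s e) i = ∑ k : Fin 24, bitz (col s k) i * e k := by
  have h (a : ZMod 2) : (if a = 1 then 1 else 0) = a := by revert a; decide
  rw [bitz, syndrome, Nat.testBit_ofBits_lt _ _ hi]
  simp [h]

theorem syndrome_add (s : List ℕ) (e f : Fin 24 → ZMod 2) :
    syndrome s (e + f) = syndrome s e ^^^ syndrome s f := by
  refine Nat.eq_of_testBit_eq fun i => ?_
  rw [Bool.eq_iff_iff, ← bitz_eq_one, ← bitz_eq_one]
  rcases lt_or_ge i 17 with hi | hi
  · rw [bitz_xor, bitz_syndrome _ _ hi, bitz_syndrome _ _ hi, bitz_syndrome _ _ hi]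
    simp [mul_add, Finset.sum_add_distrib]
  · have hlt (e : Fin 24 → ZMod 2) : syndrome s e < 2 ^ i :=
      (syndrome_lt s e).trans_le (Nat.pow_le_pow_right (by norm_num) hi)
    rw [bitz_eq_one, bitz_eq_one, Nat.testBit_lt_two_pow (hlt _),
      Nat.testBit_lt_two_pow (Nat.xor_lt_two_pow (hlt _) (hlt _))]

/-- The elements of a nonlinear set `G` of syndromes are not the differences of five points. -/
theorem glueTest_sound {s : List ℕ} {w w' : ℕ} (h : glueTest s w w' = true) (hs : s.length = 7) :
    (∀ x < 2 ^ 17, parity 131071 17 x = 1 → Reach s 7 x) ∧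
      ∀ x : Fin 5 → ℕ, (∀ i, x i < 2 ^ 17) → ¬∀ i j, i ≠ j → ¬Reach s 7 (x i ^^^ x j) := by
  rw [glueTest, Bool.and_eq_true] at h
  obtain ⟨ho, h⟩ := h
  rw [forceList_eq] at h
  simp only [force_eq] at h
  obtain ⟨A, hA, he⟩ := withBall_eq (α := Bool) (s := s) (l := append (unitCols 17) s)
    (fun c hc => by
      rw [append_eq, List.mem_append] at hc
      obtain hc | hc := hc
      · obtain ⟨k, hk, rfl⟩ := mem_unitCols hc
        exact ⟨Nat.pow_lt_pow_right (by norm_num) hk, ⟨k, by omega⟩, by simp [col, hk]⟩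
      · obtain ⟨i, hi, rfl⟩ := List.getElem_of_mem hc
        exact ⟨(allOdd_iff ho _ hc).1, ⟨17 + i, by omega⟩, by simp [col, hi]⟩) 7
  rw [he, Bool.and_eq_true] at h
  obtain ⟨h1, h2⟩ := h
  have mO (x : ℕ) (hx : x < 2 ^ 17) :
      mem (lift (paritySet 131071 17)) x = decide (parity 131071 17 x = 1) :=
    (represents_paritySet _ _).mem_lift hx
  have mF (x : ℕ) (hx : x < 2 ^ 17) : mem (lift (fullSet 17)) x = true :=
    (represents_fullSet _).mem_lift hx
  generalize lift (paritySet 131071 17) = O at h1 h2 mO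
  generalize lift (fullSet 17) = F at h1 h2 mF
  have hodd : ∀ x < 2 ^ 17, parity 131071 17 x = 1 → mem A x = true := fun x hx hp => by
    have h3 : mem (diffSet F (Nat.lor A (diffSet F O))) x = false := by
      rw [Nat.beq_eq] at h1
      have h4 := Nat.testBit_shiftRight (i := 64) (j := x)
        (diffSet F (Nat.lor A (diffSet F O)))
      rw [mem_eq, ← h4]
      exact (congrArg (·.testBit x) h1).trans (Nat.zero_testBit x)
    rw [mem_diffSet, mem_lor, mem_diffSet, mF x hx, mO x hx, decide_eq_true hp] at h3
    simpa using h3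
  refine ⟨fun x hx hp => hA x hx (hodd x hx hp), fun x hx hxG => ?_⟩
  have mG (y : ℕ) (hy : y < 2 ^ 17) (h : ¬Reach s 7 y) :
      mem (salt (diffSet F (Nat.lor A O))) y = true := by
    have h3 : mem A y = false := by
      rw [← Bool.not_eq_true]
      exact fun h' => h (hA y hy h')
    have h4 : mem O y = false := by
      rw [mO y hy, decide_eq_false_iff_not]
      intro h'
      rw [hodd y hy h'] at h3
      cases h3
    rw [mem_salt, mem_diffSet, mem_lor, mF y hy, h3, h4]
    rfl
  generalize salt (diffSet F (Nat.lor A O)) = G at h2 mG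
  obtain ⟨i, j, hij, hc⟩ := Fintype.exists_ne_map_eq_of_card_lt
    (fun i => (parity w 17 (x i), parity w' 17 (x i)))
    (by decide : Fintype.card (ZMod 2 × ZMod 2) < Fintype.card (Fin 5))
  obtain ⟨a, b, c, hai, haj, hbi, hbj, hci, hcj, hab, hac, hbc⟩ :
      ∃ a b c : Fin 5, a ≠ i ∧ a ≠ j ∧ b ≠ i ∧ b ≠ j ∧ c ≠ i ∧ c ≠ j ∧ a ≠ b ∧ a ≠ c ∧ b ≠ c := by
    clear hc
    revert i j
    decide
  have hlt (i j : Fin 5) : x i ^^^ x j < 2 ^ 17 := Nat.xor_lt_two_pow (hx i) (hx j)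
  have hg (i j : Fin 5) (hij : i ≠ j) : mem G (x i ^^^ x j) = true := mG _ (hlt i j) (hxG i j hij)
  split at h2
  · cases h2
  rename_i t ht
  obtain ⟨s', t', h3⟩ := forBits_exists ht (hlt i j) (by
    have hw (w : ℕ) (hc : parity w 17 (x i) = parity w 17 (x j)) :
        mem (lift (paritySet w 17)) (x i ^^^ x j) = false := by
      rw [(represents_paritySet _ _).mem_lift (hlt i j), parity_xor, hc, CharTwo.add_self_eq_zero]
      simp
    rw [mem_diffSet, mem_diffSet, hg i j hij, hw w (Prod.ext_iff.1 hc).1,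
      hw w' (Prod.ext_iff.1 hc).2]
    rfl)
  rw [zero_add] at h3
  have hcancel (i j k : Fin 5) : (x i ^^^ x k) ^^^ (x j ^^^ x k) = x i ^^^ x j := by
    rw [Nat.xor_comm (x j), Nat.xor_assoc, ← Nat.xor_assoc (x k), Nat.xor_self, Nat.zero_xor]
  have hcancel' (i j k : Fin 5) : (x k ^^^ x j) ^^^ (x i ^^^ x j) = x k ^^^ x i := hcancel k i j
  have hne (a b : Fin 5) (hab : a ≠ b) : x a ^^^ x j ≠ x b ^^^ x j := fun h => by
    have h4 := hcancel a b j
    rw [h, Nat.xor_self] at h4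
    exact hxG a b hab (h4 ▸ (reach_zero s).mono (by norm_num))
  refine edgeStep_sound (hlt i j) h3 (hlt a j) (hlt b j) (hlt c j) (hg a j haj) (hg b j hbj)
    (hg c j hcj) ?_ ?_ ?_ (hne a b hab) (hne a c hac) (hne b c hbc) ?_ ?_ ?_
  all_goals rw [hcancel]
  exacts [hg a i hai, hg b i hbi, hg c i hci, hg a b hab, hg a c hac, hg b c hbc]

/-- The weight of the restriction of `v` to `T`. -/
def wt (T : Finset (Fin 30)) (v : V) : ℕ := (T.filter fun t => v t ≠ 0).card

theorem parity_two_pow {k : ℕ} (hk : k < 17) : parity 131071 17 (2 ^ k) = 1 := by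
  rw [parity, Finset.sum_eq_single k]
  · interval_cases k <;> rfl
  · intro i _ hi
    rw [bitz_two_pow, if_neg hi.symm, mul_zero]
  · intro h
    exact absurd (Finset.mem_range.2 hk) h

theorem parity_col {s : List ℕ} (hs : s.length = 7) (hodd : allOdd s = true) (k : Fin 24) :
    parity 131071 17 (col s k) = 1 := by
  rw [col]
  split_ifs with hk
  · exact parity_two_pow hk
  · have hlt : (k : ℕ) - 17 < s.length := by omega
    rw [List.getD_eq_getElem _ _ hlt]
    exact (allOdd_iff hodd _ (List.getElem_mem _)).2

theorem parity_syndrome {s : List ℕ} (hs : s.length = 7) (hodd : allOdd s = true)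
    (e : Fin 24 → ZMod 2) : parity 131071 17 (syndrome s e) = ∑ k : Fin 24, e k := by
  have hsum : parity 131071 17 (syndrome s e) =
      ∑ k : Fin 24, parity 131071 17 (col s k) * e k := by
    simp only [parity, Finset.sum_mul]
    rw [Finset.sum_comm]
    refine Finset.sum_congr rfl fun i hi => ?_
    rw [bitz_syndrome _ _ (Finset.mem_range.1 hi), Finset.mul_sum]
    exact Finset.sum_congr rfl fun k _ => (mul_assoc _ _ _).symm
  rw [hsum]
  exact Finset.sum_congr rfl fun k _ => by rw [parity_col hs hodd, one_mul]

theorem HasForm.exists_wt_le {s : List ℕ} {K : Submodule (ZMod 2) V} {T : Finset (Fin 30)}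
    (h : HasForm s K T) (hT : T.card = 24) (hs : s.length = 7) (hodd : allOdd s = true) :
    ∃ f : V → ℕ, (∀ v, f v < 2 ^ 17) ∧ (∀ u v, f (u + v) = f u ^^^ f v) ∧
      (∀ v, parity 131071 17 (f v) = ∑ t ∈ T, v t) ∧
      ∀ v, Reach s 7 (f v) → ∃ u ∈ K, wt T (v + u) ≤ 7 := by
  obtain ⟨ρ, hi, hρ, hK⟩ := h
  have hTρ : T = Finset.univ.map ⟨ρ, hi⟩ := by
    refine (Finset.eq_of_subset_of_card_le (fun t ht => ?_) ?_).symm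
    · obtain ⟨k, -, rfl⟩ := Finset.mem_map.1 ht
      exact hρ k
    · simp [hT]
  refine ⟨fun v => syndrome s (v ∘ ρ), fun v => syndrome_lt _ _, fun u v => syndrome_add _ _ _,
    fun v => ?_, fun v hv => ?_⟩
  · rw [parity_syndrome hs hodd, hTρ, Finset.sum_map]
    rfl
  · obtain ⟨e, h1, h2⟩ := hv
    have h3 (i : ℕ) (hi : i < 17) :
        ∑ k : Fin 24, bitz (col s k) i * (fun k => v (ρ k) + e k) k = 0 := by
      have h4 := bitz_syndrome s (v ∘ ρ) hi
      have h5 := h2 i hi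
      rw [h4] at h5
      simp only [mul_add, Finset.sum_add_distrib]
      rw [h5]
      exact CharTwo.add_self_eq_zero _
    obtain ⟨u, hu, hue⟩ := hK _ h3
    refine ⟨u, hu, ?_⟩
    rw [wt, hTρ, Finset.filter_map, Finset.card_map]
    refine (le_of_eq ?_).trans h1
    rw [hammingNorm]
    congr 1
    ext k
    simp [hue, ← add_assoc, CharTwo.add_self_eq_zero]

theorem HasForm.glue {s : List ℕ} {K : Submodule (ZMod 2) V} {T : Finset (Fin 30)}
    (h : HasForm s K T) (hT : T.card = 24) (hs : s.length = 7) {w w' : ℕ}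
    (hg : glueTest s w w' = true) :
    (∀ q : V, ∑ t ∈ T, q t = 1 → ∃ u ∈ K, wt T (q + u) ≤ 7) ∧
      ∀ q : Fin 5 → V, ∃ i j, i ≠ j ∧ ∃ u ∈ K, wt T (q i + q j + u) ≤ 7 := by
  have hodd : allOdd s = true := by
    rw [glueTest, Bool.and_eq_true] at hg
    exact hg.1
  obtain ⟨f, h1, h2, h3, h4⟩ := h.exists_wt_le hT hs hodd
  obtain ⟨h5, h6⟩ := glueTest_sound hg hs
  refine ⟨fun q hq => h4 q (h5 _ (h1 q) (by rw [h3, hq])), fun q => ?_⟩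
  by_contra! hc
  refine h6 (fun i => f (q i)) (fun i => h1 _) fun i j hij hr => ?_
  rw [← h2] at hr
  obtain ⟨u, hu, hw⟩ := h4 _ hr
  exact absurd (hc i j hij u hu) (by omega)

/-! ### Normalized generator matrices -/

/-- A word, encoded as a number. -/
noncomputable def encode {n : ℕ} (e : Fin n → ZMod 2) : ℕ := Nat.ofBits fun i => decide (e i = 1)

theorem encode_lt {n : ℕ} (e : Fin n → ZMod 2) : encode e < 2 ^ n := Nat.ofBits_lt_two_pow _

theorem testBit_encode {n : ℕ} (e : Fin n → ZMod 2) (i : Fin n) :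
    (encode e).testBit i = decide (e i = 1) := by
  rw [encode, Nat.testBit_ofBits_lt _ _ i.2]

theorem bitz_encode {n : ℕ} (e : Fin n → ZMod 2) (i : Fin n) : bitz (encode e) i = e i := by
  have h (a : ZMod 2) : (if a = 1 then 1 else 0) = a := by revert a; decide
  rw [bitz, testBit_encode]
  simp [h]

theorem bitCount_eq_hammingNorm {n x : ℕ} {e : Fin n → ZMod 2} (h : ∀ i : Fin n, e i = bitz x i) :
    bitCount n x = hammingNorm e := by
  rw [bitCount_eq_sum, ← Fin.sum_univ_eq_sum_range (fun i => if x.testBit i then 1 else 0),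
    ← Finset.sum_filter, Finset.sum_const, smul_eq_mul, mul_one, hammingNorm]
  congr 1
  ext i
  simp [h, bitz]

theorem eq_of_bitz {n x y : ℕ} (hx : x < 2 ^ n) (hy : y < 2 ^ n)
    (h : ∀ i : Fin n, bitz x i = bitz y i) : x = y := by
  refine Nat.eq_of_testBit_eq fun i => ?_
  rcases lt_or_ge i n with hi | hi
  · rw [Bool.eq_iff_iff, ← bitz_eq_one, ← bitz_eq_one, h ⟨i, hi⟩]
  · rw [Nat.testBit_lt_two_pow (hx.trans_le (Nat.pow_le_pow_right (by norm_num) hi)),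
      Nat.testBit_lt_two_pow (hy.trans_le (Nat.pow_le_pow_right (by norm_num) hi))]

theorem encode_add {n : ℕ} (e f : Fin n → ZMod 2) : encode (e + f) = encode e ^^^ encode f :=
  eq_of_bitz (encode_lt _) (Nat.xor_lt_two_pow (encode_lt _) (encode_lt _)) fun i => by
    rw [bitz_xor, bitz_encode, bitz_encode, bitz_encode, Pi.add_apply]

theorem encode_zero {n : ℕ} : encode (0 : Fin n → ZMod 2) = 0 :=
  eq_of_bitz (encode_lt _) (by positivity) fun i => by rw [bitz_encode, bitz_zero_left, Pi.zero_apply]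

theorem bitCount_encode {n : ℕ} (e : Fin n → ZMod 2) : bitCount n (encode e) = hammingNorm e :=
  bitCount_eq_hammingNorm fun i => (bitz_encode e i).symm

theorem hammingNorm_comp_perm {n : ℕ} (e : Fin n → ZMod 2) (π : Equiv.Perm (Fin n)) :
    hammingNorm (e ∘ π) = hammingNorm e := by
  rw [hammingNorm, hammingNorm, ← Finset.card_map π.toEmbedding]
  congr 1
  ext i
  simp

theorem hammingNorm_add_one {n : ℕ} (e : Fin n → ZMod 2) :
    hammingNorm (e + 1) + hammingNorm e = n := by
  have h := Finset.card_filter_add_card_filter_not (s := (Finset.univ : Finset (Fin n)))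
    fun i => e i = 0
  rw [Finset.card_univ, Fintype.card_fin] at h
  have ha (a : ZMod 2) : a + 1 ≠ 0 ↔ a = 0 := by revert a; decide
  rw [hammingNorm, hammingNorm]
  simpa only [Pi.add_apply, Pi.one_apply, ha] using h

/-- The property `SignedBy` for words. -/
def LightBy (σ : Fin 16 → Fin 30) (r : V) : List V → Prop
  | [] => True
  | u :: us => hammingNorm ((u + r) ∘ σ) ≤ 7 ∨ hammingNorm ((u + r) ∘ σ) = 8 ∧ LightBy σ r us

/-- The property `Signed` for words. -/
def Light (σ : Fin 16 → Fin 30) : List V → List V → Prop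
  | _, [] => True
  | us, r :: rs => LightBy σ r us ∧ Light σ (us ++ us.map (· + r)) rs

theorem lightBy_or {σ : Fin 16 → Fin 30} {h : V} (h1 : ∀ j, h (σ j) = 1) (v : V) (us : List V) :
    LightBy σ v us ∨ LightBy σ (v + h) us := by
  induction us with
  | nil => exact .inl trivial
  | cons u us ih =>
    have h2 := hammingNorm_add_one ((u + v) ∘ σ)
    have h3 : (u + (v + h)) ∘ σ = (u + v) ∘ σ + 1 := by
      ext j
      simp [h1, add_assoc]
    simp only [LightBy, h3]
    obtain h4 | h4 | h4 : hammingNorm ((u + v) ∘ σ) ≤ 7 ∨ hammingNorm ((u + v) ∘ σ) = 8 ∨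
        hammingNorm ((u + v) ∘ σ + 1) ≤ 7 := by omega
    · exact .inl (.inl h4)
    · exact ih.imp (fun h => .inr ⟨h4, h⟩) fun h => .inr ⟨by omega, h⟩
    · exact .inr (.inl h4)

theorem exists_light {σ : Fin 16 → Fin 30} {h : V} (h1 : ∀ j, h (σ j) = 1) {P : ℕ → V → Prop}
    (hP : ∀ b v, P b v → P b (v + h)) {bs : List ℕ} (hbs : ∀ b ∈ bs, ∃ v, P b v) (us : List V) :
    ∃ vs, List.Forall₂ P bs vs ∧ Light σ us vs := by
  induction bs generalizing us with
  | nil => exact ⟨[], .nil, trivial⟩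
  | cons b bs ih =>
    simp only [List.mem_cons, forall_eq_or_imp] at hbs
    obtain ⟨⟨v, hv⟩, hbs⟩ := hbs
    obtain ⟨v', hv', hl⟩ : ∃ v', P b v' ∧ LightBy σ v' us := by
      obtain hl | hl := lightBy_or h1 v us
      exacts [⟨v, hv, hl⟩, ⟨v + h, hP _ _ hv, hl⟩]
    obtain ⟨vs, h2, h3⟩ := ih hbs (us ++ us.map (· + v'))
    exact ⟨v' :: vs, .cons hv' h2, hl, h3⟩

variable (σ : Fin 16 → Fin 30) (π : Equiv.Perm (Fin 16))

theorem signedBy_map {r : V} {us : List V} (h : LightBy σ r us) :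
    SignedBy (encode (r ∘ σ ∘ π)) (us.map fun v => encode (v ∘ σ ∘ π)) := by
  induction us with
  | nil => trivial
  | cons u us ih =>
    have h1 : bitCount 16 (encode (u ∘ σ ∘ π) ^^^ encode (r ∘ σ ∘ π)) =
        hammingNorm ((u + r) ∘ σ) := by
      rw [← encode_add, bitCount_encode, ← hammingNorm_comp_perm ((u + r) ∘ σ) π]
      rfl
    rw [List.map_cons, SignedBy, h1]
    exact h.imp_right fun h => ⟨h.1, ih h.2⟩

theorem signed_map {us rs : List V} (h : Light σ us rs) :
    Signed (us.map fun v => encode (v ∘ σ ∘ π)) (rs.map fun v => encode (v ∘ σ ∘ π)) := by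
  induction rs generalizing us with
  | nil => trivial
  | cons r rs ih =>
    refine ⟨signedBy_map σ π h.1, ?_⟩
    convert ih h.2 using 1
    rw [List.map_append, List.map_map, List.map_map]
    congr 2
    ext v
    simp only [Function.comp_apply]
    rw [← encode_add]
    rfl

/-- The column `t` of the matrix with the given rows, read as a number. -/
def colKey (t : Fin 30) : List V → ℕ
  | [] => 0
  | v :: vs => (v t).val * 2 ^ vs.length + colKey t vs

theorem colKey_lt (t : Fin 30) (vs : List V) : colKey t vs < 2 ^ vs.length := by
  induction vs with
  | nil => simp [colKey]
  | cons v vs ih =>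
    have h : (v t).val ≤ 1 := Nat.lt_succ_iff.1 (ZMod.val_lt _)
    rw [colKey, List.length_cons, pow_succ]
    nlinarith

theorem ascending_map {vs : List V} {Q : ℕ} {σ : Fin 16 → Fin 30}
    (h : ∀ i : Fin 15, Q.testBit i = true → colKey (σ i.castSucc) vs ≤ colKey (σ i.succ) vs) :
    Ascending Q (vs.map fun v => encode (v ∘ σ)) := by
  induction vs generalizing Q with
  | nil => trivial
  | cons v vs ih =>
    have h2 (a : ZMod 2) : a.val = if a = 1 then 1 else 0 := by revert a; decide
    have hb (i : Fin 16) : (encode (v ∘ σ)).testBit i = decide (v (σ i) = 1) := testBit_encode _ _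
    refine ⟨fun i hi hQ h1 => ?_, ih fun i hQ => ?_⟩
    · have h3 := h ⟨i, hi⟩ hQ
      have h4 := hb (Fin.castSucc ⟨i, hi⟩)
      have h5 := hb (Fin.succ ⟨i, hi⟩)
      rw [Fin.val_castSucc] at h4
      rw [Fin.val_succ] at h5
      simp only at h4 h5
      rw [h5, decide_eq_true_eq]
      rw [h4, decide_eq_true_eq] at h1
      by_contra h6
      rw [colKey, colKey, h2, h2, if_pos h1, if_neg h6] at h3
      have := colKey_lt (σ (Fin.succ ⟨i, hi⟩)) vs
      omega
    · rw [testBit_equalMask, Bool.and_eq_true, beq_iff_eq] at hQ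
      have h3 := h i hQ.1
      have h4 := hb i.castSucc
      have h5 := hb i.succ
      rw [Fin.val_castSucc] at h4
      rw [Fin.val_succ] at h5
      rw [h4, h5, decide_eq_decide] at hQ
      rw [colKey, colKey, h2, h2] at h3
      simp only [hQ.2] at h3
      omega

theorem exists_ascending (vs : List V) :
    ∃ π : Equiv.Perm (Fin 16), Ascending 32767 (vs.map fun v => encode (v ∘ σ ∘ π)) := by
  refine ⟨Tuple.sort fun j => colKey (σ j) vs, ascending_map fun i _ => ?_⟩
  exact Tuple.monotone_sort (fun j => colKey (σ j) vs) (Fin.castSucc_lt_succ).le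

theorem forall₂_words {R : ℕ → ℕ → Prop} (hR : ∀ a b c d, R a b → R c d → R (a ^^^ c) (b ^^^ d))
    {bs ms : List ℕ} (h : List.Forall₂ R bs ms) : List.Forall₂ R (words bs) (words ms) := by
  have h' {a b : ℕ} (hab : R a b) {bs ms : List ℕ} (h : List.Forall₂ R bs ms) :
      List.Forall₂ R (xorWords a bs) (xorWords b ms) := by
    induction h with
    | nil => exact .nil
    | cons h _ ih => exact .cons h (.cons (hR _ _ _ _ h hab) ih)
  induction h with
  | nil => exact .nil
  | cons h _ ih => exact .cons h (h' h ih)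

theorem exists_rows {K : Submodule (ZMod 2) V} {T : Finset (Fin 30)} {σ : Fin 16 → Fin 30}
    {τ : Fin 8 → Fin 30} (hwt : ∀ v, wt T v = hammingNorm (v ∘ σ) + hammingNorm (v ∘ τ))
    (hK : ∀ v ∈ K, v ≠ 0 → Even (wt T v) ∧ 10 ≤ wt T v) {h : V} (hh : h ∈ K)
    (h1 : ∀ j, h (σ j) = 1) (h0 : ∀ j, h (τ j) = 0) {bs : List ℕ}
    (hbs : ∀ b ∈ bs, ∃ v ∈ K, ∀ j : Fin 8, v (τ j) = bitz b j)
    (hw : ∀ w ∈ words bs, bitCount 8 w ≠ 0) :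
    ∃ (π : Equiv.Perm (Fin 16)) (vs : List V), (∀ v ∈ vs, v ∈ K) ∧
      List.Forall₂ (fun b v => ∀ j : Fin 8, v (τ j) = bitz b j) bs vs ∧
      List.Forall₂ (fun b v => goodWeight (bitCount 8 b) (bitCount 16 v) = true) (words bs)
        (words (vs.map fun v => encode (v ∘ σ ∘ π))) ∧
      Signed [0] (vs.map fun v => encode (v ∘ σ ∘ π)) ∧
      Ascending 32767 (vs.map fun v => encode (v ∘ σ ∘ π)) := by
  obtain ⟨vs, h2, h3⟩ := exists_light (P := fun b v => v ∈ K ∧ ∀ j : Fin 8, v (τ j) = bitz b j) h1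
    (fun b v hv => ⟨K.add_mem hv.1 hh, fun j => by
      rw [Pi.add_apply, h0, add_zero, hv.2]⟩) hbs [0]
  obtain ⟨π, hπ⟩ := exists_ascending σ vs
  refine ⟨π, vs, fun v hv => ?_, h2.imp fun _ _ h => h.2, ?_, ?_, hπ⟩
  · obtain ⟨i, hi, rfl⟩ := List.getElem_of_mem hv
    exact ((List.forall₂_iff_get.1 h2).2 i (by rwa [h2.length_eq]) hi).1
  · have h4 := forall₂_words
      (R := fun b m => ∃ v ∈ K, (∀ j : Fin 8, v (τ j) = bitz b j) ∧ m = encode (v ∘ σ ∘ π))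
      (by
        rintro a _ c _ ⟨u, hu, h5, rfl⟩ ⟨v, hv, h6, rfl⟩
        refine ⟨u + v, K.add_mem hu hv, fun j => by rw [bitz_xor, Pi.add_apply, h5, h6], ?_⟩
        rw [← encode_add]
        rfl)
      (ms := vs.map fun v => encode (v ∘ σ ∘ π)) (bs := bs) (by
        rw [List.forall₂_map_right_iff]
        exact h2.imp fun _ v h => ⟨v, h.1, h.2, rfl⟩)
    have h5 : List.Forall₂ (fun b m => bitCount 8 b ≠ 0 ∧
        ∃ v ∈ K, (∀ j : Fin 8, v (τ j) = bitz b j) ∧ m = encode (v ∘ σ ∘ π))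
        (words bs) (words (vs.map fun v => encode (v ∘ σ ∘ π))) := by
      rw [List.forall₂_and_left]
      exact ⟨hw, h4⟩
    refine h5.imp ?_
    rintro b _ ⟨hb, v, hv, hvb, rfl⟩
    have h6 : bitCount 8 b = hammingNorm (v ∘ τ) := bitCount_eq_hammingNorm hvb
    have h7 : bitCount 16 (encode (v ∘ σ ∘ π)) = hammingNorm (v ∘ σ) := by
      rw [bitCount_encode, ← hammingNorm_comp_perm (v ∘ σ) π]
      rfl
    have h8 : (v + h) ∘ σ = v ∘ σ + 1 := by
      ext j
      simp [h1]
    have h9 : (v + h) ∘ τ = v ∘ τ := by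
      ext j
      simp [h0]
    have hv0 (w : V) (hw : w ∘ τ = v ∘ τ) : w ≠ 0 := by
      rintro rfl
      rw [h6, ← hw] at hb
      exact hb hammingNorm_zero
    obtain ⟨ha, hc⟩ := hK v hv (hv0 v rfl)
    obtain ⟨-, hd⟩ := hK (v + h) (K.add_mem hv hh) (hv0 _ h9)
    rw [hwt, h8, h9] at hd
    rw [hwt, Nat.even_iff] at ha
    rw [hwt] at hc
    have he := hammingNorm_add_one (v ∘ σ)
    rw [h6, h7]
    have hland (n : ℕ) : Nat.land n 1 = n % 2 := Nat.and_one_is_mod n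
    have hx : goodWeight (hammingNorm (v ∘ τ)) (hammingNorm (v ∘ σ)) =
      (Nat.beq (Nat.land (hammingNorm (v ∘ τ) + hammingNorm (v ∘ σ)) 1) 0 &&
      (Nat.ble 10 (hammingNorm (v ∘ τ) + hammingNorm (v ∘ σ)) &&
        Nat.ble (10 + hammingNorm (v ∘ σ)) (16 + hammingNorm (v ∘ τ)))) := rfl
    rw [hx, Bool.and_eq_true, Bool.and_eq_true, Nat.beq_eq, Nat.ble_eq, Nat.ble_eq, hland]
    omega
  · have := signed_map σ π h3
    rw [List.map_cons, List.map_nil] at this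
    have h0 : encode ((0 : V) ∘ σ ∘ π) = 0 := encode_zero
    rwa [h0] at this

/-! ### Codes with a word of weight 16 -/

theorem exists_enum {S : Finset (Fin 30)} {n : ℕ} (h : S.card = n) :
    ∃ σ : Fin n → Fin 30, Function.Injective σ ∧ Finset.univ.image σ = S := by
  refine ⟨fun i => (S.equivFin.symm (Fin.cast h.symm i) : Fin 30), fun i j hij => ?_, ?_⟩
  · simpa using hij
  · ext t
    simp only [Finset.mem_image, Finset.mem_univ, true_and]
    constructor
    · rintro ⟨i, rfl⟩
      exact (S.equivFin.symm _).2
    · exact fun ht => ⟨Fin.cast h (S.equivFin ⟨t, ht⟩), by simp⟩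

theorem wt_image {n : ℕ} {σ : Fin n → Fin 30} (hσ : Function.Injective σ) (v : V) :
    wt (Finset.univ.image σ) v = hammingNorm (v ∘ σ) := by
  rw [wt, Finset.filter_image, Finset.card_image_of_injective _ hσ]
  rfl

theorem wt_union {S T : Finset (Fin 30)} (h : Disjoint S T) (v : V) :
    wt (S ∪ T) v = wt S v + wt T v := by
  rw [wt, Finset.filter_union, Finset.card_union_of_disjoint (Finset.disjoint_filter_filter h)]
  rfl

theorem false_of_runSearch {K : Submodule (ZMod 2) V} {T : Finset (Fin 30)} {σ : Fin 16 → Fin 30}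
    {τ : Fin 8 → Fin 30} (hwt : ∀ v, wt T v = hammingNorm (v ∘ σ) + hammingNorm (v ∘ τ))
    (hK : ∀ v ∈ K, v ≠ 0 → Even (wt T v) ∧ 10 ≤ wt T v) {h : V} (hh : h ∈ K)
    (h1 : ∀ j, h (σ j) = 1) (h0 : ∀ j, h (τ j) = 0) {bs : List ℕ}
    (hbs : ∀ b ∈ bs, ∃ v ∈ K, ∀ j : Fin 8, v (τ j) = bitz b j)
    (hw : ∀ w ∈ words bs, bitCount 8 w ≠ 0)
    (hs : (runSearch bs (fun _ => Step.fail) ()).isSome = true) : False := by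
  obtain ⟨π, vs, -, h2, h3, h4, h5⟩ := exists_rows hwt hK hh h1 h0 hbs hw
  obtain ⟨t, ht⟩ := Option.isSome_iff_exists.1 hs
  obtain ⟨s', t', h6⟩ := runSearch_sound ht (by rw [List.length_map, h2.length_eq])
    (fun m hm => by
      obtain ⟨v, -, rfl⟩ := List.mem_map.1 hm
      exact encode_lt _) h3 h4 h5
  cases h6

theorem hasForm_of_recognizeAll {K : Submodule (ZMod 2) V} {T : Finset (Fin 30)}
    {σ : Fin 16 → Fin 30} {τ : Fin 8 → Fin 30} (hσ : ∀ j, σ j ∈ T) (hτ : ∀ j, τ j ∈ T)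
    (hwt : ∀ v, wt T v = hammingNorm (v ∘ σ) + hammingNorm (v ∘ τ))
    (hK : ∀ v ∈ K, v ≠ 0 → Even (wt T v) ∧ 10 ≤ wt T v) {h : V} (hh : h ∈ K)
    (h1 : ∀ j, h (σ j) = 1) (h0 : ∀ j, h (τ j) = 0) {bs : List ℕ}
    (hbs : ∀ b ∈ bs, ∃ v ∈ K, ∀ j : Fin 8, v (τ j) = bitz b j)
    (hw : ∀ w ∈ words bs, bitCount 8 w ≠ 0) {codes : List (List ℕ)} {certs : List ℕ}
    (hc : ∀ s ∈ codes, ∀ k < 24, ∀ l < 24, dualCol s k = dualCol s l → k = l)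
    (hs : recognizeAll codes bs certs = true) : ∃ s ∈ codes, HasForm s K T := by
  obtain ⟨π, vs, h2, h3, h4, h5, h6⟩ := exists_rows hwt hK hh h1 h0 hbs hw
  obtain ⟨s, hsc, a, cs, heq⟩ := recognizeAll_sound hs
    (by rw [List.length_map, h3.length_eq])
    (fun m hm => by
      obtain ⟨v, -, rfl⟩ := List.mem_map.1 hm
      exact encode_lt _) h4 h5 h6
  refine ⟨s, hsc, hasForm_of_genSet_eq (hc s hsc) (σ ∘ π) τ (fun j => hσ _) hτ hh (fun j => h1 _) h0
    (vs := vs.reverse) (fun v hv => h2 v (List.mem_reverse.1 hv)) ?_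
    (List.forall₂_reverse_iff.2 h3) heq⟩
  rw [List.forall₂_reverse_iff, List.forall₂_map_left_iff, List.forall₂_same]
  exact fun v _ j => (bitz_encode (v ∘ σ ∘ π) j).symm

/-- The sum of the entries of `y` in a block of coordinates. -/
def blockSum (c : Fin 8 → Fin 3) (a : Fin 3) (y : Fin 8 → ZMod 2) : ZMod 2 :=
  ∑ i with c i = a, y i

/-- A code of codimension 2 without words of weight 1 is given by the equality of three sums. -/
theorem exists_blocks {R : Submodule (ZMod 2) (Fin 8 → ZMod 2)} (hR : Module.finrank (ZMod 2) R = 6)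
    (h1 : ∀ i, Pi.single i 1 ∉ R) :
    ∃ c : Fin 8 → Fin 3, (∀ y, y ∈ R ↔ ∀ a b, blockSum c a y = blockSum c b y) ∧
      ∀ a, ∃ i, c i ≠ a := by
  have hq : Module.finrank (ZMod 2) ((Fin 8 → ZMod 2) ⧸ R) =
      Module.finrank (ZMod 2) (Fin 2 → ZMod 2) := by
    have := R.finrank_quotient_add_finrank
    rw [hR, Module.finrank_fin_fun] at this
    rw [Module.finrank_fin_fun]
    omega
  let e := LinearEquiv.ofFinrankEq _ _ hq
  have hker (y : Fin 8 → ZMod 2) : e (R.mkQ y) = 0 ↔ y ∈ R := by simp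
  let L : Fin 3 → Fin 2 → ZMod 2 := ![![1, 0], ![0, 1], ![1, 1]]
  have hL : ∀ t : Fin 2 → ZMod 2, t ≠ 0 → ∃ a, L a = t := by decide
  choose c hc using fun i => hL (e (R.mkQ (Pi.single i 1))) fun h => h1 i ((hker _).1 h)
  have hsum (y : Fin 8 → ZMod 2) : e (R.mkQ y) = ∑ a, blockSum c a y • L a := by
    have hy : y = ∑ i, y i • (Pi.single i 1 : Fin 8 → ZMod 2) := by
      ext j
      simp [Finset.sum_apply, Pi.single_apply]
    conv_lhs => rw [hy, map_sum, map_sum]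
    simp only [blockSum, Finset.sum_smul]
    rw [← Finset.sum_fiberwise Finset.univ c]
    refine Finset.sum_congr rfl fun a _ => Finset.sum_congr rfl fun i hi => ?_
    rw [map_smul, map_smul, ← hc, (Finset.mem_filter.1 hi).2]
  refine ⟨c, fun y => ?_, fun a => ?_⟩
  · rw [← hker, hsum]
    have : ∀ p : Fin 3 → ZMod 2, ∑ a, p a • L a = 0 ↔ ∀ a b, p a = p b := by decide
    exact this fun a => blockSum c a y
  · by_contra! ha
    obtain ⟨f, hf⟩ : ∃ f : Fin 2 → ZMod 2, f ≠ 0 ∧ f ≠ L a := by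
      clear ha
      revert a
      decide
    obtain ⟨y, hy⟩ := R.mkQ_surjective (e.symm f)
    have h2 : f = blockSum c a y • L a := by
      rw [← Finset.sum_eq_single (s := Finset.univ) (f := fun b => blockSum c b y • L b) a,
        ← hsum, hy, e.apply_symm_apply]
      · intro b _ hb
        rw [blockSum, Finset.filter_false_of_mem fun i _ => by rw [ha]; exact hb.symm]
        simp
      · simp
    have h3 (z : ZMod 2) : z = 0 ∨ z = 1 := by revert z; decide
    obtain h3 | h3 := h3 (blockSum c a y)
    · exact hf.1 (by rw [h2, h3, zero_smul])
    · exact hf.2 (by rw [h2, h3, one_smul])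

theorem blockSum_comp_perm (c : Fin 8 → Fin 3) (π : Equiv.Perm (Fin 8)) (a : Fin 3)
    (y : Fin 8 → ZMod 2) : blockSum (c ∘ π) a (y ∘ π) = blockSum c a y := by
  rw [blockSum, blockSum, Finset.sum_filter, Finset.sum_filter,
    ← Equiv.sum_comp π fun i => if c i = a then y i else 0]
  rfl

theorem blockSum_perm_comp (c : Fin 8 → Fin 3) (ρ : Equiv.Perm (Fin 3)) (a : Fin 3)
    (y : Fin 8 → ZMod 2) : blockSum (ρ ∘ c) a y = blockSum c (ρ.symm a) y := by
  rw [blockSum, blockSum]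
  congr 1
  ext i
  simp [Equiv.eq_symm_apply]

theorem exists_comp_perm_eq {α β : Type*} [Fintype α] [DecidableEq α] [DecidableEq β] {f g : α → β}
    (h : ∀ b, Fintype.card {x // f x = b} = Fintype.card {x // g x = b}) :
    ∃ π : Equiv.Perm α, f ∘ π = g := by
  refine ⟨(Equiv.sigmaFiberEquiv g).symm.trans ((Equiv.sigmaCongrRight fun b =>
    (Fintype.equivOfCardEq (h b).symm)).trans (Equiv.sigmaFiberEquiv f)), ?_⟩
  ext x
  exact (Fintype.equivOfCardEq (h (g x)).symm ⟨x, rfl⟩).2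

/-- The possible partitions into three blocks, up to order. -/
theorem exists_sorted_blocks (c : Fin 8 → Fin 3)
    (h : ∀ a, 3 ≤ (Finset.univ.filter fun i => c i ≠ a).card) :
    ∃ (ρ : Equiv.Perm (Fin 3)) (π : Equiv.Perm (Fin 8)), ρ ∘ c ∘ π ∈
      ({![1, 1, 1, 2, 2, 2, 2, 2], ![1, 1, 1, 1, 2, 2, 2, 2], ![0, 1, 1, 2, 2, 2, 2, 2],
        ![0, 1, 1, 1, 2, 2, 2, 2], ![0, 0, 1, 1, 2, 2, 2, 2], ![0, 0, 1, 1, 1, 2, 2, 2]} :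
        Set (Fin 8 → Fin 3)) := by
  let n : Fin 3 → ℕ := fun a => Fintype.card {i // c i = a}
  have hn (a : Fin 3) : n a ≤ 5 := by
    have h1 := Finset.card_filter_add_card_filter_not (s := (Finset.univ : Finset (Fin 8)))
      fun i => c i = a
    rw [Finset.card_univ, Fintype.card_fin] at h1
    have h2 := h a
    have h3 : n a = _ := Fintype.card_subtype fun i => c i = a
    simp only [ne_eq] at h2
    omega
  have hsum : ∑ a, n a = 8 := by
    rw [← Fintype.card_sigma, Fintype.card_congr (Equiv.sigmaFiberEquiv c), Fintype.card_fin]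
  let ρ := Tuple.sort n
  have hm : Monotone (n ∘ ρ) := Tuple.monotone_sort n
  have h01 : n (ρ 0) ≤ n (ρ 1) := hm (by decide : (0 : Fin 3) ≤ 1)
  have h12 : n (ρ 1) ≤ n (ρ 2) := hm (by decide : (1 : Fin 3) ≤ 2)
  have h2 := hn (ρ 2)
  have hs : n (ρ 0) + n (ρ 1) + n (ρ 2) = 8 := by
    rw [← hsum, ← Equiv.sum_comp ρ n, Fin.sum_univ_three]
  have key (g : Fin 8 → Fin 3) (h0 : n (ρ 0) = Fintype.card {i // g i = 0})
      (h1 : n (ρ 1) = Fintype.card {i // g i = 1}) (h2 : n (ρ 2) = Fintype.card {i // g i = 2}) :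
      ∃ π : Equiv.Perm (Fin 8), ρ.symm ∘ c ∘ π = g := by
    obtain ⟨π, hπ⟩ := exists_comp_perm_eq (f := ρ.symm ∘ c) (g := g) fun b => by
      have : Fintype.card {x // (ρ.symm ∘ c) x = b} = n (ρ b) :=
        Fintype.card_congr (Equiv.subtypeEquivRight fun x => by
          simp [Equiv.symm_apply_eq])
      rw [this]
      fin_cases b
      exacts [h0, h1, h2]
    exact ⟨π, hπ⟩
  have hcard : (n (ρ 0) = 0 ∧ n (ρ 1) = 3 ∧ n (ρ 2) = 5) ∨
      (n (ρ 0) = 0 ∧ n (ρ 1) = 4 ∧ n (ρ 2) = 4) ∨ (n (ρ 0) = 1 ∧ n (ρ 1) = 2 ∧ n (ρ 2) = 5) ∨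
      (n (ρ 0) = 1 ∧ n (ρ 1) = 3 ∧ n (ρ 2) = 4) ∨ (n (ρ 0) = 2 ∧ n (ρ 1) = 2 ∧ n (ρ 2) = 4) ∨
      (n (ρ 0) = 2 ∧ n (ρ 1) = 3 ∧ n (ρ 2) = 3) := by omega
  refine ⟨ρ.symm, ?_⟩
  simp only [Set.mem_insert_iff, Set.mem_singleton_iff]
  obtain ⟨h0, h1, h2⟩ | ⟨h0, h1, h2⟩ | ⟨h0, h1, h2⟩ | ⟨h0, h1, h2⟩ | ⟨h0, h1, h2⟩ | ⟨h0, h1, h2⟩ :=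
    hcard
  · obtain ⟨π, hπ⟩ := key ![1, 1, 1, 2, 2, 2, 2, 2] (by rw [h0]; rfl) (by rw [h1]; rfl)
      (by rw [h2]; rfl)
    exact ⟨π, by tauto⟩
  · obtain ⟨π, hπ⟩ := key ![1, 1, 1, 1, 2, 2, 2, 2] (by rw [h0]; rfl) (by rw [h1]; rfl)
      (by rw [h2]; rfl)
    exact ⟨π, by tauto⟩
  · obtain ⟨π, hπ⟩ := key ![0, 1, 1, 2, 2, 2, 2, 2] (by rw [h0]; rfl) (by rw [h1]; rfl)
      (by rw [h2]; rfl)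
    exact ⟨π, by tauto⟩
  · obtain ⟨π, hπ⟩ := key ![0, 1, 1, 1, 2, 2, 2, 2] (by rw [h0]; rfl) (by rw [h1]; rfl)
      (by rw [h2]; rfl)
    exact ⟨π, by tauto⟩
  · obtain ⟨π, hπ⟩ := key ![0, 0, 1, 1, 2, 2, 2, 2] (by rw [h0]; rfl) (by rw [h1]; rfl)
      (by rw [h2]; rfl)
    exact ⟨π, by tauto⟩
  · obtain ⟨π, hπ⟩ := key ![0, 0, 1, 1, 1, 2, 2, 2] (by rw [h0]; rfl) (by rw [h1]; rfl)
      (by rw [h2]; rfl)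
    exact ⟨π, by tauto⟩

def codes : List (List ℕ) :=
  [[62063, 28307, 24348, 16352, 68570, 129346, 125996],
   [62063, 28307, 24348, 16352, 70618, 71335, 116338],
   [62063, 28307, 24348, 16352, 70618, 79095, 101105],
   [12911, 44691, 24348, 16352, 72410, 116408, 98781],
   [62063, 28307, 24348, 16352, 70618, 129410, 103591],
   [62063, 28307, 24348, 16352, 78554, 128022, 116515]]

def certs044 : List ℕ :=
  [2434711804723868, 102087552016433, 1003136898179241, 1263171398148417, 2164221609910569,
   4063106608172329, 2294817032828225, 2440484240769692, 1249427502801217, 2177965505257769,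
   88343656669233, 1016880793526441, 2303888003730545, 4054035637269737, 4046888811662633,
   2296741178176833, 2287670207220849, 4055959782618345, 2294752608258409, 47137408759836,
   1263329150036161, 2164271115200825, 1249584269107865, 1263220790272865, 4055888915597545,
   4053971212699945, 1003186836269353, 2580412199156252, 102244871104545, 1016930185650825,
   1003293664486257, 2296670311155881, 2303823579221089, 4063042183662625, 4046817944702185,
   2287599340260521, 4063042183628897, 2294746165840945, 2580495951053212, 1233917213993753,
   86576277626993, 1247660123758913, 2162346856685865, 2303823579187233, 4053964770282609,
   2162454230868329, 2580412199191068, 72832935062521, 86468903444529, 1001369519136937,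
   4053971212733737, 2294752608292201, 4046817944728809, 2287599340287145, 4046888811655377,
   4055959782557993, 2287670207213681, 2296741178116473, 66166261364764, 2164221723076657,
   1003137444145337, 2177965618424121, 1016881339492785, 2599441051760748, 1016881339492649,
   2177965618424225, 1003137444145185, 2164221723076777, 2303888003723585, 2294817032767673,
   4063106608165345, 4054035637209321, 4063042183629097, 2296670311182385, 2303823579187561,
   4055888915624049, 4053971212733537, 2294752608291873, 41090094807068, 1233917213993153,
   987518795573345, 2148603074505017, 1247552749577057, 4063035741178089, 987518795573545,
   1001262144955017, 2574364885203484, 72832935061537, 2148603074504817, 2303817136736425,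
   2294752608258081, 2296670311155761, 4053971212699745, 4055888915597425, 2303823579221289,
   4063042183662953, 2287599340260401, 2590116677796252, 1263329150036761, 88393601575465,
   88500422975601, 2178014897381673, 4046817944702065, 2164378376216937, 102136944140337,
   2574364885238300, 102244871105529, 1249477880507081, 2434712270815772, 1003137880301737,
   102087668539441, 1263172380270913, 2164221726433577, 2294751775951225, 4063041351321713,
   4063041351321897, 2294751775950881, 1249428484923713, 2440484706861596, 2177965621780777,
   1016881775648937, 88343773192241, 4053970380392745, 2303822746880033, 2303822746880377,
   4053970380392561, 4063105775865129, 2164270565878073, 66188668385324, 1263328600713409,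
   1249585251230361, 1263221772395361, 2294745333533745, 4046887979348177, 2296669478875185,
   2303887171423593, 1003186286946601, 2580413131340316, 102244321781793, 1016931167773321,
   1003294646608753, 4053963937975409, 2287669374906513, 4055888083316849, 2294816200521025,
   4055888083290345, 86576394150001, 2438461777265308, 1233916664671001, 1247661105881409,
   2162346973208873, 4055958950250793, 2296669478848561, 4054034804962561, 2296669478848681,
   2162454347391337, 2580413131375132, 72832385739769, 86469019967537, 1001370501259433,
   2296740345809257, 4055888083290225, 4053970380426537, 2303822746914169, 2164221173753905,
   1003136894822585, 293491372669460, 2177965069101369, 1016880790170033, 2303822746914089,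
   4053970380426617, 4063041351355425, 2294751775984753, 1016880790169897, 2177965069101473,
   2282782785223196, 1003136894822433, 2164221173754025, 2294751775984673, 4063041351355505,
   4046887979355433, 4046817112394985, 2303887171416385, 41174778853420, 1233916664670401,
   987518246250593, 2148602525182265, 1247553731699553, 2287598507953201, 2287598507953321,
   2287669374913897, 4063105775857921, 987518246250793, 1001263127077513, 2574365817387548,
   72832385738785, 2148602525182065, 4046817112394865, 2296740345869633, 4046817112421609,
   2294816200460473, 4063034908870889, 2440385922613916, 1263328600714009, 88393052252713,
   88500539498609, 2178015013904681, 2287598507979945, 4055958950311169, 4054034804902137,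
   2303816304429225, 2164378492739945, 102137060663345, 2574365817422364, 102244321782777,
   1249477331184329, 2057598355410217, 1003137884627305, 1533149072916508, 2177965618372657,
   1016880790118449, 2164221605584993, 291167668564521, 2041380558900521, 1016881779974505,
   1513357863616540, 2177965500932193, 2164221723025457, 1003136894771249, 282096697635369,
   2057597516549233, 2050450690934833, 2041379720039537, 2048526545586225, 2057596574272809,
   3448364171397675, 4055895365546537, 572867367256475, 1263329150043329, 1271254399179307,
   86419632228129, 308539730170379, 2041309699438369, 987518795631913, 62341635178027,
   3450274987903499, 1299017067780651, 72675736880929, 306065829007883, 2041378777763113,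
   3450288316746283, 4046824394617385, 3451099621624331, 575616146325915, 1233917214000321,
   2048456525018913, 1003186836327721, 36503111925291, 1249427931275361, 88344210317673,
   2764602096025628, 2177965069049905, 1016881339441201, 4055895482069545, 2303888960032041,
   4055959899998321, 4063106725612593, 1263171826622561, 102088105664873, 2744810886725660,
   2164221173702705, 1003137444094001, 4046824511140393, 2287671163522345, 4054035754649713,
   4046888929102897, 291167552041513, 2303887178894633, 141033195047467, 308632239799867,
   2148603074563385, 282091094996265, 414092846436875, 1001213306537761, 1623098120067627,
   4126488948228651, 102244871111713, 3133615639104043, 411618945274379, 987469411190561,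
   1650860788668971, 3134440272824875, 282096581112361, 2287669382384937, 142957340396075,
   282793716547131, 2164271115259193, 289237920576809, 4129237727298091, 72832935068705,
   4055958951168113, 2148602525240633, 52720908470843, 2162297460295369, 702220558123547,
   2057596567719025, 2041308867131169, 3451098639501835, 4126490596196907, 102244321788961,
   3451113675294931, 2218836018474195, 52720908374587, 1263328600720577, 4055958951228609,
   282090262689065, 3134439290702379, 702220541477403, 2162297027495625, 2057596567711937,
   987518246309161, 62341485362731, 4297935904954779, 2216913288038971, 4054034805819505,
   59867734051387, 2164270565936441, 3450274005781003, 2041378771209329, 2048455692711713,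
   4129239375266347, 72832385745953, 2217186751032531, 3448364896225491, 2148553564948169,
   681329837195803, 59867733955131, 1233916664677569, 4054034805880001, 3133614656981547,
   289237088269609, 2041378771202241, 1003186287004969, 36502962109995, 2219662067108411,
   4324873939835291, 681329820549659, 2148553132148425, 2041380558893265, 2057598355403049,
   1263171826673761, 1533150029160860, 1249427931326649, 1016880793577785, 1263172380322105,
   282096697669161, 1249427931326961, 1391234817987132, 1263171826673961, 1003136898230441,
   1249428484974761, 291167668598561, 2041379720032369, 2041379720039737, 2050450690935161,
   2050450690995249, 2041378777755857, 2216909726812715, 3448363738607147, 95032778620907,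
   2162346856744801, 4046824394651177, 414092846497291, 1233759890689209, 2057527495887561,
   36483634364387, 1249477880565449, 142944460081691, 2216911291550251, 2057596574265641,
   3448364171406891, 52701530690091, 1263220790330665, 4055895365580577, 62249244229163,
   1247503786036521, 4297723136301595, 2057527495914185, 702240321814939, 2148603074563185,
   759093843206556, 2164221605636281, 88343777569089, 1016881775700281, 1263171398199609,
   4046824511174185, 1637525422608956, 2177965500983593, 102087672916177, 1003137880352937,
   1249427502852265, 4055895482103585, 2287671163515089, 2303888960024873, 4046888929103225,
   4046888929095729, 4055959900058737, 4055959899998521, 282096581146153, 2148553564998841,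
   308539730230795, 2287669382377681, 3131703401122347, 141032762256939, 88393601633833,
   388327355252643, 298308891445441, 2218822413322507, 306139011153891, 86468903503481,
   291167552075553, 2162297460346153, 97433616317995, 3131704965859883, 2303887178887465,
   141033195056683, 1623710857550235, 987518795631713, 4150308786520619, 298308891472065,
   404545251578427, 1016930185708737, 2041378771202161, 2057526663580361, 4297724401408539,
   4046887980273017, 1003186287005225, 414185305630227, 702220541399579, 72676169731241,
   4325146493731355, 3133631266435043, 306138844692451, 86469020026489, 36502962136643,
   1247553731757921, 2041378771209529, 36483734241251, 1249477331242697, 4054034805819585,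
   298308059138241, 1623712122657179, 72675736931497, 282701207004699, 2217186751032947,
   2219662067114555, 2050449742104953, 142944609896987, 2057526663606985, 4055958951228529,
   987518246308961, 4150310484427307, 4325146660192795, 141035493526499, 388254323280171,
   86420065078585, 404545151701563, 1016931167831233, 52701430813227, 1263221772453161,
   2057596567719105, 702242019721627, 2148602525240433, 4055958951168313, 2217173145890147,
   298308059164865, 2217188165955187, 3448641189054011, 86419632278841, 87812889610867,
   2041314346726697, 2050386280510761, 3450288309013035, 1271042670713243, 3133627541892651,
   4055888084234433, 306065847025195, 1247503793769769, 86468906910913, 308612912386619,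
   573049400050091, 1263220786005545, 2162454344092721, 36483634793075, 141032763436587,
   2057532149729313, 2048462967408937, 86420064109865, 308539748127275, 102244872029657,
   299011361870387, 2294745341004913, 1623712133929499, 3450287872814635, 2048462121110825,
   2048455678659633, 1001369515728945, 2162454343983153, 1001263131402601, 1515146717495324,
   2162346852360289, 2057533930866721, 2048462959971625, 2057533092005921, 2048456517520497,
   2162346969800753, 1001262141546545, 1001370505584937, 151592032551452, 2162454226542625,
   298308051694281, 2057526649554993, 2050387112817961, 3448363727456811, 3131704973602347,
   102137065047841, 298992017871371, 2048461178834217, 1271868579502619, 4063035748676297,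
   1001213298855209, 59775392218667, 1247553735165121, 596687255880091, 1001369515838513,
   59848256847475, 4046817113339073, 3131703396534827, 2048462135101737, 2050385317621793,
   1247503793718569, 62249293320747, 678422127690283, 2178121834497057, 4297109123750443,
   2218822401002043, 1271253124110891, 3450275424111163, 306138861469299, 2162453794769969,
   2041307904275649, 3448362745334315, 86419514787113, 308539897942571, 572869011423787,
   1263328160187425, 289243530660137, 4055894526685217, 3133628524015147, 3131704390987307,
   282774239414899, 1001370065161265, 1247504343041321, 62249143505451, 404564478136883,
   1017038546339289, 2048454736383089, 1271868413041179, 289244362967337, 2303822754351137,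
   4063035858618417, 1247553178050657, 1001370065051697, 2162453794660401, 86469457092969,
   2746599740604444, 4053964887723057, 2294747122142321, 2162346420478001, 1001262690869297,
   1247660552232993, 86576831275305, 3423738636812828, 4063035865199305, 4063042301069345,
   2303824535488545, 2294753564593449, 4053971330174249, 306065996840491, 2162297577786665,
   86469456233665, 4150308836852123, 141033346051627, 404545134137867, 1016930739357473,
   3131704378657323, 1623712300390939, 298307935171273, 2294751783456041, 291168508376361,
   678602516316587, 2178014460315177, 3450286890692139, 2050378875171009, 86419514838313,
   59775242403371, 2218835285903915, 4296898670352795, 1247553185842369, 62322307764795,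
   4046823555790121, 291167676069161, 2057532149763369, 987469403508009, 62249293381163,
   1263221775860929, 573047755882907, 2041316141888809, 3450287872805419, 86469024352033,
   308612744614411, 3133629118950955, 1271043945781787, 2296669486319729, 2048461178800161,
   2057533938338089, 3448363727466027, 72676168762665, 306065846964779, 2164378489441329,
   59848256883315, 142956908785195, 1622887500208667, 72832935986649, 306158187450931,
   2287598515424369, 2057533930900777, 2048462959937569, 2048462121076769, 2050379823974449,
   2057533092039977, 2041308853079089, 1003293661077553, 2164378489331761, 1016931172098409,
   153402361266844, 2178014893056097, 2050380662835313, 2041309691939953, 2178015010496561,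
   1016930182242353, 1003294650933545, 147743741854236, 2164378371891233, 2057533106030889,
   2041314346692641, 4324871792351787, 2219647034722875, 1233759898371369, 59775392158251,
   3133627541883435, 1003293661187121, 36483634757235, 4053963938919617, 681170906759723,
   2148709898454049, 72675619491113, 62249143565867, 3448362745343531, 2057525700751553,
   2216911140555307, 4297723304073627, 1263221226538177, 52701581021755, 702242016313771,
   2162346419619369, 282096705140009, 4055894526719273, 2041315309581609, 2050385317655849,
   596688900047275, 1247552745309737, 3448364163664427, 1271867304434075, 308539748187691,
   1233759898422569, 3131703396544043, 4063034909814977, 102136947606721, 298992185643579,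
   72675619439913, 306065996780075, 3450286890682923, 2164377940118577, 282774239379059,
   2048454729856193, 575617790493227, 1233916224144417, 1299015792712235, 3451100057831995,
   298314501589289, 4046823555756065, 414165860880907, 1001262698661665, 142957491400235,
   3133628524005931, 1622887666670107, 2050378881697905, 282097537447209, 308539898002987,
   2148553682439465, 2303822754385193, 102137496929473, 4126669336854939, 1233760447694121,
   59775242342955, 3133628536335915, 1003294210509873, 306138861505139, 1271043779320347,
   411711303717427, 987626610296281, 2041307910802545, 3131704378666539, 298315333896489,
   2294751783421985, 1263221218746465, 1003294210400305, 2164377940009009, 102137497788777,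
   3425548965528220, 4046818062142513, 2296671267457137, 2287600296561777, 2178014461173809,
   1016930731565105, 1249584697581601, 88500976623913, 3419890346115612, 4063042301103401,
   4055889033037873, 4053971330140193, 2303824535522601, 2294753564559393]

theorem recognizeAll044 :
    recognizeAll codes [96, 9, 5, 192, 80, 6] certs044 = true := by
  decide +kernel

def certs125 : List ℕ :=
  [1297961472615810, 2409170922998922, 3111481691727434, 2353798165270418, 3026698990511490,
   2428685183214978, 3041692721341826, 2458829411181954, 4483580500764234, 1296492593800778,
   1297866983335298, 2409065696300170, 3111361432643146, 3041542397486466, 2458921752978818,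
   4483797396612682, 2353984996347794, 3026849314366850, 2428592841418114, 1296587083081290,
   799941669700570, 3544321331839962, 113560558393226, 796093379003226, 1571237815932810,
   128678843275146, 1556119531050890, 3540473041142618, 800158565549018, 3544293414552538,
   113766716823434, 1571407467141002, 128885001705354, 1556289182259082, 796310274851674,
   3540445123855194, 2905700818768906, 2364212968571018, 1750011405287898, 2245770856776474,
   2716056588796042, 1753189681087258, 970561545065482, 2383329868005850, 2731449751584906,
   2364088414519642, 1749891146204058, 973310324134922, 2893331312956426, 1753309940171098,
   2238624031195930, 2383454422056970, 2697343331750922, 2697306824529266, 409037420774170,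
   409282233909386, 412885711471514, 413130524606474, 2682188539647346, 2682225046869002,
   4188482407776682, 4188452343005658, 2675627983525026, 2675591476303322, 388666398359562,
   388421585224602, 388666396524554, 388421583389594, 412885717107610, 413130530242570,
   4216245076377898, 4216215011606874, 4193675038179674, 4193705102950698, 409037428245274,
   409282241380490, 1056493471393666, 2669935750145322, 1085385716393018, 472560714245858,
   458239145797058, 2654664993925106, 3464000421357138, 1493000327521354, 1509067800176210,
   3477774381475338, 1056523536164850, 2670058156713970, 1085355651621962, 472532796958218,
   458267063084330, 2654542587356458, 3463755608221122, 1493124881573274, 1508943246124930,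
   3478019194611098, 3097067768243586, 2442978840143434, 1282568302486914, 3055561183979082,
   4499740322555266, 3097188034798978, 1282473814910338, 4499523428541826, 2442886483404362,
   3055711500232266, 2383454420354010, 1749891159442394, 2364088421991258, 2715962105152346,
   1753309947642714, 2245921186267994, 2238624044434266, 2731449749881690, 1218305508524890,
   780700223554394, 1573997419447258, 1573997434389466, 125930060273546, 780700225389402,
   3547619860955994, 3547619859120986, 3253473313393802, 2654542572414338, 2670058149111170,
   472532804560458, 1508943253595522, 1493124879869514, 1056523537868162, 1085355666564682,
   3268714015199122, 458267064919426, 3097188027327874, 1282568304190850, 2442886498346570,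
   1282473813206402, 3055711507834442, 4499523426706818, 3097067775714690, 4499740324390274,
   2442978825201226, 3055561176376906, 2238774368289626, 2731355260601178, 2383329866302426,
   1750011418526682, 2364212976042842, 2716056594432858, 1753189688558426, 2245770862412634,
   1218427915092826, 126136218703754, 780917119402842, 1574089761244122, 1574089776186330,
   780917121237850, 3547591943668570, 3547591941833562, 3253595719961738, 1056493473097090,
   2654664978982274, 2669935742543234, 472560721847882, 1085385731335754, 1509067807647106,
   1493000325817930, 3268591608631186, 458239147632002, 2218158517666218, 1725547279040986,
   2358865741758938, 2886734253544610, 2218008201413530, 2710833906860042, 2358990286635018,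
   1725427025724314, 3041542410724802, 4483797403952538, 3026849320003570, 2428592832242986,
   2458921758746498, 1296587075741082, 1297866977699826, 3126050215027786, 3111361419404810,
   4484130265752874, 1086730056099714, 2639699165439274, 1507693408937370, 473907102715082,
   3463450663708058, 2639821579347954, 1507568864060490, 1086760107632626, 473110471894314,
   3463205844936202, 3544321324237682, 1554755980903410, 1225452334105586, 1202912360678386,
   1577295954330610, 799941677040498, 1779595302950666, 4348053509134090, 2218008193811354,
   1725427019957146, 2358990295810058, 2710833914200074, 2218158525268394, 2710739417579946,
   2358865732583898, 1725547284808154, 3041692734580722, 4483580508104418, 3026698996147650,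
   2428685174040450, 2458829416949034, 1296492586460218, 1297961466979922, 3125929955943946,
   3111481678488650, 4484347161601618, 1086760120870898, 2639821572007922, 1507568854885450,
   473924282584074, 3463205850572298, 2639699172779306, 1507693418112410, 1086730042861442,
   473082554607042, 3463450658071962, 3544293406950298, 1554848322699610, 1225574740672810,
   1203034767245610, 1577388296126810, 800158572888074, 1779700529649026, 3540445118087962]

theorem recognizeAll125 :
    recognizeAll codes [69, 192, 40, 13, 80, 131] certs125 = true := by
  decide +kernel

def certs134 : List ℕ :=
  [754743033370114, 768309996197306, 772779463280538, 590634480473954, 768359771182426,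
   569194005567330, 1305317038506426, 1327010700219834, 1327010697205178, 1305317040341434,
   754615882388594, 579683060024698, 46255520634010, 1326911682926010, 46409183155354,
   1326861904926138, 772757828666882, 751349565506058, 748708389732986, 761185034846698,
   748622429045498, 569178756781418, 770030693517050, 745094168221650, 1327841776386970,
   1327742759092234, 1324937757742554, 1324987532727458, 765389972063130, 765368330765210,
   742386194334170, 742218457563610, 744945375942106, 770162705434386, 772757821982210,
   579661418727162, 751507513688130, 761368020402690, 748723638518274, 748758735929538,
   752713385379738, 768458790311258, 1326911678076346, 1305301788017082, 1326861903091130,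
   1305202770723258, 766435625833538, 578814732309946, 1312442168137522, 1311639232201570,
   1324283614085986, 1304470711850906, 764758445932906, 764926182703866, 768117109834378,
   768138751132410, 768309998032314, 752845397296202, 766385850848730, 766562783368666,
   765526288253850, 742401444823514, 742401446658522, 765526286943130, 770009042913042,
   745122308462042, 770030684210938, 578814730474938, 765389981369242, 742218459267546,
   574211271710170, 765368338760602, 755440520529690, 755594183051034, 745094174775250,
   766435632387138, 1312293375858138, 1304371694556170, 65771852027266, 1311623983416090,
   754615880684906, 772889841894554, 748615425475002, 761259807359418, 565654950663442,
   748737093320858, 748708383179098, 761185028292954, 751349564195738, 748622427734810,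
   764758441083354, 764926179688922, 768117116519194, 768138759127834, 45837778048154,
   65903865255066, 45045531033754, 47794310103066, 64408367677594, 64403904938138,
   1327841773371706, 1327742754242874, 751507521684378, 748758742614810, 593705953809778,
   573639866602866, 1324169341452730, 47636352614426, 1311623976862138, 44892036284570,
   576780786205850, 45727407428978, 65793494635890, 45023889736474, 47772668806042,
   596846873412762, 576912631662322, 770009050908170, 64540213134106, 64540211823386,
   1327680096190938, 1327680094355930, 772779471275762, 752713384068850, 565654952498450,
   573626411799994, 593591288222874, 573525201015962, 770162704122946, 755594175054922,
   752823754687642, 768359776031810, 764833220149562, 764833221984570, 586270793684410,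
   768253424713882, 754714897979130, 768458793326546, 755440521840130, 596978718869234,
   1324106681565530, 47772659499930, 1311462299681114, 45023881741082]

theorem recognizeAll134 :
    recognizeAll codes [131, 192, 137, 41, 144, 69] certs134 = true := by
  decide +kernel

def certs224 : List ℕ :=
  [2159232981273672, 901342220519944, 4062245030200650, 1610885080906794, 1693632792037354,
   3168278201413034, 899955734618712, 381668242796074, 359982801917314, 848788664319770,
   3902185980626090, 237129090469488, 996664075357152, 3882089828634058, 1710705287023738,
   856797134108994, 218071603787970, 1012499854683104, 1462049523668789, 4296029595905321,
   4295816089155881, 1981139018989682, 3177407104041074, 3908106975773626, 2610746429016232,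
   4251979252274906, 2995363765676226, 811985492436896, 835076109035424, 2866117613812890,
   2490634402400010, 2993714129136402, 2615969830668456, 534365155213450, 2485173670363274,
   3012651008926546, 447251433636161, 2993958304621330, 434606143947073, 3229312513851689,
   4256014172765170, 385735140654066, 3205100038371625, 2159172851760200, 848647249069114,
   359907791012210, 3902278322482050, 3491005277946104, 3881967422022370, 3908076911016890,
   856998813090402, 2440114823348545, 534461473193306, 1450486783903400, 1223759904605792,
   4111735291840114, 848646930302010, 2862509421871714, 856998997639778, 660853042168105,
   4084673290052370, 2440116568179009, 660852136198441, 848550612351034, 1397029384793498,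
   992243832594504, 834927932734368, 857035320295010, 381698307561178, 3883493913855210,
   997276108293192, 1581856160722416, 3200438312545578, 385793122675754, 3883738089442842,
   1719227693321842, 3168336183443882, 1997906051219754, 1589993135242586, 1556039816939176,
   3370006152578656, 4050426504938554, 1719196991030898, 1610831404843305, 265780106925877,
   1586831530143017, 621640577065634, 3533865213646282, 4334596413997538, 3292610361609680,
   1085357397421610, 3177359859431586, 3531012490117730, 4330289176329146, 3531048997322338,
   1085385549584090, 1784906461871008, 4304605586490440, 611346127717610, 4330319241085882,
   2786668206229672, 1085387462186714, 1693540450298050, 3591552235792288, 1710827693548370,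
   2429406903578026, 1085355484818986, 1568459520090712, 2869178096728122, 4327612367249416,
   4343164873783530, 230119507116362, 3537449917497674, 3094355283525989, 3543693059566913,
   3530830874132801, 913455242063146, 4502159826464240, 4256072154786858, 4490149671733768,
   2686999910943816, 2865975879796042, 2490492668574762, 2792870725282330, 324798379890050,
   4050568238956314, 418931595740330, 4303993553554400, 4212961788169840, 398835443748298,
   2803193679105106, 4488987883177376, 2869274733446202, 4252728724095346, 2159348643473144,
   2803041576937554, 218024359117282, 3525355339923938, 2883249084285285, 1885237209255376,
   1981091774380194, 4251949187509802, 1819657412291905, 1508121827004018, 2793022005366298,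
   3527785339961432, 4062386764217498, 1611026814732042, 1480784947440402, 4304818891917480,
   1819442261377345, 2862307558340930, 4334643088242882, 4108722867301344, 410533978317474,
   3537681349523514, 2814685083213832, 4334650101116098, 900180431963552, 3537777986241594,
   3320434570372856, 1086136934007154, 410503276128338, 3522660926096442, 2686939781430344,
   1063595033035122, 419023937596290, 1204022140879096, 398713037136610, 3522564289378362,
   4352516040994202, 2786646026756168, 2429464885608874, 2455302838436138, 2047293338140810,
   2062962603573386, 1464292167649800, 3883585618176538, 385748025540650, 1028685552194890,
   3559303477143064, 3883616320364778, 2432694545924761, 3902308018036906, 3205314065214761,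
   2866081106608282, 860571907113114, 2461281848246937, 848752157115162, 2869379641492250,
   856893770827074, 559477090778834, 1208915256116576, 1476111917648392, 3881936350734794,
   3229503321025833, 2993958942155538, 2461498743991961, 3012650639827794, 4247812498389920,
   2995362759043266, 2862545929076322, 4251979050948314, 2610745640487080, 3229312195084585,
   2490396031828746, 555255557374730, 3205122939273513, 534364836446346, 2485173351596170,
   2432911441669785, 4256102219552754, 2866119341866138, 2993713491602194, 2629263392040696,
   835074867521440, 1391251026393498, 2615744344992936, 3802740690955282, 1610990307555370,
   3486311231023144, 2004169657068842, 1981080516865138, 1450466030497448, 324768516451698,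
   2638559211270128, 1387677613603050, 3832977260719122, 1387677093509354, 2618336592554536,
   4065446928365626, 3486401022709120, 1997848069188906, 347308504821106, 2629329964002040,
   4050329868220474, 235944506207642, 1464280792703496, 1610989082818602, 2004170781142314,
   4062148393482570, 2610520943340712, 1397022942345626, 4062149618219338, 2610520154811560,
   230172070161818, 1605767627323738, 1464483293801968, 1997847465209130, 1981081036958834,
   1590098361891162, 1450465309077160, 899968619514456, 1209121414448480, 1710676413449338,
   1605660991389018, 4065543380534330, 1693663410442218, 4111765356596850, 1458032152268165,
   3200496294576426, 2004227639099690, 860370043582794, 1391256898416026, 992039737863336,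
   1586640924295465, 385823187441650, 860608917634202, 4247960674690976, 4084428477033234,
   1010782975092472, 3177349122010226, 534566699841882, 1556018342112936, 1611021306047785,
   1981145461445794, 2004235205628938, 1605564354642058, 1589896313946250, 1391203781722442,
   1391203211297098, 230108769703242, 218014141797858, 4065648607347482, 4050530322465562,
   907190461808938, 881352508981674, 1610788444160778, 1610787219424010, 913513224093994,
   913512653668650, 4062350257012890, 4062351481749658, 1387630368932298, 1396975647342922,
   1589896498495626, 1605565763928202, 4050531731751706, 4065648791896858, 3084286917902989,
   2791374298205642, 410655747394642, 2814493957260296, 347338569586050, 4065685114552090,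
   410411571807906, 2927209264579792, 4352509598546330, 2865879243077962, 2786442720554152,
   1827962251756185, 3533875951059402, 235890819088714, 1799591845179033, 2485375214991706,
   907132479778090, 4490339992579568, 2862404195059010, 2494616340496082, 4501968616425992,
   2791220266658250, 751519201330528, 1719197628565106, 3559277707351576, 1589992950693210,
   4050425095652410, 1556040622245544, 3168335579464106, 1997905447239978, 848550293583930,
   1397029334461850, 1010849547053816, 857035504844386, 381700018837210, 992265223538856,
   834926691220384, 4086077744474306, 3200438866193706, 901330040267272, 555457420769322,
   1719227055787634, 4086201711251434, 1610830180106537, 4272782718389637, 1586832050236713,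
   324798581216642, 4050566829670170, 418932786922666, 4108709630067456, 3525312160219344,
   230118383042890, 3537449363849546, 2450968453350029, 2803194048203858, 398835997396426,
   1828179147501209, 913454671637802, 2490597895223338, 1867830814074920, 2792869534099994,
   4256027057651754, 3913805961139530, 2151927661405720, 4490148866427400, 4096079188224552,
   2869177777961018, 4343163749710058, 1799374949434009, 2927177052340432, 1063670245266818,
   3522800932060954, 630039385670826, 414352641508096, 3537439180084554, 3525344552179170,
   3522764424856346, 3537882709738266, 4327421241295880, 621518170556066, 3525344372458704,
   1086210233636226, 3537919216942874, 2438477304081522, 887515278061224, 1063640180501874,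
   611468534227178, 3275293758115200, 2455244856405290, 1086180168871282, 630160231899306,
   1508091762247282, 2047389471571290, 2151901891614232, 3522659198043194, 887536836773544,
   3177413546497186, 3200503290680330, 2047292834824330, 2062960875520138, 1481029760459538,
   4352516594642330, 4330506122472466, 4304593406241960, 1499721458131794, 4327408272519152,
   4360742692236306, 4334649530690754, 3292597124392400, 2063057512267098, 3537777482925114,
   751725359662432, 1499570547131514, 559582317427410, 899954946089560, 3168277597433258,
   359982952912258, 1012433282721760, 724586401453680, 3902185611527338, 848788983086874,
   1981138498895986, 3177407154372722, 4295816995125545, 1710706478206074, 3882088822001098,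
   996438589681632, 1387683535957226, 1022900432579682, 2974759050224725, 3285894865222440,
   4062246254937418, 1693633345685482, 1610883856170026, 901342925163016, 4296028689935657,
   447468329381185, 848752475882266, 2869379960259354, 2866082834661530, 860572410429594,
   434823039692097, 3902308387135658, 381623145660970, 3881937357367754, 3486388137813376,
   907338467787496, 856893586277698, 2371101557127976, 860466680300874, 1464293677599240,
   4086171646494698, 555352194120746, 3883615682830570, 3205312639151401, 3229503639792937,
   2792900789936362, 4252803885995394, 2802948865984162, 236952996894320, 2618270020593192,
   2869416467463962, 2440331719093569, 4251891205487322, 381610260773594, 2440333463924033,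
   4251891004160730, 381611972049626, 2638784696945648, 2802949235082914, 4234342121994648,
   4252803735000450, 2869416148696858, 661048463086889, 2792899598754026, 661047557117225,
   3902430793748354, 1693662856794090, 3881845015512802, 811837316135840, 992052706640968,
   860608414317722, 555493927945994, 359952888147314, 3177349172341874, 1556019147419304,
   1605662400675162, 1710675222267002, 907132309455592, 1568683496015264, 4065543565083706,
   1391257468841370, 997467234246728, 860370546899274, 2004228763173162, 3200496848224554,
   1586618929363241, 4276581566587989, 1611026825762089, 4330231194233954, 4343171316231402,
   4108634468175616, 419055193432234, 2438535286112370, 3168342625899898, 1085297502796506,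
   1085299415399130, 2159322873681656, 1085312300286506, 3530906038568258, 3275280168576384,
   398683526130122, 4330233106836578, 4303768067878880, 4343170192157930, 419054002249898,
   1085310387683882, 398682972481994, 3275280873219456, 3530907263305026, 1223997100802792,
   1578315663435205, 235891423068490, 3533876555039178, 3543476163821889, 4252773821230450,
   2004181518563338, 4490340797885936, 3537503050968474, 4304796712443976, 2865880971131210,
   3531047769877825, 4251904090374698, 3320408800581368, 2791221826939338, 1867907016222080,
   2862402785772866, 2791372737924554, 1499600611888250, 4327633758194672, 347340280862082,
   4065685299101466, 410410934273698, 4208013683854960, 218024879210978, 3525355289592290,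
   3091243580024261, 1819440516546881, 4334643658668226, 414277479616256, 3908018928921698,
   419176408862594, 2995486172172266, 398590630627042, 2786454900802632, 4062387988954266,
   1611025589995274, 3591404059491232, 2485269988343130, 2869274414679098, 4488987161757088,
   3012498537645178, 1223790942470888, 2494721567144658, 881294526950826, 4488762397303384,
   1819659157122369, 3525344602510818, 3537438626436426, 1086182031142258, 901533346672112,
   3200449603614730, 630161792180394, 1063640130170226, 3168288938834298, 887515361947304,
   611469087875306, 1063670194935170, 630037825389738, 3522802660114202, 4108656295340000,
   4207837590279792, 3522766152909594, 3537883213054746, 1086212095907202, 4096012616263208,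
   3537919720259354, 621517163923106, 4212785694594672]

theorem recognizeAll224 :
    recognizeAll codes [137, 160, 42, 144, 73, 37] certs224 = true := by
  decide +kernel

def certs233 : List ℕ :=
  [4032221846636274, 1715510760347626, 4368030725498760, 331950517416953, 1922559146056154,
   1927781818803354, 3123703676492369, 3005816160059673, 1074900039266498, 2681261630819250,
   4393981392131192, 617622474851866, 4038911610520826, 344030230350825, 2682575957920690,
   1080659489746978, 2581672674270393, 1394756345269170, 1953538087315378, 3831596780349178,
   3782036435340586, 2028744729290538, 3421063594348034, 318064889423794, 2842577964601074,
   3471210021227818, 4460919841211289, 386234253970354, 3982372082542314, 3826374107981506,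
   2027920086132090, 1945016860009522, 3788792362217162, 2095184315723290, 982617233822648,
   550926731451690, 1406626135935570, 1394756339501954, 3994354303099978, 2030681917875498,
   1962732408923658, 3803093925619098, 4443323225597722, 3472859290504538, 1601541212441970,
   2825535526243554, 552606298545498, 341072711393904, 1452541793319706, 867632632868634,
   1031591746649002, 1450645167058306, 771827137490528, 2825782704967106, 325337448048498,
   3436285242477730, 3461509470326650, 356853084826752, 2110871834767314, 3768914045611018,
   1188654447886506, 1681239717230762, 875054113795586, 2380019534775082, 1711275920704250,
   1430477632208938, 1922559144745130, 331950514139417, 1413694629672217, 2361602705572602,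
   1712100563861674, 872178912346410, 872178914181594, 2451041935284394, 623104784875994,
   621455515599274, 1361758155487274, 3874456374131066, 2575710153482162, 441542701511418,
   439338689237034, 1183645784216466, 706836686439938, 503282238029834, 4028272967019258,
   1410411452495362, 2586622474198922, 1167482362663354, 3541039827191194, 616318731517834,
   1380289408439466, 605525998796722, 1392007975049002, 3525004097030066, 3234836852194282,
   3220543193168394, 2578588733487466, 4019238503956866, 4196681159417834, 2064650935793394,
   1434964393754922, 2701602603403786, 2050716669376242, 4038542988798250, 520090357661706,
   1899769997858554, 4030846156390914, 3205074130253946, 3205074138119146, 2592477248436586,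
   1420759444787097, 526962458799882, 1923922746530170, 3197354775520770, 1183645778449314,
   3892971088951466, 1723367461115106, 1711547706004890, 4428688482581042, 619545833716658,
   1023875842358058, 330011450411545, 1712923066875970, 4409172143061938, 1371437283720050,
   1441836327535474, 1038963209426226, 1038963214537954, 499983715337138, 2574980958586082,
   727727401994194, 870930943487490, 3005816163337209, 2753616405136201, 2572687295507194,
   1720733432715218, 4364895389612808, 498929246580154, 3552859582301410, 242844669970394,
   1690344403960242, 1265896555458282, 3339824619036456, 3664330298930968, 1642878413485832,
   1572467131725592, 4084198998715730, 125552367896066, 2065868420672250, 1834609966536232,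
   2599957383552785, 4003791758343122, 2099307469778442, 962952725376904, 4333822305222897,
   1550137827184296, 1461826948869154, 1040255734168066, 2694526124385561, 1474213186288594,
   2177502332457552, 1031316867038162, 2687232226303497, 3978635094702090, 356853079059472,
   2110871820217386, 2388786679995289, 1201337681551240, 4254691310279808, 3892971090262490,
   822206714191024, 3555640185036552, 1666891973442442, 1022226576227194, 1364565349939498,
   3123978562525481, 625866971381258, 1397230640731170, 4341103354308778, 722467962881058,
   520090369852202, 4038542990633434, 1707699633034762, 4021869172164330, 4395632393063024,
   1076966511282098, 3894670670053704, 130815632213746, 435571015813289, 3285437968112537,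
   3299906857294137, 1431302168049618, 2578101246893066, 1438862740092825, 3193231605212674,
   445665855566570, 2579008676174858, 2064753735100482, 4070523801682696, 129166363591850,
   3186628143326538, 125552366715978, 1834609960769208, 2065868430108706, 544879431392554,
   224382764195578, 2577692279774537, 2845299044486210, 326436971866066, 3243442281506234,
   3437934511099642, 2701251006242809, 3994354297988506, 3803093917754890, 2030681927313394,
   1962732421113130, 2575710141292426, 1440449055881194, 3188008924981170, 1422644943582961,
   1433776069211650, 2577001735266186, 2767635171705673, 3287362113460569, 1427988285551897,
   2066693063830122, 125002610902218, 2071850138602616, 2063379345566218, 3894670656815880,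
   130815631033386, 3194599602627834, 1930519811827466, 1195526395560090, 1428553486860314,
   2381393924309754, 1692309345124522, 435571009129105, 2380019525337258, 628819246659698,
   1596692042649097, 865708264959722, 1688111664904346, 863107943252610, 865856720487154,
   4092445337627802, 2451866569006066, 1355435963627546, 632725509784178, 632725511619202,
   2141843530944002, 3771316196970226, 679111680953642, 3826374100116514, 1389258787130322,
   4350864743579889, 4442503021445873, 541061440347658, 3482480015412978, 4436451270059042,
   344178290582538, 2841203575066114, 1184206354940682, 1422683590135129, 3188008926684906,
   1923098112809402, 867726792868490, 869376062145274, 1711548677341706, 4428688474454610,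
   4112093655379722, 1678436831640458, 1364565336046346, 1434964379861770, 2380567126327690,
   601129013951058, 1722817700190162, 1722817705301506, 322864624830529, 847417156873594,
   1188654461780442, 4021562084690234, 442088061694698, 1178148226077682, 499983703147402,
   4017552728647970, 1884627838998250, 1428553500754210, 3208647543044658, 2601548219365826,
   3211946085792722, 2587254560340002, 4194118255123866, 2073806413559386, 432196852675306,
   4038544318269738, 4032220796938994, 1872831962978026, 1671905728757594, 1413798794919970,
   3535724335400442, 214216822490714, 607999899958322, 229925413717034, 631986772212746,
   3552309821376466, 4205202374532514, 2043760214865498, 3225765873399874, 2571716777949778,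
   2571716785813954, 3225765881265106, 2108988884433410, 982617231331456, 3788792363527202,
   4460919833084425, 2581672667586177, 2591711046344009, 382965113343072, 2105649139985482,
   3986606554003898, 2680085400722513, 848785109724194, 1201329548799528, 1461293924661762,
   1048227193469874, 1465950117473346, 751842197876168, 234282415037962, 2008953510553386,
   1943917348382642, 3980722815099914, 3821701183563514, 686683113622946, 2007317295785850,
   3789503606918778, 3809965873292706, 3437934509919266, 3454637522652194, 2845299036359714,
   1593986952170530, 868457266588738, 1475631537503154, 1550137831640840, 549002586103066,
   3787967728496138, 954981269876616, 2085838466887178, 235927622393594, 3986881433614786,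
   2083933799886786, 2722322352884784, 546284106685802, 1023345409439778, 903831296305456,
   1461293930035234, 3482480017247746, 4436451277924274, 2628784031130658, 1617209253138162,
   2591104115271850, 1715510752482570, 4387102520903856, 730201303156226, 2573331691144706,
   526646872309770, 2944698566358792, 2359298697877552, 2775881515598633, 1681239731124698,
   3018185669149593, 865708263255986, 4092170458016994, 3883344941957296, 1215157078496290,
   2042503798581418, 3305023287375456, 736184402597936, 1350213297290106, 1716457805120010,
   229925408343562, 3552309826487810, 1923922747841426, 1925033047219186, 344320023229337,
   2592478514244346, 3382863037334544, 1710837835929554, 1075436809515074, 2684500103268402,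
   3123978554398905, 3109505370249737, 330011457096585, 4037537220985866, 990133491029120,
   618172230665738, 1079023207870626, 2683735531980850, 4254691307790264, 904043410726064,
   2372568883485425, 1672114653674114, 3895444991425522, 814235258690736, 2679114727863312,
   493976968692066, 4029472019704450, 735387224507746, 605526006267290, 1392007960499266,
   4334231406636018, 1343399751104546, 3105561742760001, 1024700477389138, 1712922313266242,
   2593597494782962, 1009373591272904, 1228113568765282, 2044962516363906, 2073148884127672,
   1406626141702922, 2599957390236969, 549002599996450, 2031506561033658, 3806667330544706,
   3787854337641994, 1936619019954018, 2687232232988569, 4464945542718538, 334958186980762,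
   3254162519877618, 2626838252611082, 2388786683271361, 1424430329135146, 1190242861323202,
   3109505379293705, 1923098113989458, 735387235518194, 1655138191376306, 2602922332718522,
   616318746459778, 1380289406735642, 3541039826929570, 3194599607084522, 1389258794470370,
   375137845750992, 2085838465183242, 3787967729675786, 544879428377618, 235927633272514,
   3766440145628330, 382965104824296, 2107501830126466, 686683128565066, 4056345092787250,
   2122028473487010, 3789503601806378, 3422987740483186, 2825535526636746, 3472859285393162,
   1601541227384218, 552606309424890, 867632634048338, 1452481112878930, 341072701301208,
   1472360520002610, 846311208431162, 3569994027111304, 3831596786247634, 2028744719460194,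
   3993092315538890, 1953538087839626, 4464945548616730, 3254162519614978, 334958187504706,
   2626838242780330, 3193231609668938, 1922284268017970, 1195526406439146, 2662075623080817,
   4024424673045042, 526646872834098, 730201314166762, 2753616408544113, 428565458981090,
   3535724335138250, 214216828127202, 607999914901442, 1420759453830193, 1614833993551369,
   2592478504413482, 4387160498239736, 1710837833963258, 2071850130083440, 125002612868466,
   1083467296998570, 4021869172557778, 633290517513250, 3390785208075016, 449589792475377,
   1228113574664146, 2671407760484224, 2044962515970810, 322864634923249, 1433776080221706,
   2577001747979386, 869376057033522, 867726789591986, 616798006165666, 619546785234978,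
   1023875843537426, 2360775907197154, 1712923057045802, 1371437294598378, 3895444991294082,
   4210104832908168, 3577905293663280, 3892696212225010, 1678436842519290, 1022226576096098,
   4021162650091882, 3412615679689642, 4019238504743658, 3396947638992938, 1065554203275786,
   2701602610874682, 2586622474722370, 1410411458131938, 822206718778544, 349219546748936,
   1666891970427786, 2380567116497762, 1693131847746218, 2683735546923306, 1079023220716266,
   1237846164942234, 1438862743369625, 1596692051692961, 1066424866768314, 3883344942481864,
   140670653564658, 3394082954413992, 4038911602788034, 617622476818338, 344030233758409,
   129166365558042, 4070523801026720, 2064753725270394, 1413694668836721, 1720733438612506,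
   2572687295113898, 1017699312864416, 2591711056437105, 2595691450932937, 2697270615153993,
   2701251009649905, 2577692283182409, 4333822314266865, 4442503022363337, 2680085410815689,
   1401353422375890, 3821701181596978, 1943917361096626, 3778188141366570, 2008953510159586,
   2139070903717810, 3787854334364842, 4054420947439538, 669915576241322, 2370508697292432,
   1031591749401522, 1450645165354050, 3461509465214514, 2607047033481002, 325337460761722,
   3436285244444162, 550926742330666, 2083933798182402, 3986881436367322, 2722322353409104,
   1584773675060346, 3421063595134450, 3471210017951626, 2842577956867546, 4003791762799082,
   962952729964520, 2099307482623722, 224382761181106, 1465950130319282, 893366461819704,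
   1048227197925530, 541061437333386, 432196850971474, 2602373310979594, 1043102618113970,
   1054922368112410, 4092445340380330, 623104779763730, 621455512322194, 1361758166366914,
   1572467121632664, 3523591200486424, 870930947944282, 1692309344731946, 2381393914478970,
   875054116548098, 1688111675783322, 4092170462473714, 3387805297787690, 3385881152438442,
   4030296401363706, 4045964442059130, 4195581648314290, 2067124842592234, 1660074129275370,
   445665868411826, 2579008688889394, 1712100554031274, 2361602705179386, 3375523967817824,
   736184399321464, 4205202375057290, 2043760220501506, 1350213294275506, 3197354778272786,
   1925033047087170, 237581450216970, 625866978852818, 4341103349197098, 2767635181797705,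
   1441836338413722, 2585701191583234, 503282250743818, 706836692076034, 1167488859931034,
   3105561743677769, 1430477643088146, 3285437977156505, 3127647321151905, 1178148233417714,
   1671905743699538, 2591102582719762, 1872831961274202, 242844680979530, 4346146395778034,
   599551194136418, 2451041936464394, 1927781823259802]

theorem recognizeAll233 :
    recognizeAll codes [81, 20, 82, 134, 12, 37] certs233 = true := by
  decide +kernel

theorem runSearch035 :
    (runSearch [192, 5, 80, 136, 40, 6] (fun _ => Step.fail) ()).isSome = true := by
  decide +kernel

theorem runSearch_even6 :
    (runSearch [3, 5, 9, 17, 33] (fun _ => Step.fail) ()).isSome = true := by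
  decide +kernel

theorem glueTest0 : glueTest [62063, 28307, 24348, 16352, 68570, 129346, 125996] 65632 95743 = true := by
  decide +kernel

theorem glueTest1 : glueTest [62063, 28307, 24348, 16352, 70618, 71335, 116338] 22 98303 = true := by
  decide +kernel

theorem glueTest2 : glueTest [62063, 28307, 24348, 16352, 70618, 79095, 101105] 25 96 = true := by
  decide +kernel

theorem glueTest3 : glueTest [12911, 44691, 24348, 16352, 72410, 116408, 98781] 16384 34048 = true := by
  decide +kernel

theorem glueTest4 : glueTest [62063, 28307, 24348, 16352, 70618, 129410, 103591] 65536 65532 = true := by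
  decide +kernel

theorem glueTest5 : glueTest [62063, 28307, 24348, 16352, 78554, 128022, 116515] 13451 13581 = true := by
  decide +kernel

section Residual

variable {K : Submodule (ZMod 2) V} {T : Finset (Fin 30)} {h : V}

theorem exists_residual (hT : T.card = 24) (h16 : wt T h = 16) :
    ∃ (σ : Fin 16 → Fin 30) (τ : Fin 8 → Fin 30), (∀ j, σ j ∈ T) ∧ (∀ j, τ j ∈ T) ∧
      Function.Injective τ ∧ (∀ v, wt T v = hammingNorm (v ∘ σ) + hammingNorm (v ∘ τ)) ∧
      (∀ j, h (σ j) = 1) ∧ ∀ j, h (τ j) = 0 := by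
  obtain ⟨σ, hσ, hσT⟩ := exists_enum h16
  obtain ⟨τ, hτ, hτT⟩ := exists_enum (S := T.filter fun t => ¬h t ≠ 0) (n := 8) (by
    have := Finset.card_filter_add_card_filter_not (s := T) fun t => h t ≠ 0
    rw [wt] at h16
    omega)
  have h1 (j : Fin 16) : σ j ∈ T ∧ h (σ j) ≠ 0 := by
    rw [← Finset.mem_filter (p := fun t => h t ≠ 0), ← hσT]
    exact Finset.mem_image_of_mem _ (Finset.mem_univ _)
  have h2 (j : Fin 8) : τ j ∈ T ∧ ¬h (τ j) ≠ 0 := by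
    rw [← Finset.mem_filter (p := fun t => ¬h t ≠ 0), ← hτT]
    exact Finset.mem_image_of_mem _ (Finset.mem_univ _)
  refine ⟨σ, τ, fun j => (h1 j).1, fun j => (h2 j).1, hτ, fun v => ?_, fun j => ?_,
    fun j => not_not.1 (h2 j).2⟩
  · rw [← wt_image hσ, ← wt_image hτ, hσT, hτT,
      ← wt_union (Finset.disjoint_filter_filter_not _ _ _), Finset.filter_union_filter_not_eq]
  · have h3 (a : ZMod 2) (ha : a ≠ 0) : a = 1 := by revert a; decide
    exact h3 _ (h1 j).2

variable {σ : Fin 16 → Fin 30} {τ : Fin 8 → Fin 30}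

theorem ten_le_residual (hwt : ∀ v, wt T v = hammingNorm (v ∘ σ) + hammingNorm (v ∘ τ))
    (hK : ∀ v ∈ K, v ≠ 0 → Even (wt T v) ∧ 10 ≤ wt T v) (hh : h ∈ K)
    (h1 : ∀ j, h (σ j) = 1) (h0 : ∀ j, h (τ j) = 0)
    {v : V} (hv : v ∈ K) (hv0 : v ≠ 0) (hvh : v ≠ h) :
    10 ≤ hammingNorm (v ∘ σ) + hammingNorm (v ∘ τ) ∧
      hammingNorm (v ∘ σ) ≤ 6 + hammingNorm (v ∘ τ) := by
  have h2 := (hK v hv hv0).2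
  have h3 := (hK (v + h) (K.add_mem hv hh) fun h => hvh (by
    rwa [CharTwo.add_eq_zero] at h)).2
  have h8 : (v + h) ∘ σ = v ∘ σ + 1 := by
    ext j
    simp [h1]
  have h9 : (v + h) ∘ τ = v ∘ τ := by
    ext j
    simp [h0]
  have he := hammingNorm_add_one (v ∘ σ)
  rw [hwt] at h2 h3
  rw [h8, h9] at h3
  omega

theorem residual_ne_one (hwt : ∀ v, wt T v = hammingNorm (v ∘ σ) + hammingNorm (v ∘ τ))
    (hK : ∀ v ∈ K, v ≠ 0 → Even (wt T v) ∧ 10 ≤ wt T v) (hh : h ∈ K)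
    (h1 : ∀ j, h (σ j) = 1) (h0 : ∀ j, h (τ j) = 0)
    {v : V} (hv : v ∈ K) : hammingNorm (v ∘ τ) ≠ 1 := fun h2 => by
  have := ten_le_residual hwt hK hh h1 h0 hv (by
    rintro rfl
    rw [show (0 : V) ∘ τ = 0 from rfl, hammingNorm_zero] at h2
    cases h2) (by
    rintro rfl
    rw [show v ∘ τ = 0 from funext h0, hammingNorm_zero] at h2
    cases h2)
  omega

theorem residual_finrank (hwt : ∀ v, wt T v = hammingNorm (v ∘ σ) + hammingNorm (v ∘ τ))
    (hK : ∀ v ∈ K, v ≠ 0 → Even (wt T v) ∧ 10 ≤ wt T v) (hh : h ∈ K)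
    (h1 : ∀ j, h (σ j) = 1) (h0 : ∀ j, h (τ j) = 0) :
    Module.finrank (ZMod 2)
    (K.map (LinearMap.funLeft (ZMod 2) (ZMod 2) τ)) + 1 = Module.finrank (ZMod 2) K := by
  rw [← LinearMap.finrank_range_add_finrank_ker
    ((LinearMap.funLeft (ZMod 2) (ZMod 2) τ).domRestrict K), LinearMap.range_domRestrict]
  congr 1
  have hmem : (⟨h, hh⟩ : K) ∈
      LinearMap.ker ((LinearMap.funLeft (ZMod 2) (ZMod 2) τ).domRestrict K) := by
    rw [LinearMap.mem_ker]
    exact funext h0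
  symm
  refine finrank_eq_one (⟨_, hmem⟩ : LinearMap.ker _) (fun h2 => ?_) fun w => ?_
  · have h3 : h = 0 := congrArg (fun x : LinearMap.ker _ => (x : K).1) h2
    have := h1 0
    rw [h3] at this
    simp at this
  · obtain ⟨⟨v, hv⟩, hw⟩ := w
    have hvτ : v ∘ τ = 0 := by
      rw [LinearMap.mem_ker] at hw
      exact hw
    by_cases hv0 : v = 0
    · exact ⟨0, by ext1; ext1; simp [hv0]⟩
    · refine ⟨1, ?_⟩
      ext1
      ext1
      rw [one_smul]
      by_contra hne
      have := ten_le_residual hwt hK hh h1 h0 hv hv0 (Ne.symm hne)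
      rw [hvτ, hammingNorm_zero] at this
      omega

end Residual

theorem residual_comp_perm {K : Submodule (ZMod 2) V} {T : Finset (Fin 30)} {h : V}
    {σ : Fin 16 → Fin 30} {τ : Fin 8 → Fin 30} (hτ : ∀ j, τ j ∈ T)
    (hwt : ∀ v, wt T v = hammingNorm (v ∘ σ) + hammingNorm (v ∘ τ))
    (h0 : ∀ j, h (τ j) = 0) {c : Fin 8 → Fin 3}
    (hc : ∀ y : Fin 8 → ZMod 2, (∃ v ∈ K, v ∘ τ = y) ↔ ∀ a b, blockSum c a y = blockSum c b y)
    {ρ : Equiv.Perm (Fin 3)} {π : Equiv.Perm (Fin 8)} {g : Fin 8 → Fin 3} (hg : ρ ∘ c ∘ π = g)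
    {bs : List ℕ} (hbs : ∀ x ∈ bs, ∀ a b, blockSum g a (fun i => bitz x i) =
      blockSum g b (fun i => bitz x i)) :
    (∀ j, (τ ∘ π) j ∈ T) ∧ (∀ v, wt T v = hammingNorm (v ∘ σ) + hammingNorm (v ∘ τ ∘ π)) ∧
      (∀ j, h ((τ ∘ π) j) = 0) ∧ ∀ b ∈ bs, ∃ v ∈ K, ∀ j : Fin 8, v ((τ ∘ π) j) = bitz b j := by
  refine ⟨fun j => hτ _, fun v => ?_, fun j => h0 _, fun x hx => ?_⟩
  · rw [hwt, ← hammingNorm_comp_perm (v ∘ τ) π]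
    rfl
  · obtain ⟨v, hv, hvτ⟩ := (hc ((fun i : Fin 8 => bitz x i) ∘ π.symm)).2 fun a b => by
      have h2 (a : Fin 3) : blockSum c a ((fun i : Fin 8 => bitz x i) ∘ π.symm) =
          blockSum g (ρ a) fun i => bitz x i := by
        rw [← hg, blockSum_perm_comp, Equiv.symm_apply_apply, ← blockSum_comp_perm c π]
        congr 1
        ext i
        simp
      rw [h2, h2]
      exact hbs x hx _ _
    refine ⟨v, hv, fun j => ?_⟩
    have := congrFun hvτ (π j)
    simpa using this

theorem dualCol_injective : ∀ s ∈ codes, ∀ k < 24, ∀ l < 24, dualCol s k = dualCol s l → k = l := by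
  decide +kernel

theorem exists_hasForm {K : Submodule (ZMod 2) V} {T : Finset (Fin 30)} (hT : T.card = 24)
    (hK : ∀ v ∈ K, v ≠ 0 → Even (wt T v) ∧ 10 ≤ wt T v) (hdim : Module.finrank (ZMod 2) K = 7)
    (hB1 : ∀ t ∈ T, ∃ v ∈ K, v t ≠ 0) (hB2 : ∀ s ∈ T, ∀ t ∈ T, s ≠ t → ∃ v ∈ K, v s + v t ≠ 0)
    {h : V} (hh : h ∈ K) (h16 : wt T h = 16) : ∃ s ∈ codes, HasForm s K T := by
  obtain ⟨σ, τ, hσ, hτ, hτi, hwt, h1, h0⟩ := exists_residual hT h16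
  obtain ⟨c, hc, hne⟩ := exists_blocks
    (R := K.map (LinearMap.funLeft (ZMod 2) (ZMod 2) τ))
    (by have := residual_finrank hwt hK hh h1 h0; omega) (fun i hi => by
      obtain ⟨v, hv, hvi⟩ := Submodule.mem_map.1 hi
      refine residual_ne_one hwt hK hh h1 h0 hv ?_
      have hvi' : v ∘ τ = Pi.single i 1 := hvi
      rw [hvi', hammingNorm, Finset.card_eq_one]
      refine ⟨i, ?_⟩
      ext j
      simp [Pi.single_apply])
  have hc' (y : Fin 8 → ZMod 2) :
      (∃ v ∈ K, v ∘ τ = y) ↔ ∀ a b, blockSum c a y = blockSum c b y := by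
    rw [← hc, Submodule.mem_map]
    rfl
  have hdual (a : Fin 3) {v : V} (hv : v ∈ K) : ∑ i with c i ≠ a, v (τ i) = 0 := by
    have h2 := (hc' (v ∘ τ)).1 ⟨v, hv, rfl⟩
    have h3 : ∑ i with c i ≠ a, v (τ i) = ∑ b with b ≠ a, blockSum c b (v ∘ τ) := by
      rw [Finset.sum_filter, Finset.sum_filter, ← Finset.sum_fiberwise Finset.univ c]
      refine Finset.sum_congr rfl fun b _ => ?_
      split_ifs with hb
      · refine Finset.sum_congr rfl fun i hi => ?_
        rw [(Finset.mem_filter.1 hi).2, if_pos hb]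
        rfl
      · refine Finset.sum_eq_zero fun i hi => ?_
        rw [(Finset.mem_filter.1 hi).2, if_neg hb]
    have h4 : (Finset.univ.filter fun b : Fin 3 => b ≠ a).card = 2 := by
      clear hne h3
      revert a
      decide
    rw [h3, Finset.sum_congr rfl fun b _ => h2 b a, Finset.sum_const, h4, two_smul,
      CharTwo.add_self_eq_zero]
  obtain ⟨ρ, π, hg⟩ := exists_sorted_blocks c fun a => by
    by_contra! h3
    obtain h3 | h3 | h3 : (Finset.univ.filter fun i => c i ≠ a).card = 0 ∨
        (Finset.univ.filter fun i => c i ≠ a).card = 1 ∨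
        (Finset.univ.filter fun i => c i ≠ a).card = 2 := by omega
    · obtain ⟨i, hi⟩ := hne a
      rw [Finset.card_eq_zero] at h3
      exact (Finset.eq_empty_iff_forall_notMem.1 h3) i (by simpa using hi)
    · obtain ⟨i, hi⟩ := Finset.card_eq_one.1 h3
      obtain ⟨v, hv, hvi⟩ := hB1 _ (hτ i)
      have := hdual a hv
      rw [hi, Finset.sum_singleton] at this
      exact hvi this
    · obtain ⟨i, j, hij, hi⟩ := Finset.card_eq_two.1 h3
      obtain ⟨v, hv, hvi⟩ := hB2 _ (hτ i) _ (hτ j) fun h => hij (hτi h)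
      have := hdual a hv
      rw [hi, Finset.sum_pair hij] at this
      exact hvi this
  simp only [Set.mem_insert_iff, Set.mem_singleton_iff] at hg
  obtain hg | hg | hg | hg | hg | hg := hg
  · obtain ⟨-, h3, h4, h5⟩ := residual_comp_perm hτ hwt h0 hc' hg
      (bs := [192, 5, 80, 136, 40, 6]) (by decide)
    exact (false_of_runSearch h3 hK hh h1 h4 h5 (by decide) runSearch035).elim
  · obtain ⟨h2, h3, h4, h5⟩ := residual_comp_perm hτ hwt h0 hc' hg
      (bs := [96, 9, 5, 192, 80, 6]) (by decide)
    exact hasForm_of_recognizeAll hσ h2 h3 hK hh h1 h4 h5 (by decide) dualCol_injective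
      recognizeAll044
  · obtain ⟨h2, h3, h4, h5⟩ := residual_comp_perm hτ hwt h0 hc' hg
      (bs := [69, 192, 40, 13, 80, 131]) (by decide)
    exact hasForm_of_recognizeAll hσ h2 h3 hK hh h1 h4 h5 (by decide) dualCol_injective
      recognizeAll125
  · obtain ⟨h2, h3, h4, h5⟩ := residual_comp_perm hτ hwt h0 hc' hg
      (bs := [131, 192, 137, 41, 144, 69]) (by decide)
    exact hasForm_of_recognizeAll hσ h2 h3 hK hh h1 h4 h5 (by decide) dualCol_injective
      recognizeAll134
  · obtain ⟨h2, h3, h4, h5⟩ := residual_comp_perm hτ hwt h0 hc' hg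
      (bs := [137, 160, 42, 144, 73, 37]) (by decide)
    exact hasForm_of_recognizeAll hσ h2 h3 hK hh h1 h4 h5 (by decide) dualCol_injective
      recognizeAll224
  · obtain ⟨h2, h3, h4, h5⟩ := residual_comp_perm hτ hwt h0 hc' hg
      (bs := [81, 20, 82, 134, 12, 37]) (by decide)
    exact hasForm_of_recognizeAll hσ h2 h3 hK hh h1 h4 h5 (by decide) dualCol_injective
      recognizeAll233

theorem add_mem_of_finrank_le {M : Type*} [AddCommGroup M] [Module (ZMod 2) M]
    [FiniteDimensional (ZMod 2) M] {R W : Submodule (ZMod 2) M} (hRW : R ≤ W)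
    (hd : Module.finrank (ZMod 2) W ≤ Module.finrank (ZMod 2) R + 1) {x y : M} (hx : x ∈ W)
    (hy : y ∈ W) (hxR : x ∉ R) (hyR : y ∉ R) : x + y ∈ R := by
  have h1 : R < R ⊔ Submodule.span (ZMod 2) {x} := by
    refine lt_of_le_of_ne le_sup_left fun h => hxR ?_
    rw [h]
    exact Submodule.mem_sup_right (Submodule.mem_span_singleton_self x)
  have h2 := Submodule.finrank_lt_finrank_of_lt h1
  have h3 : R ⊔ Submodule.span (ZMod 2) {x} = W :=
    Submodule.eq_of_le_of_finrank_le
      (sup_le hRW ((Submodule.span_singleton_le_iff_mem _ _).2 hx)) (by omega)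
  rw [← h3, Submodule.mem_sup] at hy
  obtain ⟨r, hr, z, hz, rfl⟩ := hy
  obtain ⟨a, rfl⟩ := Submodule.mem_span_singleton.1 hz
  have ha : ∀ a : ZMod 2, a = 0 ∨ a = 1 := by decide
  obtain rfl | rfl := ha a
  · rw [zero_smul, add_zero] at hyR
    exact absurd hr hyR
  · have h4 : x + x = 0 := by
      rw [← two_smul (ZMod 2), show (2 : ZMod 2) = 0 from rfl, zero_smul]
    rwa [one_smul, add_comm r, ← add_assoc, h4, zero_add]

theorem false_of_finrank_eq_six {K : Submodule (ZMod 2) V} {T : Finset (Fin 30)} (hT : T.card = 22)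
    (hsupp : ∀ v ∈ K, ∀ t ∉ T, v t = 0)
    (hK : ∀ v ∈ K, v ≠ 0 → Even (wt T v) ∧ 10 ≤ wt T v) (hdim : Module.finrank (ZMod 2) K = 6)
    {h : V} (hh : h ∈ K) (h16 : wt T h = 16) : False := by
  obtain ⟨T', hTT', hT'⟩ := Finset.exists_superset_card_eq (n := 24) (by omega : T.card ≤ 24)
    (by simp)
  have hwtT (v : V) (hv : ∀ t ∉ T, v t = 0) : wt T' v = wt T v := by
    rw [wt, wt]
    congr 1
    ext t
    simp only [Finset.mem_filter]
    exact ⟨fun h => ⟨by_contra fun ht => h.2 (hv t ht), h.2⟩, fun h => ⟨hTT' h.1, h.2⟩⟩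
  have hK' : ∀ v ∈ K, v ≠ 0 → Even (wt T' v) ∧ 10 ≤ wt T' v := fun v hv => by
    rw [hwtT v (hsupp v hv)]
    exact hK v hv
  obtain ⟨σ, τ, -, -, hτi, hwt, h1, h0⟩ := exists_residual hT' (by rwa [hwtT h (hsupp h hh)])
  let f : V := fun t => if t ∈ T then 1 else 0
  have hfσ (j : Fin 16) : (f ∘ σ) j = 1 := if_pos (by
    by_contra h2
    have := h1 j
    rw [hsupp h hh _ h2] at this
    simp at this)
  have hf : hammingNorm (f ∘ τ) = 6 := by
    have h2 := hwt f
    have h3 : hammingNorm (f ∘ σ) = 16 := by simp only [hammingNorm, hfσ]; rfl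
    have h4 : wt T f = 22 := by
      rw [wt, Finset.filter_true_of_mem, hT]
      intro t ht
      simp [f, ht]
    rw [h3, hwtT f fun t ht => if_neg ht, h4] at h2
    omega
  obtain ⟨π, hπ⟩ := exists_comp_perm_eq (f := f ∘ τ) (g := ![1, 1, 1, 1, 1, 1, 0, 0]) fun b => by
    have h2 := Finset.card_filter_add_card_filter_not (s := (Finset.univ : Finset (Fin 8)))
      fun i => (f ∘ τ) i = 0
    rw [hammingNorm] at hf
    rw [Finset.card_univ, Fintype.card_fin, hf] at h2
    rw [Fintype.card_subtype]
    have hb : b = 0 ∨ b = 1 := by revert b; decide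
    obtain rfl | rfl := hb
    · rw [show (Finset.univ.filter fun i => (f ∘ τ) i = 0).card = 2 by omega]
      rfl
    · have h3 (a : ZMod 2) : a = 1 ↔ a ≠ 0 := by revert a; decide
      simp only [h3 ((f ∘ τ) _)]
      rw [hf]
      rfl
  have hwt' (v : V) : wt T' v = hammingNorm (v ∘ σ) + hammingNorm (v ∘ τ ∘ π) := by
    rw [hwt, ← hammingNorm_comp_perm (v ∘ τ) π]
    rfl
  have h0' (j : Fin 8) : h ((τ ∘ π) j) = 0 := h0 _
  generalize hτ' : τ ∘ π = τ' at h0' hwt'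
  have hz (v : V) (hv : v ∈ K) (j : Fin 2) : v (τ' (Fin.natAdd 6 j)) = 0 := by
    refine hsupp v hv _ fun h2 => ?_
    have h3 : f (τ' (Fin.natAdd 6 j)) = 0 := by
      rw [← hτ']
      refine (congrFun hπ (Fin.natAdd 6 j)).trans ?_
      fin_cases j <;> rfl
    simp [f, h2] at h3
  let W := LinearMap.ker (LinearMap.funLeft (ZMod 2) (ZMod 2) (Fin.natAdd 6 : Fin 2 → Fin 8))
  have hW : Module.finrank (ZMod 2) W = 6 := by
    have h2 := LinearMap.finrank_range_add_finrank_ker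
      (LinearMap.funLeft (ZMod 2) (ZMod 2) (Fin.natAdd 6 : Fin 2 → Fin 8))
    rw [LinearMap.range_eq_top.2 (LinearMap.funLeft_surjective_of_injective _ _ _
      (Fin.natAdd_injective 2 6)), finrank_top, Module.finrank_fin_fun,
      Module.finrank_fin_fun] at h2
    change _ + Module.finrank (ZMod 2) W = 8 at h2
    omega
  have hRW : K.map (LinearMap.funLeft (ZMod 2) (ZMod 2) τ') ≤ W := by
    rintro _ ⟨v, hv, rfl⟩
    rw [LinearMap.mem_ker]
    exact funext fun j => hz v hv j
  have hRd := residual_finrank hwt' hK' hh h1 h0'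
  have hsW (i : Fin 6) : (Pi.single (Fin.castAdd 2 i) 1 : Fin 8 → ZMod 2) ∈ W := by
    rw [LinearMap.mem_ker]
    revert i
    decide
  have hsR (i : Fin 8) : (Pi.single i 1 : Fin 8 → ZMod 2) ∉
      K.map (LinearMap.funLeft (ZMod 2) (ZMod 2) τ') := by
    rintro ⟨v, hv, hvi⟩
    refine residual_ne_one hwt' hK' hh h1 h0' hv ?_
    have hvi' : v ∘ τ' = Pi.single i 1 := hvi
    rw [hvi', hammingNorm, Finset.card_eq_one]
    refine ⟨i, ?_⟩
    ext j
    simp [Pi.single_apply]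
  refine false_of_runSearch hwt' hK' hh h1 h0' (bs := [3, 5, 9, 17, 33]) (fun x hx => ?_)
    (by decide) runSearch_even6
  obtain ⟨i, hi⟩ : ∃ i : Fin 6, ∀ j : Fin 8, (Pi.single (Fin.castAdd 2 0) 1 +
      Pi.single (Fin.castAdd 2 i) 1 : Fin 8 → ZMod 2) j = bitz x j := by
    revert x
    decide
  obtain ⟨v, hv, h2⟩ := add_mem_of_finrank_le hRW (by rw [hRd, hdim, hW]) (hsW 0) (hsW i) (hsR _) (hsR _)
  exact ⟨v, hv, fun j => (congrFun h2 j).trans (hi j)⟩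

/-! ### Even codes of minimum weight ten -/

/-- `S` is supported on `T`, and its nonzero words have even weight at least ten. -/
def IsEvenCode (T : Finset (Fin 30)) (S : Submodule (ZMod 2) V) : Prop :=
  (∀ v ∈ S, ∀ t ∉ T, v t = 0) ∧ ∀ v ∈ S, v ≠ 0 → Even (wt T v) ∧ 10 ≤ wt T v

/-- There is no even code of length `n`, dimension at least `k` and minimum weight ten. -/
def NoCode (n k : ℕ) : Prop :=
  ∀ (T : Finset (Fin 30)) (S : Submodule (ZMod 2) V), T.card = n → IsEvenCode T S →
    Module.finrank (ZMod 2) S < k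

/-- The words that vanish on `U`. -/
def vanishing (U : Finset (Fin 30)) : Submodule (ZMod 2) V where
  carrier := {v | ∀ t ∈ U, v t = 0}
  add_mem' ha hb t ht := by simp [ha t ht, hb t ht]
  zero_mem' _ _ := rfl
  smul_mem' c v hv t ht := by simp [hv t ht]

theorem mem_vanishing {U : Finset (Fin 30)} {v : V} : v ∈ vanishing U ↔ ∀ t ∈ U, v t = 0 := Iff.rfl

theorem zmod_two_eq_zero_or (a : ZMod 2) : a = 0 ∨ a = 1 := by revert a; decide

theorem wt_cast (T : Finset (Fin 30)) (v : V) : (wt T v : ZMod 2) = ∑ t ∈ T, v t := by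
  rw [wt, Finset.card_filter, Nat.cast_sum]
  refine Finset.sum_congr rfl fun t _ => ?_
  obtain h | h := zmod_two_eq_zero_or (v t) <;> simp [h]

theorem wt_zero (T : Finset (Fin 30)) : wt T 0 = 0 := by simp [wt]

theorem wt_le_card (T : Finset (Fin 30)) (v : V) : wt T v ≤ T.card := Finset.card_filter_le _ _

theorem wt_sdiff {U T : Finset (Fin 30)} {v : V} (hv : v ∈ vanishing U) : wt (T \ U) v = wt T v := by
  unfold wt
  congr 1
  ext t
  simp only [Finset.mem_filter, Finset.mem_sdiff]
  exact ⟨fun h => ⟨h.1.1, h.2⟩, fun h => ⟨⟨h.1, fun h2 => h.2 (hv t h2)⟩, h.2⟩⟩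

theorem IsEvenCode.mono {T : Finset (Fin 30)} {S S' : Submodule (ZMod 2) V} (h : IsEvenCode T S)
    (hS : S' ≤ S) : IsEvenCode T S' :=
  ⟨fun v hv => h.1 v (hS hv), fun v hv => h.2 v (hS hv)⟩

theorem IsEvenCode.shorten {T : Finset (Fin 30)} {S : Submodule (ZMod 2) V} (h : IsEvenCode T S)
    (U : Finset (Fin 30)) : IsEvenCode (T \ U) (S ⊓ vanishing U) := by
  refine ⟨fun v hv t ht => ?_, fun v hv hv0 => ?_⟩
  · by_cases h2 : t ∈ U
    · exact hv.2 t h2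
    · exact h.1 v hv.1 t fun h3 => ht (Finset.mem_sdiff.2 ⟨h3, h2⟩)
  · rw [wt_sdiff hv.2]
    exact h.2 v hv.1 hv0

/-- Restriction to `U` of the words of `S`. -/
def restriction (S : Submodule (ZMod 2) V) (U : Finset (Fin 30)) : S →ₗ[ZMod 2] U → ZMod 2 :=
  (LinearMap.funLeft (ZMod 2) (ZMod 2) ((↑) : U → Fin 30)).comp S.subtype

theorem finrank_range_restriction (S : Submodule (ZMod 2) V) (U : Finset (Fin 30)) :
    Module.finrank (ZMod 2) (LinearMap.range (restriction S U)) +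
      Module.finrank (ZMod 2) ↥(S ⊓ vanishing U) = Module.finrank (ZMod 2) S := by
  rw [← LinearMap.finrank_range_add_finrank_ker (restriction S U)]
  congr 1
  have h : S ⊓ vanishing U = (LinearMap.ker (restriction S U)).map S.subtype := by
    ext v
    simp only [Submodule.mem_inf, Submodule.mem_map, LinearMap.mem_ker]
    constructor
    · rintro ⟨h1, h2⟩
      exact ⟨⟨v, h1⟩, funext fun t => h2 t t.2, rfl⟩
    · rintro ⟨w, hw, rfl⟩
      exact ⟨w.2, fun t ht => congrFun hw ⟨t, ht⟩⟩
  rw [h, Submodule.finrank_map_subtype_eq]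

theorem finrank_le_add_card (S : Submodule (ZMod 2) V) (U : Finset (Fin 30)) :
    Module.finrank (ZMod 2) S ≤ Module.finrank (ZMod 2) ↥(S ⊓ vanishing U) + U.card := by
  have h1 := finrank_range_restriction S U
  have h2 := Submodule.finrank_le (LinearMap.range (restriction S U))
  rw [Module.finrank_fintype_fun_eq_card, Fintype.card_coe] at h2
  omega

theorem exists_le_finrank_eq {S : Submodule (ZMod 2) V} {k : ℕ} (h : k ≤ Module.finrank (ZMod 2) S) :
    ∃ S' ≤ S, Module.finrank (ZMod 2) S' = k := by
  obtain ⟨f, hf⟩ := exists_linearIndependent_of_le_finrank h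
  refine ⟨(Submodule.span (ZMod 2) (Set.range f)).map S.subtype, Submodule.map_subtype_le _ _, ?_⟩
  rw [Submodule.finrank_map_subtype_eq, finrank_span_eq_card hf, Fintype.card_fin]

/-- It suffices to exclude the dimension `k` itself. -/
theorem noCode_of_finrank_ne {n k : ℕ} (h : ∀ (T : Finset (Fin 30)) (S : Submodule (ZMod 2) V),
    T.card = n → IsEvenCode T S → Module.finrank (ZMod 2) S ≠ k) : NoCode n k := by
  intro T S hT hS
  by_contra! h2
  obtain ⟨S', hS', h3⟩ := exists_le_finrank_eq h2
  exact h T S' hT (hS.mono hS') h3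

theorem NoCode.succ {n k : ℕ} (h : NoCode n k) : NoCode (n + 1) (k + 1) := by
  intro T S hT hS
  obtain ⟨t, ht⟩ : T.Nonempty := Finset.card_pos.1 (by omega)
  have h1 := h _ _ (by rw [Finset.card_sdiff_of_subset (by simpa using ht)]; simp [hT]) (hS.shorten {t})
  have h2 := finrank_le_add_card S {t}
  rw [Finset.card_singleton] at h2
  omega

/-- A code orthogonal to a set `U` is shortened on `U` at the price of `U.card - 1` dimensions. -/
theorem finrank_lt_of_dual {T U : Finset (Fin 30)} {S : Submodule (ZMod 2) V} {n k : ℕ}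
    (h : NoCode n k) (hS : IsEvenCode T S) (hU : U ⊆ T) (hU0 : U.Nonempty)
    (hT : T.card = n + U.card) (hd : ∀ v ∈ S, ∑ t ∈ U, v t = 0) :
    Module.finrank (ZMod 2) S + 1 < k + U.card := by
  obtain ⟨x, hx⟩ := hU0
  have h1 : S ⊓ vanishing (U.erase x) = S ⊓ vanishing U := by
    ext v
    simp only [Submodule.mem_inf, mem_vanishing]
    refine and_congr_right fun hv => ⟨fun h2 t ht => ?_, fun h2 t ht => h2 t (Finset.mem_of_mem_erase ht)⟩
    by_cases htx : t = x
    · have h3 := hd v hv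
      rw [← Finset.add_sum_erase _ _ hx, Finset.sum_eq_zero h2, add_zero] at h3
      rw [htx, h3]
    · exact h2 t (Finset.mem_erase.2 ⟨htx, ht⟩)
  have h2 := finrank_le_add_card S (U.erase x)
  have h3 := h _ _ (by rw [Finset.card_sdiff_of_subset hU, hT, Nat.add_sub_cancel]) (hS.shorten U)
  rw [h1, Finset.card_erase_of_mem hx] at h2
  have h4 : 0 < U.card := Finset.card_pos.2 ⟨x, hx⟩
  omega

/-- The functional `v ↦ ∑ t ∈ U, v t` on `S`. -/
def checkSum (S : Submodule (ZMod 2) V) (U : Finset (Fin 30)) : S →ₗ[ZMod 2] ZMod 2 :=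
  (∑ t ∈ U, LinearMap.proj t).comp S.subtype

theorem checkSum_apply (S : Submodule (ZMod 2) V) (U : Finset (Fin 30)) (v : S) :
    checkSum S U v = ∑ t ∈ U, (v : V) t := by
  simp [checkSum]

theorem sum_symmDiff_eq (A B : Finset (Fin 30)) (v : V) :
    ∑ t ∈ symmDiff A B, v t = ∑ t ∈ A, v t + ∑ t ∈ B, v t := by
  have h (A : Finset (Fin 30)) : ∑ t ∈ A, v t = ∑ t, if t ∈ A then v t else 0 := by simp
  rw [h A, h B, h, ← Finset.sum_add_distrib]
  refine Finset.sum_congr rfl fun t _ => ?_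
  by_cases h1 : t ∈ A <;> by_cases h2 : t ∈ B <;> simp [Finset.mem_symmDiff, h1, h2]
  exact (CharTwo.add_self_eq_zero _).symm

/-- More sets of at most `r` coordinates than functionals give a dual word of weight at most `2 r`. -/
theorem exists_dual {T : Finset (Fin 30)} {S : Submodule (ZMod 2) V} (r : ℕ)
    (h : 2 ^ Module.finrank (ZMod 2) S < ∑ i ∈ Finset.range (r + 1), T.card.choose i) :
    ∃ U ⊆ T, U.Nonempty ∧ U.card ≤ 2 * r ∧ ∀ v ∈ S, ∑ t ∈ U, v t = 0 := by
  classical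
  let F := (Finset.range (r + 1)).biUnion fun i => T.powersetCard i
  have hF : F.card = ∑ i ∈ Finset.range (r + 1), T.card.choose i := by
    rw [Finset.card_biUnion fun i _ j _ hij => T.pairwise_disjoint_powersetCard hij]
    simp only [Finset.card_powersetCard]
  have hD : Nat.card (Module.Dual (ZMod 2) S) = 2 ^ Module.finrank (ZMod 2) S := by
    rw [Module.natCard_eq_pow_finrank (K := ZMod 2), Subspace.dual_finrank_eq, Nat.card_zmod]
  have : Finite (Module.Dual (ZMod 2) S) := Nat.finite_of_card_ne_zero (by rw [hD]; positivity)
  have := Fintype.ofFinite (Module.Dual (ZMod 2) S)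
  obtain ⟨A, hA, B, hB, hAB, h2⟩ := Finset.exists_ne_map_eq_of_card_lt_of_maps_to
    (s := F) (t := Finset.univ) (f := fun U => (checkSum S U : Module.Dual (ZMod 2) S))
    (by rw [Finset.card_univ, ← Nat.card_eq_fintype_card, hD, hF]; exact h)
    (fun _ _ => Finset.mem_univ _)
  have hF' {A : Finset (Fin 30)} (hA : A ∈ F) : A ⊆ T ∧ A.card ≤ r := by
    obtain ⟨i, hi, h3⟩ := Finset.mem_biUnion.1 hA
    rw [Finset.mem_powersetCard] at h3
    rw [Finset.mem_range] at hi
    exact ⟨h3.1, by omega⟩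
  refine ⟨symmDiff A B, ?_, ?_, ?_, fun v hv => ?_⟩
  · exact fun t ht => (Finset.mem_symmDiff.1 ht).elim (fun h => (hF' hA).1 h.1) fun h => (hF' hB).1 h.1
  · rw [Finset.nonempty_iff_ne_empty]
    exact fun h => hAB (symmDiff_eq_bot.1 h)
  · have h3 : symmDiff A B ⊆ A ∪ B := symmDiff_le_sup
    have h4 := (Finset.card_le_card h3).trans (Finset.card_union_le A B)
    have := (hF' hA).2
    have := (hF' hB).2
    omega
  · have h3 := congrArg (fun f : Module.Dual (ZMod 2) S => f ⟨v, hv⟩) h2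
    simp only [checkSum_apply] at h3
    rw [sum_symmDiff_eq, h3]
    exact CharTwo.add_self_eq_zero _

/-! ### Power moments -/

/-- The nontrivial character of `ZMod 2`. -/
def chi (a : ZMod 2) : ℤ := if a = 0 then 1 else -1

theorem chi_add (a b : ZMod 2) : chi (a + b) = chi a * chi b := by
  revert a b
  decide

/-- The character sum `∑ t ∈ T, (-1) ^ v t`. -/
def spin (T : Finset (Fin 30)) (v : V) : ℤ := ∑ t ∈ T, chi (v t)

theorem spin_eq (T : Finset (Fin 30)) (v : V) : spin T v = T.card - 2 * wt T v := by
  have h (a : ZMod 2) : chi a = 1 - 2 * if a ≠ 0 then 1 else 0 := by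
    revert a
    decide
  rw [spin, wt, Finset.card_filter]
  simp only [h, Finset.sum_sub_distrib, ← Finset.mul_sum]
  push_cast
  simp

/-- The ordered triples of coordinates that sum to zero on `S`. -/
noncomputable def triples (S : Submodule (ZMod 2) V) (T : Finset (Fin 30)) :
    Finset (Fin 30 × Fin 30 × Fin 30) :=
  open Classical in (T ×ˢ T ×ˢ T).filter fun p => ∀ v ∈ S, v p.1 + v p.2.1 + v p.2.2 = 0

theorem mem_triples {S : Submodule (ZMod 2) V} {T : Finset (Fin 30)} {p : Fin 30 × Fin 30 × Fin 30} :
    p ∈ triples S T ↔ (p.1 ∈ T ∧ p.2.1 ∈ T ∧ p.2.2 ∈ T) ∧ ∀ v ∈ S, v p.1 + v p.2.1 + v p.2.2 = 0 := by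
  simp only [triples, Finset.mem_filter, Finset.mem_product]

theorem ne_of_mem_triples {S : Submodule (ZMod 2) V} {T : Finset (Fin 30)}
    (hB1 : ∀ t ∈ T, ∃ v ∈ S, v t ≠ 0) {p : Fin 30 × Fin 30 × Fin 30}
    (hp : p ∈ triples S T) : p.1 ≠ p.2.1 ∧ p.1 ≠ p.2.2 ∧ p.2.1 ≠ p.2.2 := by
  obtain ⟨⟨h1, h2, h3⟩, h4⟩ := mem_triples.1 hp
  obtain ⟨i, j, l⟩ := p
  simp only at h1 h2 h3 h4
  refine ⟨?_, ?_, ?_⟩ <;> rintro h <;> simp only at h <;> subst h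
  · obtain ⟨v, hv, h5⟩ := hB1 l h3
    exact h5 (by simpa [CharTwo.add_self_eq_zero] using h4 v hv)
  · obtain ⟨v, hv, h5⟩ := hB1 j h2
    exact h5 (by simpa [add_right_comm, CharTwo.add_self_eq_zero] using h4 v hv)
  · obtain ⟨v, hv, h5⟩ := hB1 i h1
    exact h5 (by simpa [add_assoc, CharTwo.add_self_eq_zero] using h4 v hv)

theorem even_card_triples {S : Submodule (ZMod 2) V} {T : Finset (Fin 30)}
    (hB1 : ∀ t ∈ T, ∃ v ∈ S, v t ≠ 0) : Even (triples S T).card := by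
  rw [← ZMod.natCast_eq_zero_iff_even, Finset.card_eq_sum_ones, Nat.cast_sum]
  refine Finset.sum_involution (fun p _ => (p.2.1, p.1, p.2.2)) (fun _ _ => by decide)
    (fun p hp _ h => ?_) (fun p hp => ?_) fun _ _ => rfl
  · exact (ne_of_mem_triples hB1 hp).1 (congrArg Prod.fst h).symm
  · obtain ⟨⟨h1, h2, h3⟩, h4⟩ := mem_triples.1 hp
    exact mem_triples.2 ⟨⟨h2, h1, h3⟩, fun v hv => by rw [add_comm (v _) (v p.1)]; exact h4 v hv⟩

section Moments

variable {S : Submodule (ZMod 2) V} [Fintype S] {T : Finset (Fin 30)} {k : ℕ}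

theorem card_eq_two_pow (hk : Module.finrank (ZMod 2) S = k) : Fintype.card S = 2 ^ k := by
  rw [← Nat.card_eq_fintype_card, Module.natCard_eq_pow_finrank (K := ZMod 2), hk, Nat.card_zmod]

theorem sum_chi_eq_zero {f : S → ZMod 2} (hf : ∀ a b, f (a + b) = f a + f b) {w : S} (hw : f w ≠ 0) : ∑ v, chi (f v) = 0 := by
  have h := Equiv.sum_comp (Equiv.addRight w) fun v => chi (f v)
  have hw' : f w = 1 := (zmod_two_eq_zero_or _).resolve_left hw
  have h1 : chi 1 = -1 := by decide
  simp only [Equiv.coe_addRight, hf, chi_add, hw', h1, mul_neg, mul_one,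
    Finset.sum_neg_distrib] at h
  omega

theorem sum_chi_single (hB1 : ∀ t ∈ T, ∃ v ∈ S, v t ≠ 0) {t : Fin 30} (ht : t ∈ T) :
    ∑ v : S, chi ((v : V) t) = 0 := by
  obtain ⟨w, hw, h⟩ := hB1 t ht
  exact sum_chi_eq_zero (f := fun v : S => (v : V) t) (fun _ _ => rfl) (w := ⟨w, hw⟩) h

theorem sum_spin (hB1 : ∀ t ∈ T, ∃ v ∈ S, v t ≠ 0) : ∑ v : S, spin T v = 0 := by
  simp only [spin]
  rw [Finset.sum_comm]
  exact Finset.sum_eq_zero fun t ht => sum_chi_single hB1 ht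

theorem sum_chi_pair (hk : Module.finrank (ZMod 2) S = k)
    (hB2 : ∀ s ∈ T, ∀ t ∈ T, s ≠ t → ∃ v ∈ S, v s + v t ≠ 0) {s t : Fin 30} (hs : s ∈ T) (ht : t ∈ T) :
    ∑ v : S, chi ((v : V) s + (v : V) t) = if s = t then 2 ^ k else 0 := by
  split_ifs with h
  · subst h
    have h1 : chi 0 = 1 := by decide
    simp [CharTwo.add_self_eq_zero, h1, card_eq_two_pow hk]
  · obtain ⟨w, hw, h2⟩ := hB2 s hs t ht h
    exact sum_chi_eq_zero (f := fun v : S => (v : V) s + (v : V) t)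
      (fun _ _ => add_add_add_comm _ _ _ _) (w := ⟨w, hw⟩) h2

theorem sum_spin_sq (hk : Module.finrank (ZMod 2) S = k)
    (hB2 : ∀ s ∈ T, ∀ t ∈ T, s ≠ t → ∃ v ∈ S, v s + v t ≠ 0) :
    ∑ v : S, spin T v ^ 2 = 2 ^ k * T.card := by
  have h (v : V) : spin T v ^ 2 = ∑ s ∈ T, ∑ t ∈ T, chi (v s + v t) := by
    simp only [spin, sq, Finset.sum_mul_sum, chi_add]
  simp only [h]
  rw [Finset.sum_comm, Finset.sum_congr rfl (g := fun _ => (2 : ℤ) ^ k), Finset.sum_const,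
    nsmul_eq_mul, mul_comm]
  intro s hs
  rw [Finset.sum_comm, Finset.sum_congr rfl fun t ht => sum_chi_pair hk hB2 hs ht]
  simp [hs]

theorem sum_spin_cube (hk : Module.finrank (ZMod 2) S = k) :
    ∑ v : S, spin T v ^ 3 = 2 ^ k * (triples S T).card := by
  classical
  have h (v : V) : spin T v ^ 3 = ∑ p ∈ T ×ˢ T ×ˢ T, chi (v p.1 + v p.2.1 + v p.2.2) := by
    simp only [spin, pow_succ, pow_zero, one_mul, chi_add, Finset.sum_product,
      Finset.mul_sum, Finset.sum_mul]
    exact Finset.sum_congr rfl fun i _ => Finset.sum_congr rfl fun j _ => Finset.sum_congr rfl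
      fun l _ => by ring
  simp only [h]
  rw [Finset.sum_comm, triples, Finset.card_filter]
  push_cast
  rw [Finset.mul_sum]
  refine Finset.sum_congr rfl fun p _ => ?_
  split_ifs with h2
  · have h1 : chi 0 = 1 := by decide
    rw [Finset.sum_congr rfl fun (v : S) _ => by rw [h2 v v.2, h1]]
    simp [card_eq_two_pow hk]
  · push Not at h2
    obtain ⟨w, hw, h3⟩ := h2
    rw [mul_zero]
    exact sum_chi_eq_zero (f := fun v : S => (v : V) p.1 + (v : V) p.2.1 + (v : V) p.2.2)
      (fun a b => by simp only [Submodule.coe_add, Pi.add_apply]; ring) (w := ⟨w, hw⟩) h3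

end Moments

theorem sum_sub_four_mul {ι : Type*} (W : Finset ι) (a : ℤ) (e : ι → ℤ) :
    ∑ v ∈ W, (a - 4 * e v) = a * W.card - 4 * ∑ v ∈ W, e v ∧
      ∑ v ∈ W, (a - 4 * e v) ^ 2 = a ^ 2 * W.card - 8 * a * ∑ v ∈ W, e v + 16 * ∑ v ∈ W, e v ^ 2 ∧
      ∑ v ∈ W, (a - 4 * e v) ^ 3 = a ^ 3 * W.card - 12 * a ^ 2 * ∑ v ∈ W, e v +
        48 * a * ∑ v ∈ W, e v ^ 2 - 64 * ∑ v ∈ W, e v ^ 3 := by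
  induction W using Finset.cons_induction with
  | empty => simp
  | cons x W hx ih =>
    simp only [Finset.sum_cons, Finset.card_cons, ih.1, ih.2.1, ih.2.2]
    push_cast
    refine ⟨?_, ?_, ?_⟩ <;> ring

theorem six_mul_sum_choose {ι : Type*} (W : Finset ι) (e : ι → ℕ) :
    6 * ∑ v ∈ W, ((e v).choose 3 : ℤ) =
      ∑ v ∈ W, (e v : ℤ) ^ 3 - 3 * ∑ v ∈ W, (e v : ℤ) ^ 2 + 2 * ∑ v ∈ W, (e v : ℤ) := by
  have h (n : ℕ) : 6 * (n.choose 3 : ℤ) = (n : ℤ) ^ 3 - 3 * (n : ℤ) ^ 2 + 2 * n := by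
    have h2 (m : ℕ) : 2 * (m.choose 2 : ℤ) = (m : ℤ) ^ 2 - m := by
      induction m with
      | zero => rfl
      | succ m ih =>
        rw [Nat.choose_succ_succ' m 1, Nat.choose_one_right]
        push_cast
        linarith
    induction n with
    | zero => rfl
    | succ n ih =>
      rw [Nat.choose_succ_succ' n 2]
      push_cast
      linarith [h2 n]
  simp only [Finset.mul_sum, ← Finset.sum_sub_distrib, ← Finset.sum_add_distrib, h]

section Bounds

variable {S : Submodule (ZMod 2) V} {T : Finset (Fin 30)}

theorem sum_wt [Fintype S] {k : ℕ} (hS : Module.finrank (ZMod 2) S = k + 1) (T : Finset (Fin 30)) :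
    ∃ m ≤ T.card, ∑ v : S, wt T v = 2 ^ k * m := by
  classical
  refine ⟨(T.filter fun t => ∃ v ∈ S, v t ≠ 0).card, Finset.card_filter_le _ _, ?_⟩
  simp only [wt, Finset.card_filter]
  rw [Finset.sum_comm, Finset.mul_sum]
  refine Finset.sum_congr rfl fun t _ => ?_
  split_ifs with h
  · obtain ⟨w, hw, hwt⟩ := h
    have h1 := sum_chi_eq_zero (f := fun v : S => (v : V) t) (fun _ _ => rfl) (w := ⟨w, hw⟩) hwt
    have h2 (a : ZMod 2) : chi a = 1 - 2 * ((if a ≠ 0 then 1 else 0 : ℕ) : ℤ) := by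
      revert a
      decide
    simp only [h2, Finset.sum_sub_distrib, ← Finset.mul_sum, ← Nat.cast_sum] at h1
    simp only [Finset.sum_const, Finset.card_univ, card_eq_two_pow hS, nsmul_eq_mul, mul_one,
      pow_succ] at h1
    push_cast at h1
    have h3 : (∑ v : S, (if (v : V) t ≠ 0 then 1 else 0 : ℕ) : ℕ) = ((2 ^ k : ℕ) : ℤ) := by
      push_cast
      linarith
    rw [mul_one]
    exact_mod_cast h3
  · push Not at h
    rw [mul_zero]
    exact Finset.sum_eq_zero fun v _ => by simp [h v v.2]

theorem sum_wt_eq [Fintype S] {m : ℕ} (hS : Fintype.card S = m + 1)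
    (h10 : ∀ v ∈ S, v ≠ 0 → 10 ≤ wt T v) : 
    ∑ v : S, wt T v = 10 * m + ∑ v ∈ Finset.univ.erase (0 : S), (wt T v - 10) := by
  classical
  have h1 : (Finset.univ.erase (0 : S)).card = m := by
    rw [Finset.card_erase_of_mem (Finset.mem_univ _), Finset.card_univ, hS, Nat.add_sub_cancel]
  rw [← Finset.add_sum_erase _ _ (Finset.mem_univ (0 : S)), Submodule.coe_zero, wt_zero, zero_add,
    ← h1, mul_comm, ← smul_eq_mul, ← Finset.sum_const, ← Finset.sum_add_distrib]
  refine Finset.sum_congr rfl fun v hv => ?_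
  have := h10 v v.2 fun h => Finset.ne_of_mem_erase hv (Subtype.ext h)
  omega

theorem sum_wt_const [Fintype S] {m : ℕ} (hS : Fintype.card S = m + 1)
    (h10 : ∀ v ∈ S, v ≠ 0 → wt T v = 10) : ∑ v : S, wt T v = 10 * m := by
  classical
  rw [sum_wt_eq hS fun v hv h0 => (h10 v hv h0).ge, Nat.add_eq_left]
  refine Finset.sum_eq_zero fun v hv => ?_
  have := h10 v v.2 fun h => Finset.ne_of_mem_erase hv (Subtype.ext h)
  omega

theorem noCode_19_4 : NoCode 19 4 := by
  refine noCode_of_finrank_ne fun T S hT hS hd => ?_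
  classical
  obtain ⟨m, hm, hsum⟩ := sum_wt hd T
  have hc : Fintype.card S = 15 + 1 := card_eq_two_pow hd
  rw [sum_wt_eq hc fun v hv h0 => (hS.2 v hv h0).2] at hsum
  obtain ⟨t, ht⟩ : ∃ t, ∀ v ∈ S, v t = 0 → v ≠ 0 → wt T v = 10 := by
    by_cases h : ∃ w ∈ S, w ≠ 0 ∧ wt T w ≠ 10
    · obtain ⟨w, hw, hw0, hw10⟩ := h
      obtain ⟨t, ht⟩ := Function.ne_iff.1 hw0
      refine ⟨t, fun v hv hvt hv0 => ?_⟩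
      have h1 : (⟨w, hw⟩ : S) ≠ ⟨v, hv⟩ := fun h => ht (by rw [Subtype.mk.inj h, hvt]; rfl)
      have h2 := Finset.add_le_sum (s := Finset.univ.erase (0 : S)) (f := fun v : S => wt T v - 10)
        (fun _ _ => Nat.zero_le _) (i := ⟨w, hw⟩) (j := ⟨v, hv⟩)
        (by simpa using hw0) (by simpa using hv0) h1
      have h3 := hS.2 w hw hw0
      have h4 := hS.2 v hv hv0
      have h5 := Nat.even_iff.1 h3.1
      have h6 := Nat.even_iff.1 h4.1
      simp only at h2
      omega
    · push Not at h
      exact ⟨0, fun v hv _ h0 => h v hv h0⟩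
  have h1 := finrank_le_add_card S {t}
  rw [Finset.card_singleton] at h1
  obtain ⟨S', hS', hd'⟩ := exists_le_finrank_eq (S := S ⊓ vanishing {t}) (k := 2 + 1) (by omega)
  obtain ⟨m', -, hsum'⟩ := sum_wt hd' T
  have hc' : Fintype.card S' = 7 + 1 := card_eq_two_pow hd'
  have h10 (v : V) (hv : v ∈ S') (h0 : v ≠ 0) : wt T v = 10 :=
    ht v (hS' hv).1 ((hS' hv).2 t (Finset.mem_singleton_self t)) h0
  have h0 := sum_wt_const hc' h10
  omega

theorem noCode_20_5 : NoCode 20 5 := noCode_19_4.succ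

theorem noCode_21_6 : NoCode 21 6 := noCode_20_5.succ

theorem noCode_22_7 : NoCode 22 7 := noCode_21_6.succ

theorem noCode_23_7 : NoCode 23 7 := by
  refine noCode_of_finrank_ne fun T S hT hS hd => ?_
  obtain ⟨U, hUT, hU, hU4, h⟩ := exists_dual (T := T) (S := S) 2 (by rw [hd, hT]; decide)
  have h0 : 0 < U.card := Finset.card_pos.2 hU
  have key {n k : ℕ} (hn : NoCode n k) (h1 : 23 = n + U.card) : 8 < k + U.card := by
    have := finrank_lt_of_dual hn hS hUT hU (hT.trans h1) h
    omega
  have h1 := key (n := 22) noCode_22_7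
  have h2 := key (n := 21) noCode_21_6
  have h3 := key (n := 20) noCode_20_5
  have h4 := key (n := 19) noCode_19_4
  omega

theorem noCode_24_8 : NoCode 24 8 := noCode_23_7.succ

theorem exists_ne_zero_of_noCode {n k : ℕ} (hn : NoCode n k) (hS : IsEvenCode T S)
    (hT : T.card = n + 1) (hd : k ≤ Module.finrank (ZMod 2) S) : ∀ t ∈ T, ∃ v ∈ S, v t ≠ 0 := by
  intro t ht
  by_contra! h
  have := finrank_lt_of_dual (U := {t}) hn hS (by simpa using ht) (by simp) (by simpa using hT)
    (by simpa using h)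
  rw [Finset.card_singleton] at this
  omega

theorem exists_add_ne_zero_of_noCode {n k : ℕ} (hn : NoCode n k) (hS : IsEvenCode T S)
    (hT : T.card = n + 2) (hd : k + 1 ≤ Module.finrank (ZMod 2) S) :
    ∀ s ∈ T, ∀ t ∈ T, s ≠ t → ∃ v ∈ S, v s + v t ≠ 0 := by
  intro s hs t ht hst
  by_contra! h
  have := finrank_lt_of_dual (U := {s, t}) hn hS
    (by simp [Finset.insert_subset_iff, hs, ht]) (by simp) (by rw [Finset.card_pair hst, hT])
    (fun v hv => by rw [Finset.sum_pair hst]; exact h v hv)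
  rw [Finset.card_pair hst] at this
  omega

/-- The first three power moments determine `∑ v, ((wt T v - 10) / 2).choose 3`. -/
theorem exists_moments [Fintype S] {k : ℕ} {a b c : ℤ} (hS : IsEvenCode T S) (hT : T.card = 20 + a)
    (hk : Fintype.card S = k + 1) (h1 : ∑ v : S, spin T v = 0)
    (h2 : ∑ v : S, spin T v ^ 2 = b) (h3 : ∑ v : S, spin T v ^ 3 = c) :
    ∃ x y z X : ℤ, 4 * x = 20 + a + a * k ∧ (20 + a) ^ 2 + a ^ 2 * k - 8 * a * x + 16 * y = b ∧
      (20 + a) ^ 3 + a ^ 3 * k - 12 * a ^ 2 * x + 48 * a * y - 64 * z = c ∧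
      6 * X = z - 3 * y + 2 * x ∧
      (X % 2 = 1 → ∃ v ∈ S, v ≠ 0 ∧ ((wt T v - 10) / 2).choose 3 % 2 = 1) := by
  classical
  let W := Finset.univ.erase (0 : S)
  have hW : W.card = k := by
    rw [Finset.card_erase_of_mem (Finset.mem_univ _), Finset.card_univ, hk, Nat.add_sub_cancel]
  have hs (v : S) (hv : v ∈ W) : spin T v = a - 4 * ((wt T v - 10) / 2 : ℕ) := by
    have h4 := hS.2 v v.2 fun h => Finset.ne_of_mem_erase hv (Subtype.ext h)
    have h5 := Nat.even_iff.1 h4.1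
    rw [spin_eq, hT]
    omega
  have h0 : spin T ((0 : S) : V) = 20 + a := by
    rw [spin_eq, hT, Submodule.coe_zero, wt_zero]
    simp
  obtain ⟨p1, p2, p3⟩ := sum_sub_four_mul W a fun v => (((wt T v - 10) / 2 : ℕ) : ℤ)
  rw [← Finset.add_sum_erase _ _ (Finset.mem_univ (0 : S)), h0] at h1 h2 h3
  change _ + ∑ v ∈ W, _ = _ at h1 h2 h3
  rw [Finset.sum_congr rfl hs, p1, hW] at h1
  rw [Finset.sum_congr rfl fun v hv => by rw [hs v hv], p2, hW] at h2
  rw [Finset.sum_congr rfl fun v hv => by rw [hs v hv], p3, hW] at h3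
  refine ⟨_, _, _, _, by linarith, by linarith, by linarith, six_mul_sum_choose W _, fun h => ?_⟩
  by_contra! h4
  have h5 : Even (∑ v ∈ W, ((((wt T v - 10) / 2).choose 3 : ℕ) : ℤ)) := by
    refine Finset.even_sum _ fun v hv => ?_
    rw [Int.even_coe_nat, Nat.even_iff]
    have := h4 v v.2 fun h => Finset.ne_of_mem_erase hv (Subtype.ext h)
    omega
  rw [Int.even_iff] at h5
  omega

theorem noCode_22_6 : NoCode 22 6 := by
  refine noCode_of_finrank_ne fun T S hT hS hd => ?_
  classical
  have hB1 := exists_ne_zero_of_noCode noCode_21_6 hS hT hd.ge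
  have hB2 := exists_add_ne_zero_of_noCode noCode_20_5 hS hT hd.ge
  have h0 : triples S T = ∅ := by
    rw [Finset.eq_empty_iff_forall_notMem]
    intro p hp
    obtain ⟨h1, h2, h3⟩ := ne_of_mem_triples hB1 hp
    obtain ⟨⟨h4, h5, h6⟩, h7⟩ := mem_triples.1 hp
    have hc : ({p.1, p.2.1, p.2.2} : Finset (Fin 30)).card = 3 := Finset.card_eq_three.2
      ⟨_, _, _, h1, h2, h3, rfl⟩
    have := finrank_lt_of_dual (U := {p.1, p.2.1, p.2.2}) noCode_19_4 hS
      (by simp [Finset.insert_subset_iff, h4, h5, h6]) (by simp) (by rw [hc, hT])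
      (fun v hv => by
        rw [Finset.sum_insert (by simp [h1, h2]), Finset.sum_pair h3, ← add_assoc]
        exact h7 v hv)
    omega
  have hk : Fintype.card S = 63 + 1 := card_eq_two_pow hd
  have h2 := sum_spin_sq hd hB2
  have h3 := sum_spin_cube (T := T) hd
  rw [h0, Finset.card_empty] at h3
  rw [hT] at h2
  obtain ⟨x, y, z, X, e1, e2, e3, e4, hX⟩ := exists_moments (a := 2) hS (by rw [hT]; rfl) hk
    (sum_spin hB1) h2 h3
  norm_num at e1 e2 e3
  obtain ⟨h, hh, h4, h5⟩ := hX (by omega)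
  have h6 := wt_le_card T h
  have h7 := (hS.2 h hh h4).1
  have h16 : wt T h = 16 := by
    rw [hT] at h6
    generalize wt T h = w at *
    interval_cases w <;> revert h5 h7 <;> decide
  exact false_of_finrank_eq_six hT hS.1 hS.2 hd hh h16

end Bounds

theorem wt_add (T : Finset (Fin 30)) (u v : V) : wt T (u + v) + 2 * wt T (u * v) = wt T u + wt T v := by
  have h (a b : ZMod 2) : (if a + b ≠ 0 then 1 else 0) + 2 * (if a * b ≠ 0 then 1 else 0) =
      (if a ≠ 0 then 1 else 0) + (if b ≠ 0 then 1 else 0) := by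
    revert a b
    decide
  simp only [wt, Finset.card_filter, Finset.mul_sum, ← Finset.sum_add_distrib]
  exact Finset.sum_congr rfl fun t _ => h (u t) (v t)

section LengthTwentyFour

variable {S : Submodule (ZMod 2) V} {T : Finset (Fin 30)}

theorem wt_add_of_full {h v : V} (hh : wt T h = T.card) : wt T (h + v) + wt T v = T.card := by
  have h1 : wt T (h * v) = wt T v := by
    rw [wt, Finset.card_filter_eq_iff] at hh
    unfold wt
    congr 1
    refine Finset.filter_congr fun t ht => ?_
    rw [Pi.mul_apply, mul_ne_zero_iff, and_iff_right (hh t ht)]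
  have h2 := wt_add T h v
  omega

theorem ne_twenty_four [Fintype S] (hT : T.card = 24) (hS : IsEvenCode T S)
    (hk : Fintype.card S = 128) (hsq : ∑ v : S, spin T v ^ 2 = 128 * T.card) {h : V} (hh : h ∈ S) :
    wt T h ≠ 24 := by
  intro h24
  classical
  have hh0 : h ≠ 0 := by
    rintro rfl
    rw [wt_zero] at h24
    omega
  have hh0' : (⟨h, hh⟩ : S) ≠ 0 := fun h1 => hh0 (congrArg Subtype.val h1)
  have hspin (v : S) : spin T v ^ 2 = 16 - 16 * (if wt T v % 4 = 0 then 1 else 0) +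
      576 * (if v = 0 then 1 else 0) + 576 * (if v = ⟨h, hh⟩ then 1 else 0) := by
    rw [spin_eq, hT]
    by_cases h1 : v = 0
    · simp [h1, wt_zero, hh0'.symm]
    by_cases h2 : v = ⟨h, hh⟩
    · simp [h2, h24, hh0']
    have h3 := hS.2 v v.2 fun h => h1 (Subtype.ext h)
    have h4 := (hS.2 (h + v) (S.add_mem hh v.2) fun h => h2 (Subtype.ext (by
      rw [← CharTwo.add_eq_zero.1 h]))).2
    have h5 := wt_add_of_full (v := v) (h24.trans hT.symm)
    have h6 := Nat.even_iff.1 h3.1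
    have h7 : wt T v = 10 ∨ wt T v = 12 ∨ wt T v = 14 := by omega
    rw [if_neg h1, if_neg h2]
    obtain h7 | h7 | h7 := h7 <;> rw [h7] <;> norm_num
  let Z : Finset S := Finset.univ.filter fun v => wt T v % 4 = 0
  have hZ : Z.card = 8 := by
    simp only [hspin, Finset.sum_add_distrib, Finset.sum_sub_distrib, ← Finset.mul_sum,
      Finset.sum_ite_eq', Finset.mem_univ, if_true, Finset.sum_const, Finset.card_univ, hk, hT] at hsq
    have h1 : (Z.card : ℤ) = ∑ v : S, if wt T v % 4 = 0 then 1 else 0 := by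
      rw [Finset.card_filter]
      push_cast
      rfl
    rw [← h1] at hsq
    norm_num at hsq
    omega
  obtain ⟨c, hc⟩ : ∃ c, c ∉ Z := by
    by_contra! h1
    rw [Finset.eq_univ_iff_forall.2 h1, Finset.card_univ, hk] at hZ
    omega
  have hev (v : S) : wt T v % 2 = 0 := by
    by_cases h1 : (v : V) = 0
    · rw [h1, wt_zero]
    · exact Nat.even_iff.1 (hS.2 v v.2 h1).1
  have hc2 : wt T c % 4 = 2 := by
    have h1 : wt T c % 4 ≠ 0 := by simpa [Z] using hc
    have := hev c
    omega
  let H : Finset S := Finset.univ.filter fun v => wt T (c * v) % 2 = 0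
  have hpar (u v w : V) : wt T (u * (v + w)) % 2 = (wt T (u * v) + wt T (u * w)) % 2 := by
    have := wt_add T (u * v) (u * w)
    rw [mul_add]
    omega
  have hH : H ⊆ Z ∪ Z.image (c + ·) := by
    intro v hv
    have h1 : wt T (c * v) % 2 = 0 := (Finset.mem_filter.1 hv).2
    rw [Finset.mem_union, Finset.mem_image]
    by_cases h2 : v ∈ Z
    · exact Or.inl h2
    refine Or.inr ⟨c + v, ?_, Subtype.ext (by
      rw [Submodule.coe_add, Submodule.coe_add, ← add_assoc, CharTwo.add_self_eq_zero, zero_add])⟩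
    have h3 : wt T v % 4 ≠ 0 := by simpa [Z] using h2
    have h4 := wt_add T c v
    have h5 := hev v
    refine Finset.mem_filter.2 ⟨Finset.mem_univ _, ?_⟩
    rw [Submodule.coe_add]
    omega
  have hH2 : Hᶜ.card ≤ H.card := by
    obtain h1 | ⟨w, hw⟩ := Hᶜ.eq_empty_or_nonempty
    · simp [h1]
    have hw' : wt T (c * w) % 2 = 1 := by simpa [H] using hw
    refine Finset.card_le_card_of_injOn (w + ·) (fun v hv => ?_) fun _ _ _ _ => add_left_cancel
    have hv' : wt T (c * v) % 2 = 1 := by simpa [H] using hv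
    refine Finset.mem_coe.2 (Finset.mem_filter.2 ⟨Finset.mem_univ _, ?_⟩)
    rw [Submodule.coe_add, hpar]
    omega
  have h1 := Finset.card_add_card_compl H
  have h2 := (Finset.card_le_card hH).trans (Finset.card_union_le _ _)
  have h3 : (Z.image (c + ·)).card ≤ Z.card := Finset.card_image_le
  omega

theorem exists_wt_eq_sixteen (hT : T.card = 24) (hS : IsEvenCode T S)
    (hd : Module.finrank (ZMod 2) S = 7) : ∃ h ∈ S, wt T h = 16 := by
  classical
  have hB1 := exists_ne_zero_of_noCode noCode_23_7 hS hT hd.ge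
  have hB2 := exists_add_ne_zero_of_noCode noCode_22_6 hS hT hd.ge
  have hk : Fintype.card S = 127 + 1 := card_eq_two_pow hd
  have h2 := sum_spin_sq hd hB2
  have h3 := sum_spin_cube (T := T) hd
  obtain ⟨m, hm⟩ := even_card_triples hB1
  obtain ⟨x, y, z, X, e1, e2, e3, e4, hX⟩ := exists_moments (a := 4) hS (by rw [hT]; rfl) hk
    (sum_spin hB1) h2 h3
  rw [hT] at e2
  rw [hm] at e3
  push_cast at e3
  norm_num at e1 e2 e3
  obtain ⟨h, hh, h4, h5⟩ := hX (by omega)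
  have h6 := wt_le_card T h
  have h7 := (hS.2 h hh h4).1
  have h8 := ne_twenty_four hT hS hk h2 hh
  refine ⟨h, hh, ?_⟩
  rw [hT] at h6
  generalize wt T h = w at *
  clear hB1 hB2
  interval_cases w <;> revert h5 h7 h8 <;> decide

end LengthTwentyFour

theorem exists_glueTest : ∀ s ∈ codes, s.length = 7 ∧ ∃ w w', glueTest s w w' = true := by
  intro s hs
  simp only [codes, List.mem_cons, List.not_mem_nil, or_false] at hs
  obtain rfl | rfl | rfl | rfl | rfl | rfl := hs
  · exact ⟨rfl, _, _, glueTest0⟩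
  · exact ⟨rfl, _, _, glueTest1⟩
  · exact ⟨rfl, _, _, glueTest2⟩
  · exact ⟨rfl, _, _, glueTest3⟩
  · exact ⟨rfl, _, _, glueTest4⟩
  · exact ⟨rfl, _, _, glueTest5⟩

theorem covering {K : Submodule (ZMod 2) V} {T : Finset (Fin 30)} (hT : T.card = 24)
    (hK : IsEvenCode T K) (hd : Module.finrank (ZMod 2) K = 7) :
    (∀ q : V, ∑ t ∈ T, q t = 1 → ∃ u ∈ K, wt T (q + u) ≤ 7) ∧
      ∀ q : Fin 5 → V, ∃ i j, i ≠ j ∧ ∃ u ∈ K, wt T (q i + q j + u) ≤ 7 := by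
  obtain ⟨h, hh, h16⟩ := exists_wt_eq_sixteen hT hK hd
  obtain ⟨s, hs, hform⟩ := exists_hasForm hT hK.2 hd
    (exists_ne_zero_of_noCode noCode_23_7 hK hT hd.ge)
    (exists_add_ne_zero_of_noCode noCode_22_6 hK hT hd.ge) hh h16
  obtain ⟨hl, w, w', hg⟩ := exists_glueTest s hs
  exact hform.glue hT hl hg

section LengthThirty

variable {C : Submodule (ZMod 2) V} {P U : Finset (Fin 30)} {x : Fin 30}

theorem card_complement (hP : P.card = 5) (hx : x ∉ P) :
    (Finset.univ \ insert x P : Finset (Fin 30)).card = 24 := by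
  rw [Finset.card_sdiff_of_subset (Finset.subset_univ _), Finset.card_insert_of_notMem hx, hP,
    Finset.card_univ, Fintype.card_fin]

theorem wt_univ {v : V} (hv : v x = 0) :
    wt Finset.univ v = wt (Finset.univ \ insert x P) v + wt P v := by
  have h1 := wt_union (Finset.sdiff_disjoint (s := insert x P) (t := Finset.univ)) v
  rw [Finset.sdiff_union_of_subset (Finset.subset_univ _)] at h1
  rw [h1, wt, wt, wt, Finset.filter_insert, if_neg (not_not.2 hv)]

/-- The restriction of `C` to `P` is as large as the relation `U` permits. -/
theorem exists_restriction_eq (hd : Module.finrank (ZMod 2) C = 12)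
    (hC : IsEvenCode Finset.univ C) (hP : P.card = 5) (hx : x ∉ P) (hUP : U ⊆ P) (hU0 : U.Nonempty)
    (hU : ∀ v ∈ C, v x = 0 → ∑ t ∈ U, v t = 0) :
    Module.finrank (ZMod 2) ↥(C ⊓ vanishing (insert x P)) = 7 ∧
      ∀ g : V, ∑ t ∈ U, g t = 0 → ∃ c ∈ C, c x = 0 ∧ ∀ t ∈ P, c t = g t := by
  obtain ⟨y, hy⟩ := hU0
  have hyP := hUP hy
  have hext {v w : V} (h : ∀ t ∈ P.erase y, v t = w t) (hs : ∑ t ∈ U, v t = ∑ t ∈ U, w t) :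
      ∀ t ∈ P, v t = w t := by
    intro t ht
    by_cases hty : t = y
    · rw [← Finset.sum_erase_add _ _ hy, ← Finset.sum_erase_add _ _ hy, Finset.sum_congr rfl
        fun t ht => h t (Finset.erase_subset_erase y hUP ht)] at hs
      rw [hty]
      exact add_left_cancel hs
    · exact h t (Finset.mem_erase.2 ⟨hty, ht⟩)
  have hmem {v : V} : v ∈ C ⊓ vanishing {x} ↔ v ∈ C ∧ v x = 0 := by
    simp [mem_vanishing]
  have hKeq : C ⊓ vanishing {x} ⊓ vanishing (P.erase y) = C ⊓ vanishing (insert x P) := by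
    ext v
    rw [Submodule.mem_inf, hmem, Submodule.mem_inf, mem_vanishing, mem_vanishing]
    constructor
    · rintro ⟨⟨h1, h2⟩, h3⟩
      refine ⟨h1, Finset.forall_mem_insert _ _ _ |>.2 ⟨h2, ?_⟩⟩
      exact hext (w := 0) h3 ((hU v h1 h2).trans (by simp))
    · rintro ⟨h1, h2⟩
      exact ⟨⟨h1, h2 x (Finset.mem_insert_self _ _)⟩, fun t ht =>
        h2 t (Finset.mem_insert_of_mem (Finset.mem_of_mem_erase ht))⟩
  have h1 := finrank_range_restriction (C ⊓ vanishing {x}) (P.erase y)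
  have h2 := finrank_le_add_card C {x}
  have h3 := noCode_24_8 _ _ (card_complement hP hx) (hC.shorten _)
  have h4 := Submodule.finrank_le (LinearMap.range (restriction (C ⊓ vanishing {x}) (P.erase y)))
  have h5 : Module.finrank (ZMod 2) (↥(P.erase y) → ZMod 2) = 4 := by
    rw [Module.finrank_fintype_fun_eq_card, Fintype.card_coe, Finset.card_erase_of_mem hyP, hP]
  rw [hKeq] at h1
  rw [Finset.card_singleton] at h2
  have h6 := Submodule.eq_top_of_finrank_eq (S := LinearMap.range
    (restriction (C ⊓ vanishing {x}) (P.erase y))) (by omega)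
  refine ⟨by omega, fun g hg => ?_⟩
  obtain ⟨⟨c, hc⟩, hcg⟩ := LinearMap.range_eq_top.1 h6 fun t => g t
  rw [hmem] at hc
  exact ⟨c, hc.1, hc.2, hext (fun t ht => congrFun hcg ⟨t, ht⟩) ((hU c hc.1 hc.2).trans hg.symm)⟩

theorem false_of_relation (hd : Module.finrank (ZMod 2) C = 12)
    (hC : IsEvenCode Finset.univ C) (hP : P.card = 5) (hx : x ∉ P) (hUP : U ⊆ P) (hU0 : U.Nonempty)
    (hU : ∀ v ∈ C, v x = 0 → ∑ t ∈ U, v t = 0) : False := by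
  obtain ⟨hK, hsec⟩ := exists_restriction_eq hd hC hP hx hUP hU0 hU
  obtain ⟨h1, h2⟩ := covering (card_complement hP hx) (hC.shorten _) hK
  have hlow {v : V} (hv : v ∈ C) (hvx : v x = 0) (hv0 : v ≠ 0) :
      10 ≤ wt (Finset.univ \ insert x P) v + wt P v := by
    rw [← wt_univ hvx]
    exact (hC.2 v hv hv0).2
  have hwt {v : V} {A : Finset (Fin 30)} (h : ∀ t ∈ P, t ∉ A → v t = 0) : wt P v ≤ A.card := by
    refine Finset.card_le_card fun t ht => ?_
    rw [Finset.mem_filter] at ht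
    by_contra h3
    exact ht.2 (h t ht.1 h3)
  obtain rfl | hne := eq_or_ne U P
  · obtain ⟨p, hp, hpU⟩ := exists_enum hP
    have hsum (i : Fin 5) : ∑ t ∈ U, (Pi.single (p i) 1 : V) t = 1 := by
      rw [Finset.sum_pi_single', if_pos]
      rw [← hpU]
      exact Finset.mem_image_of_mem _ (Finset.mem_univ _)
    choose q hq hqx hqU using fun i : Fin 5 => hsec (Pi.single (p i) 1 + Pi.single (p 0) 1) (by
      simp only [Pi.add_apply, Finset.sum_add_distrib, hsum]
      rfl)
    obtain ⟨i, j, hij, u, hu, hle⟩ := h2 q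
    have huU (t : Fin 30) (ht : t ∈ U) : u t = 0 := hu.2 t (Finset.mem_insert_of_mem ht)
    have hval (t : Fin 30) (ht : t ∈ U) : (q i + q j + u) t =
        (Pi.single (p i) 1 : V) t + (Pi.single (p j) 1 : V) t := by
      rw [Pi.add_apply, Pi.add_apply, hqU i t ht, hqU j t ht, huU t ht, add_zero, Pi.add_apply,
        Pi.add_apply, add_add_add_comm, CharTwo.add_self_eq_zero ((Pi.single (p 0) 1 : V) t), add_zero]
    have hpi : p i ∈ U := by
      rw [← hpU]
      exact Finset.mem_image_of_mem _ (Finset.mem_univ _)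
    have h3 := hlow (v := q i + q j + u) (C.add_mem (C.add_mem (hq i) (hq j)) hu.1)
      (by simp [hqx, hu.2 x (Finset.mem_insert_self _ _)]) (fun h0 => by
        have h4 := hval (p i) hpi
        rw [h0, Pi.single_eq_same, Pi.single_eq_of_ne (hp.ne hij), add_zero] at h4
        exact zero_ne_one h4)
    have h4 : wt U (q i + q j + u) ≤ ({p i, p j} : Finset (Fin 30)).card := hwt fun t ht h5 => by
      simp only [Finset.mem_insert, Finset.mem_singleton, not_or] at h5
      rw [hval t ht, Pi.single_eq_of_ne h5.1, Pi.single_eq_of_ne h5.2, add_zero]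
    have h5 : ({p i, p j} : Finset (Fin 30)).card ≤ 2 := Finset.card_le_two
    omega
  · obtain ⟨z, hzP, hzU⟩ := Finset.exists_of_ssubset (hUP.ssubset_of_ne hne)
    obtain ⟨c, hc, hcx, hcP⟩ := hsec (Pi.single z 1) (by rw [Finset.sum_pi_single', if_neg hzU])
    have hcz : c z = 1 := by rw [hcP z hzP, Pi.single_eq_same]
    have hc0 : c ≠ 0 := by
      rintro rfl
      exact zero_ne_one hcz
    have hwtP {u : V} (hu : u ∈ vanishing (insert x P)) : wt P (c + u) = 1 := by
      rw [wt, Finset.card_eq_one]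
      refine ⟨z, ?_⟩
      ext t
      simp only [Finset.mem_filter, Finset.mem_singleton]
      constructor
      · rintro ⟨ht, h3⟩
        by_contra h4
        rw [Pi.add_apply, hcP t ht, hu t (Finset.mem_insert_of_mem ht), Pi.single_eq_of_ne h4] at h3
        exact h3 (add_zero 0)
      · rintro rfl
        refine ⟨hzP, ?_⟩
        rw [Pi.add_apply, hcz, hu t (Finset.mem_insert_of_mem hzP)]
        decide
    obtain ⟨u, hu, hle⟩ := h1 c (by
      have h3 := Nat.even_iff.1 (hC.2 c hc hc0).1
      have h4 := hwtP (u := 0) (Submodule.zero_mem _)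
      rw [add_zero] at h4
      rw [wt_univ hcx, h4] at h3
      rw [← wt_cast, ZMod.natCast_eq_one_iff_odd, Nat.odd_iff]
      omega)
    have h3 := hlow (C.add_mem hc hu.1)
      (by simp [hcx, hu.2 x (Finset.mem_insert_self _ _)]) (fun h0 => by
        have h4 := hwtP hu.2
        rw [h0, wt_zero] at h4
        exact zero_ne_one h4)
    have h4 := hwtP hu.2
    omega

theorem false_of_even_code (hd : Module.finrank (ZMod 2) C = 12)
    (hC : IsEvenCode Finset.univ C) : False := by
  obtain ⟨U, -, hU0, hU6, hU⟩ := exists_dual (T := Finset.univ) (S := C) 3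
    (by rw [hd, Finset.card_univ, Fintype.card_fin]; decide)
  obtain h | h : U.card = 6 ∨ U.card ≤ 5 := by omega
  · obtain ⟨x, hx⟩ := hU0
    have hP : (U.erase x).card = 5 := by rw [Finset.card_erase_of_mem hx, h]
    refine false_of_relation hd hC hP (Finset.notMem_erase x U) subset_rfl
      (Finset.card_pos.1 (by omega)) fun v hv hvx => ?_
    have h1 := hU v hv
    rwa [← Finset.add_sum_erase _ _ hx, hvx, zero_add] at h1
  · obtain ⟨P, hUP, hP⟩ := Finset.exists_superset_card_eq h (by simp)
    obtain ⟨x, hx⟩ : ∃ x, x ∉ P := by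
      by_contra! h1
      rw [Finset.eq_univ_iff_forall.2 h1, Finset.card_univ, Fintype.card_fin] at hP
      omega
    exact false_of_relation hd hC hP hx hUP hU0 fun v hv _ => hU v hv

/-- Replace the last coordinate by an overall parity check of the others. -/
def extend : V →ₗ[ZMod 2] V where
  toFun v := Function.update v 29 (∑ t ∈ Finset.univ.erase 29, v t)
  map_add' u v := by
    ext t
    obtain rfl | ht := eq_or_ne t 29
    · simp [Finset.sum_add_distrib]
    · simp [ht]
  map_smul' c v := by
    ext t
    obtain rfl | ht := eq_or_ne t 29
    · simp [mul_sub, Finset.mul_sum]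
    · simp [ht]

theorem false_of_code (hd : Module.finrank (ZMod 2) C = 12)
    (hC : ∀ v ∈ C, v ≠ 0 → 10 ≤ hammingNorm v) : False := by
  have hsplit (v : V) : wt Finset.univ v = wt {29} v + wt (Finset.univ.erase 29) v := by
    rw [← wt_union (by simp), ← Finset.insert_eq, Finset.insert_erase (Finset.mem_univ _)]
  have herase (v : V) : wt (Finset.univ.erase 29) (extend v) = wt (Finset.univ.erase 29) v := by
    refine congrArg Finset.card (Finset.filter_congr fun t ht => ?_)
    change Function.update v 29 _ t ≠ 0 ↔ _
    rw [Function.update_of_ne (Finset.ne_of_mem_erase ht)]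
  have hle (v : V) (hv : v ∈ C) (hv0 : v ≠ 0) : 9 ≤ wt (Finset.univ.erase 29) v := by
    have h1 : 10 ≤ wt Finset.univ v := hC v hv hv0
    have h2 := hsplit v
    have h3 := wt_le_card {29} v
    rw [Finset.card_singleton] at h3
    omega
  have heven (v : V) : Even (wt Finset.univ (extend v)) := by
    rw [← ZMod.natCast_eq_zero_iff_even, wt_cast, ← Finset.add_sum_erase _ _ (Finset.mem_univ 29),
      ← wt_cast, herase, wt_cast]
    change Function.update v 29 _ 29 + _ = _
    rw [Function.update_self]
    exact CharTwo.add_self_eq_zero _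
  refine false_of_even_code (C := C.map extend) ?_ ⟨fun _ _ t ht => absurd (Finset.mem_univ t) ht, ?_⟩
  · have hinj : Function.Injective (extend.comp C.subtype) := by
      rw [injective_iff_map_eq_zero]
      intro v hv
      by_contra h0
      have h1 := hle v v.2 fun h => h0 (Subtype.ext h)
      have h2 : extend v = 0 := hv
      rw [← herase, h2, wt_zero] at h1
      omega
    have h1 := LinearMap.finrank_range_of_inj hinj
    rwa [LinearMap.range_comp, Submodule.range_subtype, hd] at h1
  · rintro _ ⟨v, hv, rfl⟩ h0
    have h1 := hle v hv fun h => h0 (by rw [h, map_zero])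
    have h2 := Nat.even_iff.1 (heven v)
    have h3 := hsplit (extend v)
    rw [herase] at h3
    exact ⟨heven v, by omega⟩

end LengthThirty

end BitGrid

/-- There is no binary linear code of length 30, dimension 12,
and minimum distance at least 10. -/
theorem no_code_30_12_10 :
    ¬ ∃ C : Submodule (ZMod 2) (Fin 30 → ZMod 2),
      Module.finrank (ZMod 2) C = 12 ∧
      ∀ v ∈ C, v ≠ 0 → 10 ≤ hammingNorm v := by
  rintro ⟨C, hd, hC⟩
  exact BitGrid.false_of_code hd hC
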